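/- Nondominated Optional Decomposition Theorem (Theorem 6.1): Assume NA(𝒫) holds, and let V = (V_t)_{t=0}^T be an adapted real-valued process such that V_t is upper semianalytic and Q-integrable for every Q ∈ 𝒬 and every t ∈ {1,…,T}. Then the following are equivalent: (i) V is a supermartingale under every Q ∈ 𝒬; (ii) there exist H ∈ ℋ and an adapted nondecreasing process K with K₀ = 0 such that V_t = V₀ + (H·S)_t − K_t 𝒫-q.s. for every t ∈ {0,1,…,T}. -/

import Mathlib

open MeasureTheory Set Filter Topology
open scoped ENNReal NNReal

noncomputable section

namespace BN

/-- The universal completion of the ambient measurable structure on `α`: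
a set is measurable iff it is null-measurable for every probability measure. -/
def univComp (α : Type*) [MeasurableSpace α] : MeasurableSpace α where
  MeasurableSet' s := ∀ μ : Measure α, IsProbabilityMeasure μ → NullMeasurableSet s μ
  measurableSet_empty := fun _ _ => MeasurableSet.empty.nullMeasurableSet
  measurableSet_compl := fun _ hs μ hμ => (hs μ hμ).compl
  measurableSet_iUnion := fun _ hf μ hμ => NullMeasurableSet.iUnion fun i => hf i μ hμ

/-- `N` is `PP`-polar: it is contained in an `m`-measurable set which is null under
every `P ∈ PP`. -/
def IsPolar {α : Type*} [MeasurableSpace α] (PP : Set (Measure α)) (m : MeasurableSpace α)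
    (N : Set α) : Prop :=
  ∃ A : Set α, MeasurableSet[m] A ∧ N ⊆ A ∧ ∀ P ∈ PP, P A = 0

/-- A property holds `PP`-quasi surely if its complement is `PP`-polar. -/
def QuasiSure {α : Type*} [mα : MeasurableSpace α] (PP : Set (Measure α))
    (m : MeasurableSpace α) (p : α → Prop) : Prop :=
  @IsPolar α mα PP m {ω | ¬ p ω}

/-- Expectation of a real random variable, with the convention
`E[f] = E[f⁺] - E[f⁻]` and `∞ - ∞ = -∞` (which holds in `EReal`). -/
def expec {α : Type*} [MeasurableSpace α] (Q : Measure α) (f : α → ℝ) : EReal :=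
  ((∫⁻ x, ENNReal.ofReal (f x) ∂Q : ℝ≥0∞) : EReal)
    - ((∫⁻ x, ENNReal.ofReal (-f x) ∂Q : ℝ≥0∞) : EReal)

/-- Positive part of an extended real, valued in `ℝ≥0∞`. -/
def posE (x : EReal) : ℝ≥0∞ := if x = ⊤ then ⊤ else ENNReal.ofReal x.toReal

/-- Expectation of an extended-real random variable, with the convention
`E[f] = E[f⁺] - E[f⁻]` and `∞ - ∞ = -∞`. -/
def eexpec {α : Type*} [MeasurableSpace α] (Q : Measure α) (f : α → EReal) : EReal :=
  ((∫⁻ x, posE (f x) ∂Q : ℝ≥0∞) : EReal) - ((∫⁻ x, posE (-(f x)) ∂Q : ℝ≥0∞) : EReal)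

/-- A real-valued function is upper semianalytic if all its strict superlevel sets
are analytic. -/
def UpperSemianalytic {α : Type*} [TopologicalSpace α] (f : α → ℝ) : Prop :=
  ∀ c : ℝ, AnalyticSet {x | c < f x}

/-- An extended-real-valued function is upper semianalytic if all its strict
superlevel sets `{f > c}`, `c ∈ ℝ`, are analytic. -/
def UpperSemianalyticE {α : Type*} [TopologicalSpace α] (f : α → EReal) : Prop :=
  ∀ c : ℝ, AnalyticSet {x | (c : EReal) < f x}

/-- Convexity of a set of probability measures. -/
def ConvexPM {α : Type*} [MeasurableSpace α] (C : Set (ProbabilityMeasure α)) : Prop :=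
  ∀ μ ∈ C, ∀ ν ∈ C, ∀ a b : ℝ≥0∞, a + b = 1 →
    ∀ ξ : ProbabilityMeasure α, (ξ : Measure α) = a • (μ : Measure α) + b • (ν : Measure α) →
      ξ ∈ C

/-! ### The general (non-Polish) setting of Section 2 -/

section General

variable {Ω : Type*} [MeasurableSpace Ω]

/-- Predictability of a trading strategy `H` with respect to a filtration `F`:
the holding `H (u+1)` over the period `(u, u+1]` is `F u`-measurable. -/
def PredictableF (F : ℕ → MeasurableSpace Ω) (T d : ℕ) (H : ℕ → Ω → Fin d → ℝ) : Prop :=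
  ∀ u : ℕ, u < T → Measurable[F u] (H (u + 1))

/-- The final gain `(H · S)_T` from trading `H` in the stocks `S`. -/
def gainF {d : ℕ} (S : ℕ → Ω → Fin d → ℝ) (H : ℕ → Ω → Fin d → ℝ) (T : ℕ) (ω : Ω) : ℝ :=
  ∑ u : Fin T, ∑ i : Fin d, H (u + 1) ω i * (S (u + 1) ω i - S u ω i)

/-- The no-arbitrage condition `NA(PP)` (no options). -/
def NAF (F : ℕ → MeasurableSpace Ω) (T d : ℕ) (S : ℕ → Ω → Fin d → ℝ)
    (PP : Set (Measure Ω)) : Prop :=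
  ∀ H : ℕ → Ω → Fin d → ℝ, PredictableF F T d H →
    QuasiSure PP ‹MeasurableSpace Ω› (fun ω => 0 ≤ gainF S H T ω) →
      QuasiSure PP ‹MeasurableSpace Ω› (fun ω => gainF S H T ω = 0)

/-- The cone `𝒞` of claims superreplicable from zero initial capital. -/
def Cset (F : ℕ → MeasurableSpace Ω) (T d : ℕ) (S : ℕ → Ω → Fin d → ℝ) : Set (Ω → ℝ) :=
  {W | ∃ H : ℕ → Ω → Fin d → ℝ, PredictableF F T d H ∧
    ∃ K : Ω → ℝ, Measurable K ∧ (∀ ω, 0 ≤ K ω) ∧ ∀ ω, W ω = gainF S H T ω - K ω}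

/-- The superhedging price (no options), with values in `EReal` (`inf ∅ = +∞`). -/
def superPriceF (F : ℕ → MeasurableSpace Ω) (T d : ℕ) (S : ℕ → Ω → Fin d → ℝ)
    (PP : Set (Measure Ω)) (f : Ω → ℝ) : EReal :=
  sInf ((fun x : ℝ => (x : EReal)) ''
    {x : ℝ | ∃ H : ℕ → Ω → Fin d → ℝ, PredictableF F T d H ∧
      QuasiSure PP ‹MeasurableSpace Ω› (fun ω => f ω ≤ x + gainF S H T ω)})

end General

/-! ### The one-period setting of Section 3 -/

section OnePeriod

variable {Ω : Type*} [MeasurableSpace Ω] {d : ℕ}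

/-- One-period no-arbitrage condition `NA(PP)` for the increment `ΔS`. -/
def NA1 (PP : Set (Measure Ω)) (ΔS : Ω → Fin d → ℝ) : Prop :=
  ∀ y : Fin d → ℝ,
    QuasiSure PP ‹MeasurableSpace Ω› (fun ω => 0 ≤ ∑ i, y i * ΔS ω i) →
      QuasiSure PP ‹MeasurableSpace Ω› (fun ω => ∑ i, y i * ΔS ω i = 0)

/-- The martingale measures dominated by `PP` in the one-period market:
`𝒬 = {Q : Q ⋘ 𝒫, E_Q[ΔS] = 0}`. -/
def Q1set (PP : Set (Measure Ω)) (ΔS : Ω → Fin d → ℝ) : Set (Measure Ω) :=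
  {Q | IsProbabilityMeasure Q ∧ (∃ P ∈ PP, Q ≪ P) ∧
    ∀ i, expec Q (fun ω => ΔS ω i) = 0}

/-- One-period superhedging price, with values in `EReal` (`inf ∅ = +∞`). -/
def superPrice1 (PP : Set (Measure Ω)) (ΔS : Ω → Fin d → ℝ) (f : Ω → ℝ) : EReal :=
  sInf ((fun x : ℝ => (x : EReal)) ''
    {x : ℝ | ∃ H : Fin d → ℝ,
      QuasiSure PP ‹MeasurableSpace Ω› (fun ω => f ω ≤ x + ∑ i, H i * ΔS ω i)})

end OnePeriod

/-! ### The Polish multi-period setting -/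

section Polish

variable (Ω₁ : Type) [MeasurableSpace Ω₁]

/-- Restriction of a path up to time `t`. -/
def restr {T : ℕ} (t : ℕ) (h : t ≤ T) (ω : Fin T → Ω₁) : Fin t → Ω₁ :=
  fun i => ω (Fin.castLE h i)

/-- Universally measurable predictability: `H u` (the holding over `(u, u+1]`)
is a universally measurable function of the first `u` coordinates. -/
def Pred (d : ℕ) (H : (u : ℕ) → (Fin u → Ω₁) → Fin d → ℝ) : Prop :=
  ∀ u : ℕ, @Measurable _ _ (univComp (Fin u → Ω₁)) _ (H u)

/-- The gain `(H · S)_t = ∑_{u=1}^t H_u (S_u - S_{u-1})` up to time `t ≤ T`. -/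
def gain {T d : ℕ} (S : (t : ℕ) → (Fin t → Ω₁) → Fin d → ℝ)
    (H : (u : ℕ) → (Fin u → Ω₁) → Fin d → ℝ) (t : ℕ) (h : t ≤ T) (ω : Fin T → Ω₁) : ℝ :=
  ∑ u : Fin t, ∑ i : Fin d,
    H u (restr Ω₁ u (u.2.le.trans h) ω) i *
      (S (u + 1) (restr Ω₁ (u + 1) (Nat.succ_le_of_lt (u.2.trans_le h)) ω) i
        - S u (restr Ω₁ u (u.2.le.trans h) ω) i)

variable [TopologicalSpace Ω₁] [OpensMeasurableSpace Ω₁]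

/-- The set `PP = {P₀ ⊗ ⋯ ⊗ P_{t-1}}` of measures built from universally
measurable selectors of the one-step collections `𝒫_s(·)`. -/
def MeasFam (Pt : (t : ℕ) → (Fin t → Ω₁) → Set (ProbabilityMeasure Ω₁)) :
    (t : ℕ) → Set (Measure (Fin t → Ω₁))
  | 0 => {μ | μ = Measure.dirac Fin.elim0}
  | (t + 1) => {μ | ∃ ν ∈ MeasFam Pt t, ∃ κ : (Fin t → Ω₁) → ProbabilityMeasure Ω₁,
      @Measurable _ _ (univComp (Fin t → Ω₁)) (borel (ProbabilityMeasure Ω₁)) κ ∧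
      (∀ ω, κ ω ∈ Pt t ω) ∧
      μ = ν.bind (fun ω => Measure.map (Fin.snoc ω) (κ ω : Measure Ω₁))}

/-- The σ-field `ℱ_t` on `Ω = Ω₁^T`: the comap under the restriction map of the
universal completion of the Borel σ-field of `Ω₁^t`. -/
def filtr (T : ℕ) (t : ℕ) (h : t ≤ T) : MeasurableSpace (Fin T → Ω₁) :=
  MeasurableSpace.comap (restr Ω₁ t h) (univComp (Fin t → Ω₁))

/-- `S` is a `Q`-martingale with respect to the filtration `(ℱ_t)`. -/
def IsMartMeas {T d : ℕ} (S : (t : ℕ) → (Fin t → Ω₁) → Fin d → ℝ)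
    (Q : Measure (Fin T → Ω₁)) : Prop :=
  (∀ (t : ℕ) (h : t ≤ T) (i : Fin d), Integrable (fun ω => S t (restr Ω₁ t h ω) i) Q) ∧
  (∀ (t : ℕ) (h : t + 1 ≤ T) (i : Fin d) (A : Set (Fin T → Ω₁)),
    MeasurableSet[filtr Ω₁ T t ((Nat.le_succ t).trans h)] A →
      ∫ ω in A, S (t + 1) (restr Ω₁ (t + 1) h ω) i ∂Q
        = ∫ ω in A, S t (restr Ω₁ t ((Nat.le_succ t).trans h) ω) i ∂Q)

/-- The martingale measures `Q ⋘ PP` consistent with the option prices: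
`𝒬 = {Q ⋘ PP : S is a Q-martingale, E_Q[gⁱ] = 0}`. -/
def QSet {T d e : ℕ} (PP : Set (Measure (Fin T → Ω₁)))
    (S : (t : ℕ) → (Fin t → Ω₁) → Fin d → ℝ) (g : Fin e → (Fin T → Ω₁) → ℝ) :
    Set (Measure (Fin T → Ω₁)) :=
  {Q | IsProbabilityMeasure Q ∧ (∃ P ∈ PP, Q ≪ P) ∧ IsMartMeas Ω₁ S Q ∧
    ∀ i : Fin e, expec Q (g i) = 0}

/-- The no-arbitrage condition `NA(PP)` with semistatic trading in the stocks `S`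
and the options `g`. -/
def NA {T d e : ℕ} (PP : Set (Measure (Fin T → Ω₁)))
    (S : (t : ℕ) → (Fin t → Ω₁) → Fin d → ℝ) (g : Fin e → (Fin T → Ω₁) → ℝ) : Prop :=
  ∀ H : (u : ℕ) → (Fin u → Ω₁) → Fin d → ℝ, Pred Ω₁ d H → ∀ h : Fin e → ℝ,
    QuasiSure PP (univComp (Fin T → Ω₁))
      (fun ω => 0 ≤ gain Ω₁ S H T le_rfl ω + ∑ i, h i * g i ω) →
    QuasiSure PP (univComp (Fin T → Ω₁))
      (fun ω => gain Ω₁ S H T le_rfl ω + ∑ i, h i * g i ω = 0)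

/-- The minimal semistatic superhedging price, valued in `EReal` (`inf ∅ = +∞`). -/
def superPrice {T d e : ℕ} (PP : Set (Measure (Fin T → Ω₁)))
    (S : (t : ℕ) → (Fin t → Ω₁) → Fin d → ℝ) (g : Fin e → (Fin T → Ω₁) → ℝ)
    (f : (Fin T → Ω₁) → ℝ) : EReal :=
  sInf ((fun x : ℝ => (x : EReal)) ''
    {x : ℝ | ∃ H : (u : ℕ) → (Fin u → Ω₁) → Fin d → ℝ, ∃ h : Fin e → ℝ, Pred Ω₁ d H ∧
      QuasiSure PP (univComp (Fin T → Ω₁))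
        (fun ω => f ω ≤ x + gain Ω₁ S H T le_rfl ω + ∑ i, h i * g i ω)})

/-- `f` is replicable by semistatic trading. -/
def Replicable {T d e : ℕ} (PP : Set (Measure (Fin T → Ω₁)))
    (S : (t : ℕ) → (Fin t → Ω₁) → Fin d → ℝ) (g : Fin e → (Fin T → Ω₁) → ℝ)
    (f : (Fin T → Ω₁) → ℝ) : Prop :=
  ∃ x : ℝ, ∃ H : (u : ℕ) → (Fin u → Ω₁) → Fin d → ℝ, ∃ h : Fin e → ℝ, Pred Ω₁ d H ∧
    QuasiSure PP (univComp (Fin T → Ω₁))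
      (fun ω => x + gain Ω₁ S H T le_rfl ω + ∑ i, h i * g i ω = f ω)

/-- The one-period increment `ΔS_{t+1}(ω, ·)` of the stock, given history `ω ∈ Ω_t`. -/
def incr {d : ℕ} (S : (t : ℕ) → (Fin t → Ω₁) → Fin d → ℝ) (t : ℕ) (ω : Fin t → Ω₁)
    (x : Ω₁) : Fin d → ℝ :=
  fun i => S (t + 1) (Fin.snoc ω x) i - S t ω i

/-- The one-step martingale measures `𝒬_t(ω)` dominated by `𝒫_t(ω)`. -/
def Q1fam {d : ℕ} (Pt : (t : ℕ) → (Fin t → Ω₁) → Set (ProbabilityMeasure Ω₁))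
    (S : (t : ℕ) → (Fin t → Ω₁) → Fin d → ℝ) (t : ℕ) (ω : Fin t → Ω₁) :
    Set (ProbabilityMeasure Ω₁) :=
  {Q | (∃ P' ∈ Pt t ω, (Q : Measure Ω₁) ≪ (P' : Measure Ω₁)) ∧
    ∀ i, expec (Q : Measure Ω₁) (fun x => incr Ω₁ S t ω x i) = 0}

/-- `V` is a `Q`-supermartingale with respect to the filtration `(ℱ_t)`:
each `V_t` is `Q`-integrable and `E_Q[V_{t+1} | ℱ_t] ≤ V_t`. -/
def IsSupermart {T : ℕ} (V : ℕ → (Fin T → Ω₁) → ℝ) (Q : Measure (Fin T → Ω₁)) : Prop :=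
  (∀ t : ℕ, t ≤ T → Integrable (V t) Q) ∧
  ∀ (t : ℕ) (h : t + 1 ≤ T) (A : Set (Fin T → Ω₁)),
    MeasurableSet[filtr Ω₁ T t ((Nat.le_succ t).trans h)] A →
      ∫ ω in A, V (t + 1) ω ∂Q ≤ ∫ ω in A, V t ω ∂Q

end Polish

/-! ### Quasi-sure supports -/

/-- The quasi-sure support of a family of measures on `ℝ^d`. -/
def qsSupp {d : ℕ} (Rs : Set (Measure (Fin d → ℝ))) : Set (Fin d → ℝ) :=
  ⋂₀ {A : Set (Fin d → ℝ) | IsClosed A ∧ ∀ R ∈ Rs, R A = 1}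

end BN

set_option linter.unusedSectionVars false

namespace BN

/-! ### The universal completion -/

section UnivComp

variable {α β : Type*} [mα : MeasurableSpace α] [mβ : MeasurableSpace β]

theorem le_univComp : mα ≤ univComp α := fun _ hs _ _ => hs.nullMeasurableSet

theorem aemeasurable_of_univComp [MeasurableSpace.CountablyGenerated β] {f : α → β}
    (hf : Measurable[univComp α] f) (μ : Measure α) [hμ : IsProbabilityMeasure μ] :
    AEMeasurable f μ :=
  NullMeasurable.aemeasurable fun _ hs => hf hs μ hμ

theorem measurable_univComp_univComp [MeasurableSpace.CountablyGenerated β] {f : α → β}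
    (hf : Measurable[univComp α] f) : Measurable[univComp α, univComp β] f := by
  intro s hs μ hμ
  have hae := aemeasurable_of_univComp hf μ
  have := Measure.isProbabilityMeasure_map hae
  exact (hs (μ.map f) this).preimage
    ⟨hae.measurable_mk, by rw [Measure.map_congr hae.ae_eq_mk]⟩ |>.congr
      (hae.ae_eq_mk.symm.preimage s)

end UnivComp

/-! ### Analytic sets: approximation from inside, universal measurability -/

section Analytic

/-- Sequences whose first `n` entries are bounded by `l`. -/
def boundedCyl {n : ℕ} (l : Fin n → ℕ) : Set (ℕ → ℕ) := {σ | ∀ i : Fin n, σ i ≤ l i}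

theorem isCompact_setOf_forall_le (k : ℕ → ℕ) : IsCompact {σ : ℕ → ℕ | ∀ i, σ i ≤ k i} := by
  have : {σ : ℕ → ℕ | ∀ i, σ i ≤ k i} = Set.pi univ fun i => Set.Iic (k i) := by
    ext; simp [Pi.le_def]
  rw [this]
  exact isCompact_univ_pi fun i => (Set.finite_Iic _).isCompact

theorem exists_boundedCyl_subset (k : ℕ → ℕ) {O : Set (ℕ → ℕ)} (hO : IsOpen O)
    (hK : {σ : ℕ → ℕ | ∀ i, σ i ≤ k i} ⊆ O) :
    ∃ n : ℕ, boundedCyl (fun i : Fin n => k i) ⊆ O := by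
  by_contra! hcon
  simp only [not_subset] at hcon
  choose σ hσ hσO using hcon
  have hcomp := isCompact_setOf_forall_le k
  obtain ⟨τ, hτ, φ, hφ, hlim⟩ := hcomp.tendsto_subseq (x := fun n i => min (σ n i) (k i))
    fun n i => min_le_right _ _
  have hlim' : Tendsto (fun n => σ (φ n)) atTop (𝓝 τ) := by
    rw [tendsto_pi_nhds] at hlim ⊢
    intro i
    refine (hlim i).congr' ?_
    filter_upwards [eventually_gt_atTop i] with n hn
    have := hσ (φ n) ⟨i, hn.trans_le (hφ.id_le n)⟩
    simpa using this
  exact (hO.isClosed_compl.mem_of_tendsto hlim' (Eventually.of_forall fun n => hσO _)) (hK hτ)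

theorem iInter_closure_image_boundedCyl_subset {X : Type*} [TopologicalSpace X] [T2Space X]
    {f : (ℕ → ℕ) → X} (hf : Continuous f) (k : ℕ → ℕ) :
    ⋂ n : ℕ, closure (f '' boundedCyl (fun i : Fin n => k i)) ⊆ range f := by
  intro z hz
  by_contra hzr
  have hcomp := isCompact_setOf_forall_le k
  obtain ⟨U, V, hU, hV, hKU, hzV, hUV⟩ := SeparatedNhds.of_isCompact_isCompact
    (hcomp.image hf) (isCompact_singleton (x := z))
    (by rw [Set.disjoint_singleton_right]; exact fun h => hzr (image_subset_range _ _ h))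
  obtain ⟨n, hn⟩ := exists_boundedCyl_subset k (hU.preimage hf) (image_subset_iff.1 hKU)
  have hz' := mem_iInter.1 hz n
  obtain ⟨y, hyV, hyU⟩ := mem_closure_iff.1 hz' V hV (hzV rfl)
  exact hUV.le_bot ⟨image_subset_iff.2 hn hyU, hyV⟩

theorem exists_forall_lt_measure_boundedCyl {Z : Type*} [MeasurableSpace Z] (μ : Measure Z)
    (A : Set (ℕ → ℕ) → Set Z) (hA : ∀ s : ℕ → Set (ℕ → ℕ), A (⋃ i, s i) = ⋃ i, A (s i))
    (hmono : Monotone A) {c : ℝ≥0∞} (hc : c < μ (A univ)) :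
    ∃ k : ℕ → ℕ, ∀ n : ℕ, c < μ (A (boundedCyl (fun i : Fin n => k i))) := by
  have step : ∀ (n : ℕ) (k : {k : ℕ → ℕ // c < μ (A (boundedCyl (fun i : Fin n => k i)))}),
      ∃ k' : {k : ℕ → ℕ // c < μ (A (boundedCyl (fun i : Fin (n + 1) => k i)))},
        ∀ i < n, k'.1 i = k.1 i := by
    rintro n ⟨k, hk⟩
    have hU : boundedCyl (fun i : Fin n => k i)
        = ⋃ m, boundedCyl (fun i : Fin (n + 1) => Function.update k n m i) := by
      ext σ
      simp only [boundedCyl, mem_ofPred_eq, mem_iUnion]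
      refine ⟨fun h => ⟨σ n, fun i => ?_⟩, fun ⟨m, h⟩ i => ?_⟩
      · rcases eq_or_ne (i : ℕ) n with hi | hi
        · simp [hi]
        · rw [Function.update_of_ne hi]
          exact h ⟨i, by omega⟩
      · have := h i.castSucc
        rwa [Function.update_of_ne (by simpa using i.2.ne)] at this
    rw [hU, hA] at hk
    have hmon : Monotone fun m => A (boundedCyl (fun i : Fin (n + 1) => Function.update k n m i)) := by
      intro m m' hm
      refine hmono fun σ hσ i => (hσ i).trans ?_
      rcases eq_or_ne (i : ℕ) n with hi | hi
      · simpa [hi] using hm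
      · simp [Function.update_of_ne hi]
    rw [hmon.directed_le.measure_iUnion, lt_iSup_iff] at hk
    obtain ⟨m, hm⟩ := hk
    exact ⟨⟨_, hm⟩, fun i hi => Function.update_of_ne hi.ne _ _⟩
  choose F hF using step
  have h0 : c < μ (A (boundedCyl (fun i : Fin 0 => (fun _ => 0 : ℕ → ℕ) i))) := by
    convert hc using 3
    ext; simp [boundedCyl]
  let K : (n : ℕ) → {k : ℕ → ℕ // c < μ (A (boundedCyl (fun i : Fin n => k i)))} :=
    fun n => Nat.rec ⟨fun _ => 0, h0⟩ (fun n k => F n k) n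
  have hK : ∀ n i, i < n → (K n).1 i = (K (i + 1)).1 i := by
    intro n
    induction n with
    | zero => intro i hi; omega
    | succ n ih =>
      intro i hi
      rcases Nat.lt_succ_iff_lt_or_eq.1 hi with h | rfl
      · rw [← ih i h]; exact hF n (K n) i h
      · rfl
  refine ⟨fun i => (K (i + 1)).1 i, fun n => ?_⟩
  have := (K n).2
  simp_rw [fun i : Fin n => hK n i i.2] at this
  exact this

theorem measurableSet_univComp_of_analyticSet {X : Type*} [TopologicalSpace X] [T2Space X]
    [MeasurableSpace X] [OpensMeasurableSpace X] {A : Set X} (hA : AnalyticSet A) :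
    MeasurableSet[univComp X] A := by
  rw [AnalyticSet] at hA
  rcases hA with rfl | ⟨f, hf, rfl⟩
  · exact @MeasurableSet.empty X (univComp X)
  intro μ hμ
  have key : ∀ c < μ (range f), ∃ C ⊆ range f, MeasurableSet C ∧ c ≤ μ C := by
    intro c hc
    obtain ⟨k, hk⟩ := exists_forall_lt_measure_boundedCyl μ (fun s => f '' s)
      (fun s => image_iUnion) (fun s t h => image_mono h) (by simpa using hc)
    refine ⟨_, iInter_closure_image_boundedCyl_subset hf k,
      MeasurableSet.iInter fun n => isClosed_closure.measurableSet, ?_⟩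
    rw [measure_iInter_eq_iInf_measure_iInter_le
      (fun n => isClosed_closure.measurableSet.nullMeasurableSet) ⟨0, measure_ne_top _ _⟩]
    refine le_iInf fun n => (hk n).le.trans (measure_mono ?_)
    refine subset_iInter₂ fun m hm => subset_closure.trans (closure_mono (image_mono ?_))
    exact fun σ hσ i => hσ (i.castLE hm)
  rcases eq_or_ne (μ (range f)) 0 with h0 | h0
  · exact NullMeasurableSet.of_null h0
  obtain ⟨u, -, hu, hlim⟩ := exists_seq_strictMono_tendsto' (bot_lt_iff_ne_bot.2 h0)
  choose C hCs hCm hC using fun n => key (u n) (hu n).2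
  refine NullMeasurableSet.congr (MeasurableSet.iUnion hCm).nullMeasurableSet (s := ⋃ n, C n) ?_
  refine ae_eq_of_subset_of_measure_ge (iUnion_subset hCs) ?_
    (MeasurableSet.iUnion hCm).nullMeasurableSet (measure_ne_top _ _)
  exact le_of_tendsto' hlim fun n => (hC n).trans (measure_mono (subset_iUnion _ n))

/-- **Jankov-von Neumann selection**. -/
theorem exists_univComp_selection {X Z : Type*} [TopologicalSpace X] [T2Space X]
    [MeasurableSpace X] [OpensMeasurableSpace X] [TopologicalSpace Z] [MeasurableSpace Z]
    [BorelSpace Z] [Nonempty Z] {A : Set (X × Z)} (hA : AnalyticSet A) :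
    ∃ φ : X → Z, Measurable[univComp X] φ ∧ ∀ x z, (x, z) ∈ A → (x, φ x) ∈ A := by
  rw [AnalyticSet] at hA
  rcases hA with rfl | ⟨f, hf, rfl⟩
  · exact ⟨fun _ => Classical.arbitrary Z, measurable_const, by simp⟩
  let U : {n : ℕ} → (Fin n → ℕ) → Set X := fun l => (fun σ => (f σ).1) '' {σ | ∀ i : Fin _, σ i = l i}
  have hU : ∀ {n : ℕ} (l : Fin n → ℕ), MeasurableSet[univComp X] (U l) := by
    intro n l
    refine measurableSet_univComp_of_analyticSet ?_
    refine AnalyticSet.image_of_continuous (IsClosed.analyticSet ?_) hf.fst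
    have : {σ : ℕ → ℕ | ∀ i : Fin n, σ i = l i} = ⋂ i : Fin n, {σ | σ i = l i} := by ext; simp
    rw [this]
    exact isClosed_iInter fun i => isClosed_eq (continuous_apply _) continuous_const
  generalize univComp X = m at hU ⊢
  have hex : ∀ {n : ℕ} (l : Fin n → ℕ) (x : X),
      ∃ m : ℕ, x ∈ U l → x ∈ U (Fin.snoc (α := fun _ => ℕ) l m) := by
    intro n l x
    by_cases hx : x ∈ U l
    · obtain ⟨σ, hσ, rfl⟩ := hx
      refine ⟨σ n, fun _ => ⟨σ, fun i => ?_, rfl⟩⟩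
      refine Fin.lastCases ?_ (fun i => ?_) i
      · simp
      · simpa using hσ i
    · exact ⟨0, fun h => absurd h hx⟩
  classical
  let s : (n : ℕ) → X → (Fin n → ℕ) := fun n => Nat.rec (fun _ => Fin.elim0)
    (fun n s x => Fin.snoc (α := fun _ => ℕ) (s x) (Nat.find (hex (s x) x))) n
  have hs : ∀ n, Measurable (s n) := by
    intro n
    induction n with
    | zero => exact measurable_const
    | succ n ih =>
      have h1 : ∀ l : Fin n → ℕ, Measurable fun x => Nat.find (hex l x) := by
        intro l
        refine measurable_find _ fun k => ?_
        have : {x | x ∈ U l → x ∈ U (Fin.snoc (α := fun _ => ℕ) l k)}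
            = (U l)ᶜ ∪ U (Fin.snoc (α := fun _ => ℕ) l k) := by
          ext x; simp [imp_iff_not_or]
        rw [this]
        exact (hU l).compl.union (hU _)
      have h2 : ∀ l : Fin n → ℕ, Measurable fun x =>
          (Fin.snoc (α := fun _ => ℕ) l (Nat.find (hex l x)) : Fin (n + 1) → ℕ) := fun l =>
        (measurable_of_countable fun m : ℕ => (Fin.snoc (α := fun _ => ℕ) l m : Fin (n+1) → ℕ)).comp
          (h1 l)
      intro B hB
      have : s (n + 1) ⁻¹' B = ⋃ l : Fin n → ℕ, (s n ⁻¹' {l}) ∩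
          (fun x => (Fin.snoc (α := fun _ => ℕ) l (Nat.find (hex l x)) : Fin (n + 1) → ℕ)) ⁻¹' B := by
        ext x
        simp [s]
      rw [this]
      exact MeasurableSet.iUnion fun l => (ih (measurableSet_singleton l)).inter (h2 l hB)
  let σ : X → ℕ → ℕ := fun x n => s (n + 1) x (Fin.last n)
  have hσ : Measurable σ :=
    measurable_pi_lambda _ fun n => (measurable_pi_apply (Fin.last n)).comp (hs (n + 1))
  have hcoh : ∀ n x (i : Fin n), s n x i = σ x i := by
    intro n x
    induction n with
    | zero => exact fun i => i.elim0
    | succ n ih =>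
      intro i
      refine Fin.lastCases rfl (fun i => ?_) i
      have : s (n + 1) x i.castSucc = s n x i := by simp [s]
      rw [this, ih i]; rfl
  refine ⟨fun x => (f (σ x)).2, (hf.snd.measurable).comp hσ, ?_⟩
  rintro x z ⟨τ, hτ⟩
  have hmem : ∀ n, x ∈ U (s n x) := by
    intro n
    induction n with
    | zero => exact ⟨τ, fun i => i.elim0, by simp [hτ]⟩
    | succ n ih => exact Nat.find_spec (hex (s n x) x) ih
  choose ρ hρ hρx using hmem
  have hlim : Tendsto ρ atTop (𝓝 (σ x)) := by
    rw [tendsto_pi_nhds]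
    intro i
    refine tendsto_const_nhds.congr' ?_
    filter_upwards [eventually_gt_atTop i] with n hn
    rw [hρ n ⟨i, hn⟩, hcoh n x ⟨i, hn⟩]
  have h1 := ((hf.fst.tendsto (σ x)).comp hlim)
  have h2 : (f (σ x)).1 = x :=
    tendsto_nhds_unique h1 (tendsto_const_nhds.congr fun n => (hρx n).symm)
  exact ⟨σ x, Prod.ext h2 rfl⟩

end Analytic

/-! ### Kernels and analytic sets -/

section KernelAnalytic

open ProbabilityTheory

variable {Z Y : Type*} [TopologicalSpace Z] [PolishSpace Z] [MeasurableSpace Z] [BorelSpace Z]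
  [TopologicalSpace Y] [PolishSpace Y] [MeasurableSpace Y] [BorelSpace Y]

/-- Sections of an analytic set have upper semianalytic measure under a kernel. -/
theorem analyticSet_lt_kernel (k : Kernel Z Y) [IsMarkovKernel k] {A : Set (Z × Y)}
    (hA : AnalyticSet A) (c : ℝ≥0∞) : AnalyticSet {z | c < k z (Prod.mk z ⁻¹' A)} := by
  rw [AnalyticSet] at hA
  rcases hA with rfl | ⟨f, hf, rfl⟩
  · simp [analyticSet_empty]
  let C : {n : ℕ} → (Fin n → ℕ) → Set (Z × Y) := fun l => closure (f '' boundedCyl l)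
  have hmeas : ∀ n : ℕ, Measurable fun p : Z × (ℕ → ℕ) =>
      k p.1 (Prod.mk p.1 ⁻¹' C (fun i : Fin n => p.2 i)) := by
    intro n
    have h1 : Measurable fun q : Z × (Fin n → ℕ) => k q.1 (Prod.mk q.1 ⁻¹' C q.2) := by
      refine measurable_from_prod_countable_left fun l => ?_
      exact Kernel.measurable_kernel_prodMk_left (t := C l) isClosed_closure.measurableSet
    exact h1.comp (measurable_fst.prodMk
      (measurable_pi_lambda _ fun i => (measurable_pi_apply _).comp measurable_snd))
  let E : ℚ → Set (Z × (ℕ → ℕ)) := fun q =>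
    ⋂ n : ℕ, {p | c < ((q : ℝ).toNNReal : ℝ≥0∞) ∧
      ((q : ℝ).toNNReal : ℝ≥0∞) ≤ k p.1 (Prod.mk p.1 ⁻¹' C (fun i : Fin n => p.2 i))}
  have hE : ∀ q, MeasurableSet (E q) := fun q => MeasurableSet.iInter fun n =>
    (MeasurableSet.const _).inter (measurableSet_le measurable_const (hmeas n))
  have : {z | c < k z (Prod.mk z ⁻¹' range f)} = ⋃ q, Prod.fst '' E q := by
    ext z
    simp only [mem_ofPred_eq, mem_iUnion, mem_image, Prod.exists, exists_and_right,
      exists_eq_right]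
    constructor
    · intro h
      obtain ⟨q, -, hcq, hq⟩ := ENNReal.lt_iff_exists_rat_btwn.1 h
      obtain ⟨κ, hκ⟩ := exists_forall_lt_measure_boundedCyl (k z)
        (fun s => Prod.mk z ⁻¹' (f '' s)) (fun s => by simp [image_iUnion])
        (fun s t h => preimage_mono (image_mono h)) (by simpa using hq)
      refine ⟨q, κ, mem_iInter.2 fun n => ⟨hcq, (hκ n).le.trans (measure_mono ?_)⟩⟩
      exact preimage_mono subset_closure
    · rintro ⟨q, κ, h⟩
      have h' := fun n => mem_iInter.1 h n
      refine (h' 0).1.trans_le ?_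
      have hsub : ⋂ n : ℕ, Prod.mk z ⁻¹' C (fun i : Fin n => κ i) ⊆ Prod.mk z ⁻¹' range f := by
        rw [← preimage_iInter]
        exact preimage_mono (iInter_closure_image_boundedCyl_subset hf κ)
      refine le_trans ?_ (measure_mono hsub)
      rw [measure_iInter_eq_iInf_measure_iInter_le
        (fun n => (isClosed_closure.measurableSet.preimage
          measurable_prodMk_left).nullMeasurableSet) ⟨0, measure_ne_top _ _⟩]
      refine le_iInf fun n => (h' n).2.trans (measure_mono ?_)
      refine subset_iInter₂ fun m hm => preimage_mono (closure_mono (image_mono ?_))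
      exact fun σ hσ i => hσ (i.castLE hm)
  rw [this]
  exact AnalyticSet.iUnion fun q => ((hE q).analyticSet).image_of_continuous continuous_fst

theorem AnalyticSet.inter' {X : Type*} [TopologicalSpace X] [T2Space X] {A B : Set X}
    (hA : AnalyticSet A) (hB : AnalyticSet B) : AnalyticSet (A ∩ B) := by
  rw [inter_eq_iInter]
  exact AnalyticSet.iInter fun b => by cases b <;> assumption

theorem AnalyticSet.union' {X : Type*} [TopologicalSpace X] {A B : Set X}
    (hA : AnalyticSet A) (hB : AnalyticSet B) : AnalyticSet (A ∪ B) := by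
  rw [union_eq_iUnion]
  exact AnalyticSet.iUnion fun b => by cases b <;> assumption

theorem UpperSemianalytic.analyticSet_lt {h : Z → ℝ} (hh : UpperSemianalytic h) {u : Z → ℝ}
    (hu : Measurable u) : AnalyticSet {z | u z < h z} := by
  have : {z | u z < h z} = ⋃ q : ℚ, {z | u z < q} ∩ {z | (q : ℝ) < h z} := by
    ext z
    simpa using ⟨fun h => exists_rat_btwn h, fun ⟨q, h1, h2⟩ => h1.trans h2⟩
  rw [this]
  exact AnalyticSet.iUnion fun q =>
    AnalyticSet.inter' (measurableSet_lt hu measurable_const).analyticSet (hh q)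

theorem UpperSemianalytic.sub_measurable {h : Z → ℝ} (hh : UpperSemianalytic h) {u : Z → ℝ}
    (hu : Measurable u) : UpperSemianalytic fun z => h z - u z := by
  intro c
  have := hh.analyticSet_lt (hu.const_add c)
  simpa [lt_sub_iff_add_lt] using this

theorem UpperSemianalytic.comp_continuous {X : Type*} [TopologicalSpace X] [T2Space X]
    {h : X → ℝ} (hh : UpperSemianalytic h) {φ : Z → X} (hφ : Continuous φ) :
    UpperSemianalytic fun z => h (φ z) :=
  fun c => (hh c).preimage hφ

theorem UpperSemianalytic.measurable_univComp {X : Type*} [TopologicalSpace X] [T2Space X]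
    [MeasurableSpace X] [OpensMeasurableSpace X]
    {h : X → ℝ} (hh : UpperSemianalytic h) : Measurable[univComp X] h := by
  have := fun c => measurableSet_univComp_of_analyticSet (hh c)
  generalize univComp X = m at this ⊢
  exact measurable_of_Ioi this

end KernelAnalytic

/-! ### Measurability of the weak topology and parametrization of analytic graphs -/

section Param

open ProbabilityTheory

variable {X Y : Type*} [TopologicalSpace X] [TopologicalSpace Y] [PolishSpace Y]
  [MeasurableSpace Y] [BorelSpace Y]

theorem measurable_toMeasure_borel :
    Measurable[borel (ProbabilityMeasure Y)] fun P : ProbabilityMeasure Y => (P : Measure Y) := by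
  borelize (ProbabilityMeasure Y)
  refine Measurable.measure_of_isPiSystem_of_isProbabilityMeasure
    (BorelSpace.measurable_eq (α := Y)) isPiSystem_isOpen fun U hU => ?_
  refine LowerSemicontinuous.measurable fun P c hc => ?_
  exact eventually_lt_of_lt_liminf
    (hc.trans_le (ProbabilityMeasure.le_liminf_measure_open_of_tendsto tendsto_id hU))

/-- A continuous parametrization by `ℕ → ℕ` of the graph of `PX`. -/
structure Param (PX : X → Set (ProbabilityMeasure Y)) where
  /-- the base point -/
  base : (ℕ → ℕ) → X
  /-- the measure over the base point -/
  meas : (ℕ → ℕ) → ProbabilityMeasure Y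
  cont_base : Continuous base
  cont_meas : Continuous meas
  mem_iff : ∀ x P, P ∈ PX x ↔ ∃ σ, base σ = x ∧ meas σ = P

theorem exists_param [Nonempty X] {PX : X → Set (ProbabilityMeasure Y)}
    (hne : ∀ x, (PX x).Nonempty)
    (hPX : AnalyticSet {p : X × ProbabilityMeasure Y | p.2 ∈ PX p.1}) : Nonempty (Param PX) := by
  rw [AnalyticSet] at hPX
  rcases hPX with h | ⟨g, hg, hr⟩
  · exfalso
    obtain ⟨x⟩ := ‹Nonempty X›
    obtain ⟨P, hP⟩ := hne x
    exact (h ▸ (show (x, P) ∈ {p : X × ProbabilityMeasure Y | p.2 ∈ PX p.1} from hP) :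
      (x, P) ∈ (∅ : Set (X × ProbabilityMeasure Y)))
  · refine ⟨⟨fun σ => (g σ).1, fun σ => (g σ).2, hg.fst, hg.snd, fun x P => ?_⟩⟩
    change (x, P) ∈ {p : X × ProbabilityMeasure Y | p.2 ∈ PX p.1} ↔ _
    rw [← hr]
    simp [Prod.ext_iff]

namespace Param

variable {PX : X → Set (ProbabilityMeasure Y)} (π : Param PX)

/-- The kernel of a parametrization. -/
def kernel : Kernel (ℕ → ℕ) Y where
  toFun σ := π.meas σ
  measurable' := by
    borelize (ProbabilityMeasure Y)
    have h1 : @Measurable _ _ _ (borel (ProbabilityMeasure Y)) π.meas := π.cont_meas.measurable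
    exact @Measurable.comp _ _ _ _ (borel (ProbabilityMeasure Y)) _ _ _
      measurable_toMeasure_borel h1

instance : IsMarkovKernel π.kernel := ⟨fun σ => inferInstanceAs (IsProbabilityMeasure (π.meas σ : Measure Y))⟩

theorem meas_mem (σ : ℕ → ℕ) : π.meas σ ∈ PX (π.base σ) := (π.mem_iff _ _).2 ⟨σ, rfl, rfl⟩

theorem measurable_meas_comp {W : Type*} [MeasurableSpace W] {σ : W → ℕ → ℕ} (hσ : Measurable σ) :
    @Measurable _ _ _ (borel (ProbabilityMeasure Y)) fun w => π.meas (σ w) := by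
  borelize (ProbabilityMeasure Y)
  exact @Measurable.comp _ _ _ _ _ (borel (ProbabilityMeasure Y)) _ _ π.cont_meas.measurable hσ

end Param

end Param

/-! ### Superhedging by a single measure over a compact set of strategies -/

section Compact

open ProbabilityTheory
open scoped Matrix

variable {Y : Type*} [MeasurableSpace Y] {d : ℕ}

theorem measurable_dot {D : Y → Fin d → ℝ} (hD : Measurable D) (y : Fin d → ℝ) :
    Measurable fun w => y ⬝ᵥ D w :=
  Finset.measurable_sum _ fun i _ => ((measurable_pi_apply i).comp hD).const_mul _

theorem tendsto_measure_dot (P : Measure Y) [IsFiniteMeasure P] {D : Y → Fin d → ℝ}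
    (hD : Measurable D) {c : ℕ → Fin d → ℝ} {y : Fin d → ℝ} (hc : Tendsto c atTop (𝓝 y))
    {ε : ℝ} (hε : 0 < ε) :
    Tendsto (fun n => P {w | ε ≤ |c n ⬝ᵥ D w - y ⬝ᵥ D w|}) atTop (𝓝 0) := by
  have := tendstoInMeasure_of_tendsto_ae (μ := P) (f := fun n w => c n ⬝ᵥ D w)
    (g := fun w => y ⬝ᵥ D w) (fun n => (measurable_dot hD _).aestronglyMeasurable)
    (Eventually.of_forall fun w => by
      have h : Continuous fun y : Fin d → ℝ => y ⬝ᵥ D w :=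
        Continuous.dotProduct continuous_id continuous_const
      exact (h.tendsto y).comp hc)
  rw [tendstoInMeasure_iff_dist] at this
  exact this ε hε

theorem forall_compact_not_ae_le_iff (P : Measure Y) [IsFiniteMeasure P] (h : Y → ℝ)
    {D : Y → Fin d → ℝ} (hD : Measurable D) {K : Set (Fin d → ℝ)} (hK : IsCompact K)
    {c : ℕ → Fin d → ℝ} (hcK : ∀ j, c j ∈ K) (hcd : K ⊆ closure (range c)) :
    (∀ y ∈ K, ¬ ∀ᵐ w ∂P, h w ≤ y ⬝ᵥ D w) ↔
      ∃ m : ℕ, ∀ j, ENNReal.ofReal (1 / (m + 1)) < P {w | c j ⬝ᵥ D w + 1 / (m + 1) < h w} := by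
  constructor
  · intro H
    by_contra! hcon
    choose j hj using hcon
    obtain ⟨y, hyK, φ, hφ, hlim⟩ := hK.tendsto_subseq (x := fun m => c (j m)) fun m => hcK _
    refine H y hyK ?_
    have h1 : Tendsto (fun n : ℕ => (1 : ℝ) / ((φ n : ℕ) + 1)) atTop (𝓝 0) :=
      tendsto_one_div_add_atTop_nhds_zero_nat.comp hφ.tendsto_atTop
    have h0 : ∀ ε : ℝ, 0 < ε → P {w | y ⬝ᵥ D w + ε < h w} = 0 := by
      intro ε hε
      have h2 := tendsto_measure_dot P hD hlim (half_pos hε)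
      have h3 : Tendsto (fun n => ENNReal.ofReal (1 / ((φ n : ℕ) + 1)) +
          P {w | ε / 2 ≤ |c (j (φ n)) ⬝ᵥ D w - y ⬝ᵥ D w|}) atTop (𝓝 0) := by
        simpa using (ENNReal.tendsto_ofReal h1).add h2
      refine le_antisymm (ge_of_tendsto h3 ?_) zero_le
      filter_upwards [h1.eventually_lt_const (half_pos hε)] with n hn
      refine le_trans (measure_mono ?_) ((measure_union_le _ _).trans (add_le_add_left (hj (φ n)) _))
      intro w hw
      by_contra hcon
      simp only [mem_union, mem_ofPred_eq, not_or, not_lt, not_le] at hcon hw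
      have := (abs_lt.1 hcon.2).2
      linarith [hcon.1]
    have h4 : {w | ¬ h w ≤ y ⬝ᵥ D w} ⊆ ⋃ n : ℕ, {w | y ⬝ᵥ D w + 1 / (n + 1) < h w} := by
      intro w hw
      simp only [mem_ofPred_eq, not_le] at hw
      obtain ⟨n, hn⟩ := exists_nat_one_div_lt (sub_pos.2 hw)
      exact mem_iUnion.2 ⟨n, by simp only [mem_ofPred_eq]; linarith⟩
    exact measure_mono_null h4 (measure_iUnion_null fun n => h0 _ (by positivity))
  · rintro ⟨m, hm⟩ y hy hle
    obtain ⟨x, hx, hlim⟩ := mem_closure_iff_seq_limit.1 (hcd hy)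
    choose j hj using hx
    set δ : ℝ := 1 / (m + 1) with hδ
    have hδ0 : 0 < δ := by positivity
    have h2 := tendsto_measure_dot P hD hlim hδ0
    have h3 : ∀ n, ENNReal.ofReal δ ≤ P {w | δ ≤ |x n ⬝ᵥ D w - y ⬝ᵥ D w|} := by
      intro n
      refine (hm (j n)).le.trans (measure_mono_ae ?_)
      filter_upwards [hle] with w hw hw'
      have h5 : c (j n) ⬝ᵥ D w + δ < h w := hw'
      rw [hj] at h5
      change δ ≤ |x n ⬝ᵥ D w - y ⬝ᵥ D w|
      rw [abs_sub_comm]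
      exact le_trans (by linarith) (le_abs_self _)
    have := ge_of_tendsto' h2 h3
    simp at this
    linarith

theorem analyticSet_forall_compact_not_ae_le {Z : Type*} [TopologicalSpace Z] [PolishSpace Z]
    [MeasurableSpace Z] [BorelSpace Z] [TopologicalSpace Y] [PolishSpace Y] [BorelSpace Y]
    (k : Kernel Z Y) [IsMarkovKernel k] {h : Z × Y → ℝ} (hh : UpperSemianalytic h)
    {D : Z × Y → Fin d → ℝ} (hD : Measurable D) {K : Set (Fin d → ℝ)} (hK : IsCompact K) :
    AnalyticSet {z | ∀ y ∈ K, ¬ ∀ᵐ w ∂(k z), h (z, w) ≤ y ⬝ᵥ D (z, w)} := by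
  rcases K.eq_empty_or_nonempty with rfl | hne
  · simpa using isClosed_univ.analyticSet
  obtain ⟨c, hcK, hcd⟩ : ∃ c : ℕ → Fin d → ℝ, (∀ j, c j ∈ K) ∧ K ⊆ closure (range c) := by
    have : Nonempty K := hne.to_subtype
    refine ⟨fun n => (TopologicalSpace.denseSeq K n : Fin d → ℝ), fun j => Subtype.coe_prop _, ?_⟩
    intro y hy
    have := TopologicalSpace.denseRange_denseSeq K ⟨y, hy⟩
    have h2 := image_closure_subset_closure_image continuous_subtype_val (mem_image_of_mem _ this)
    rwa [← range_comp] at h2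
  have heq : {z | ∀ y ∈ K, ¬ ∀ᵐ w ∂(k z), h (z, w) ≤ y ⬝ᵥ D (z, w)} =
      ⋃ m : ℕ, ⋂ j : ℕ, {z | ENNReal.ofReal (1 / (m + 1)) <
        k z (Prod.mk z ⁻¹' {p | c j ⬝ᵥ D p + 1 / (m + 1) < h p})} := by
    ext z
    have := forall_compact_not_ae_le_iff (k z) (fun w => h (z, w))
      (hD.comp measurable_prodMk_left : Measurable fun w => D (z, w)) hK hcK hcd
    simp only [mem_iUnion, mem_iInter]
    exact this
  rw [heq]
  exact AnalyticSet.iUnion fun m => AnalyticSet.iInter fun j =>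
    analyticSet_lt_kernel k (hh.analyticSet_lt ((measurable_dot hD _).add_const _)) _

theorem isClosed_ae_le (P : Measure Y) (h : Y → ℝ) (D : Y → Fin d → ℝ) :
    IsClosed {y : Fin d → ℝ | ∀ᵐ w ∂P, h w ≤ y ⬝ᵥ D w} := by
  refine IsSeqClosed.isClosed fun c y hc hlim => ?_
  have : ∀ᵐ w ∂P, ∀ n, h w ≤ c n ⬝ᵥ D w := ae_all_iff.2 hc
  filter_upwards [this] with w hw
  have hcont : Continuous fun y : Fin d → ℝ => y ⬝ᵥ D w :=
    Continuous.dotProduct continuous_id continuous_const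
  exact ge_of_tendsto' ((hcont.tendsto y).comp hlim) hw

theorem convex_ae_le (P : Measure Y) (h : Y → ℝ) (D : Y → Fin d → ℝ) :
    Convex ℝ {y : Fin d → ℝ | ∀ᵐ w ∂P, h w ≤ y ⬝ᵥ D w} := by
  intro x hx y hy a b ha hb hab
  change ∀ᵐ w ∂P, h w ≤ (a • x + b • y) ⬝ᵥ D w
  filter_upwards [hx, hy] with w h1 h2
  simp only [add_dotProduct, smul_dotProduct, smul_eq_mul]
  calc h w = a * h w + b * h w := by rw [← add_mul, hab, one_mul]
    _ ≤ _ := by gcongr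

/-- The midpoint of two probability measures. -/
theorem exists_midpoint {C : Set (ProbabilityMeasure Y)} (hC : ConvexPM C)
    {P R : ProbabilityMeasure Y} (hP : P ∈ C) (hR : R ∈ C) :
    ∃ M ∈ C, (M : Measure Y) = (2⁻¹ : ℝ≥0∞) • (P : Measure Y) + (2⁻¹ : ℝ≥0∞) • (R : Measure Y) := by
  have : IsProbabilityMeasure ((2⁻¹ : ℝ≥0∞) • (P : Measure Y) + (2⁻¹ : ℝ≥0∞) • (R : Measure Y)) :=
    ⟨by simp [ENNReal.inv_two_add_inv_two]⟩
  exact ⟨⟨_, this⟩, hC P hP R hR _ _ ENNReal.inv_two_add_inv_two _ rfl, rfl⟩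

theorem ae_midpoint_iff {P R M : Measure Y}
    (hM : M = (2⁻¹ : ℝ≥0∞) • P + (2⁻¹ : ℝ≥0∞) • R) {p : Y → Prop} :
    (∀ᵐ w ∂M, p w) ↔ (∀ᵐ w ∂P, p w) ∧ ∀ᵐ w ∂(R), p w := by
  rw [hM, ae_add_measure_iff, Measure.ae_ennreal_smul_measure_iff (by simp),
    Measure.ae_ennreal_smul_measure_iff (by simp)]

theorem exists_mem_compact_forall_ae_le {C : Set (ProbabilityMeasure Y)} (hC : ConvexPM C)
    (hne : C.Nonempty) (h : Y → ℝ) (D : Y → Fin d → ℝ) {K : Set (Fin d → ℝ)} (hK : IsCompact K)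
    (hex : ∀ P ∈ C, ∃ y ∈ K, ∀ᵐ w ∂(P : Measure Y), h w ≤ y ⬝ᵥ D w) :
    ∃ y ∈ K, ∀ P ∈ C, ∀ᵐ w ∂(P : Measure Y), h w ≤ y ⬝ᵥ D w := by
  have : Nonempty C := hne.to_subtype
  obtain ⟨y, hy⟩ := IsCompact.nonempty_iInter_of_directed_nonempty_isCompact_isClosed
    (fun P : C => K ∩ {y : Fin d → ℝ | ∀ᵐ w ∂((P : ProbabilityMeasure Y) : Measure Y), h w ≤ y ⬝ᵥ D w})
    (by
      rintro ⟨P, hP⟩ ⟨R, hR⟩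
      obtain ⟨M, hM, hMeq⟩ := exists_midpoint hC hP hR
      refine ⟨⟨M, hM⟩, fun y hy => ⟨hy.1, ?_⟩, fun y hy => ⟨hy.1, ?_⟩⟩
      · exact ((ae_midpoint_iff hMeq).1 hy.2).1
      · exact ((ae_midpoint_iff hMeq).1 hy.2).2)
    (fun P => (hex P P.2).imp fun y hy => hy)
    (fun P => hK.inter_right (isClosed_ae_le _ _ _))
    (fun P => hK.isClosed.inter (isClosed_ae_le _ _ _))
  have hy' := mem_iInter.1 hy
  exact ⟨y, (hy' (Classical.arbitrary C)).1, fun P hP => (hy' ⟨P, hP⟩).2⟩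

end Compact

/-! ### Measurable selection from closed convex sets -/

section ClosedConvex

open scoped Matrix

variable {d : ℕ}

theorem isCompact_dotProduct_self_le (r : ℝ) : IsCompact {y : Fin d → ℝ | y ⬝ᵥ y ≤ r} := by
  refine Metric.isCompact_of_isClosed_isBounded
    (isClosed_le (Continuous.dotProduct continuous_id continuous_id) continuous_const) ?_
  refine (Metric.isBounded_closedBall (x := (0 : Fin d → ℝ)) (r := √r)).subset fun y hy => ?_
  rw [mem_closedBall_zero_iff, pi_norm_le_iff_of_nonneg (Real.sqrt_nonneg _)]
  intro i
  rw [Real.norm_eq_abs]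
  refine Real.abs_le_sqrt (le_trans ?_ hy)
  rw [sq]
  exact Finset.single_le_sum (f := fun i => y i * y i) (fun i _ => mul_self_nonneg _)
    (Finset.mem_univ i)

theorem exists_isMinOn_dotProduct_self {G : Set (Fin d → ℝ)} (hG : IsClosed G)
    (hne : G.Nonempty) : ∃ y ∈ G, ∀ z ∈ G, y ⬝ᵥ y ≤ z ⬝ᵥ z := by
  obtain ⟨y₀, hy₀⟩ := hne
  obtain ⟨y, hy, hmin⟩ := ((isCompact_dotProduct_self_le (y₀ ⬝ᵥ y₀)).inter_left hG).exists_isMinOn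
    ⟨y₀, hy₀, le_refl (y₀ ⬝ᵥ y₀)⟩ (f := fun y => y ⬝ᵥ y)
    (Continuous.dotProduct continuous_id continuous_id).continuousOn
  refine ⟨y, hy.1, fun z hz => ?_⟩
  by_cases h : z ⬝ᵥ z ≤ y₀ ⬝ᵥ y₀
  · exact hmin ⟨hz, h⟩
  · exact hy.2.trans (not_le.1 h).le

theorem eq_of_isMinOn_dotProduct_self {G : Set (Fin d → ℝ)} (hG : Convex ℝ G)
    {y z : Fin d → ℝ} (hy : y ∈ G) (hz : z ∈ G) (hymin : ∀ x ∈ G, y ⬝ᵥ y ≤ x ⬝ᵥ x)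
    (hzy : z ⬝ᵥ z ≤ y ⬝ᵥ y) : y = z := by
  have hmid := hymin _ (hG hy hz (a := 1 / 2) (b := 1 / 2) (by norm_num) (by norm_num) (by norm_num))
  have h1 : (y - z) ⬝ᵥ (y - z) = 0 := by
    refine le_antisymm ?_ (by simpa using dotProduct_star_self_nonneg (y - z))
    simp only [add_dotProduct, dotProduct_add, smul_dotProduct, dotProduct_smul, smul_eq_mul,
      sub_dotProduct, dotProduct_sub, dotProduct_comm z y] at hmid ⊢
    linarith
  exact sub_eq_zero.1 (dotProduct_self_eq_zero.1 h1)

theorem exists_measurable_selection_closed_convex {X : Type*} [MeasurableSpace X]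
    (G : X → Set (Fin d → ℝ)) (hcl : ∀ x, IsClosed (G x)) (hconv : ∀ x, Convex ℝ (G x))
    (hmeas : ∀ K, IsCompact K → MeasurableSet {x | (G x ∩ K).Nonempty}) :
    MeasurableSet {x | (G x).Nonempty} ∧
      ∃ h : X → Fin d → ℝ, Measurable h ∧ ∀ x, (G x).Nonempty → h x ∈ G x := by
  have hne : MeasurableSet {x | (G x).Nonempty} := by
    have : {x | (G x).Nonempty} = ⋃ n : ℕ, {x | (G x ∩ {y : Fin d → ℝ | y ⬝ᵥ y ≤ n}).Nonempty} := by
      ext x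
      simp only [mem_ofPred_eq, mem_iUnion]
      refine ⟨fun ⟨y, hy⟩ => ?_, fun ⟨n, hn⟩ => hn.mono inter_subset_left⟩
      obtain ⟨n, hn⟩ := exists_nat_ge (y ⬝ᵥ y)
      exact ⟨n, y, hy, hn⟩
    rw [this]
    exact MeasurableSet.iUnion fun n => hmeas _ (isCompact_dotProduct_self_le _)
  refine ⟨hne, ?_⟩
  classical
  choose! h hG hmin using fun x (hx : (G x).Nonempty) => exists_isMinOn_dotProduct_self (hcl x) hx
  refine ⟨fun x => if (G x).Nonempty then h x else 0, ?_, fun x hx => by simpa [hx] using hG x hx⟩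
  refine measurable_of_isClosed fun C hC => ?_
  have heq : (fun x => if (G x).Nonempty then h x else 0) ⁻¹' C =
      ({x | (G x).Nonempty} ∩ ⋂ q : ℚ, ({x | (G x ∩ {y : Fin d → ℝ | y ⬝ᵥ y ≤ q}).Nonempty}ᶜ ∪
        {x | (G x ∩ (C ∩ {y : Fin d → ℝ | y ⬝ᵥ y ≤ q})).Nonempty})) ∪
      ({x | (G x).Nonempty}ᶜ ∩ {x | (0 : Fin d → ℝ) ∈ C}) := by
    ext x
    by_cases hx : (G x).Nonempty
    · simp only [mem_preimage, hx, if_true, mem_union, mem_inter_iff, mem_ofPred_eq, mem_iInter,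
        mem_compl_iff, not_true, false_and, or_false, true_and]
      constructor
      · intro hC q
        refine or_iff_not_imp_left.2 fun hq => ?_
        obtain ⟨z, hz, hzq⟩ := not_not.1 hq
        exact ⟨h x, hG x hx, hC, (hmin x hx z hz).trans hzq⟩
      · intro H
        have hCne : ∀ q : ℚ, h x ⬝ᵥ h x ≤ q → ∃ z ∈ G x ∩ C, z ⬝ᵥ z ≤ q := by
          intro q hq
          rcases H q with h' | ⟨z, hz, hz', hzq⟩
          · exact absurd ⟨h x, hG x hx, hq⟩ h'
          · exact ⟨z, ⟨hz, hz'⟩, hzq⟩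
        obtain ⟨z, hz, hzmin⟩ := exists_isMinOn_dotProduct_self ((hcl x).inter hC) (by
          obtain ⟨q, hq⟩ := exists_rat_gt (h x ⬝ᵥ h x)
          obtain ⟨z, hz, -⟩ := hCne q hq.le
          exact ⟨z, hz⟩)
        have hle : z ⬝ᵥ z ≤ h x ⬝ᵥ h x := by
          refine le_of_forall_gt_imp_ge_of_dense fun a ha => ?_
          obtain ⟨q, hq, hqa⟩ := exists_rat_btwn ha
          obtain ⟨w, hw, hwq⟩ := hCne q hq.le
          exact (hzmin w hw).trans (hwq.trans hqa.le)
        rw [eq_of_isMinOn_dotProduct_self (hconv x) (hG x hx) hz.1 (hmin x hx) hle]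
        exact hz.2
    · simp [hx]
  rw [heq]
  refine (hne.inter (MeasurableSet.iInter fun q => ?_)).union (hne.compl.inter (MeasurableSet.const _))
  exact (hmeas _ (isCompact_dotProduct_self_le _)).compl.union
    (hmeas _ ((isCompact_dotProduct_self_le _).inter_left hC))

end ClosedConvex

/-! ### Universally measurable one-step superhedging strategies -/

section OneStep

open ProbabilityTheory
open scoped Matrix

variable {X Y : Type*} [TopologicalSpace X] [PolishSpace X] [MeasurableSpace X] [BorelSpace X]
  [TopologicalSpace Y] [PolishSpace Y] [MeasurableSpace Y] [BorelSpace Y] {d : ℕ}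
  {PX : X → Set (ProbabilityMeasure Y)}

/-- The superhedging strategies for the claim `h` at the point `x`. -/
def hedges (PX : X → Set (ProbabilityMeasure Y)) (D : X × Y → Fin d → ℝ) (h : X × Y → ℝ) (x : X) :
    Set (Fin d → ℝ) :=
  {y | ∀ P ∈ PX x, ∀ᵐ w ∂(P : Measure Y), h (x, w) ≤ y ⬝ᵥ D (x, w)}

theorem isClosed_hedges (D : X × Y → Fin d → ℝ) (h : X × Y → ℝ) (x : X) :
    IsClosed (hedges PX D h x) := by
  have : hedges PX D h x = ⋂ P ∈ PX x,
      {y | ∀ᵐ w ∂(P : Measure Y), h (x, w) ≤ y ⬝ᵥ D (x, w)} := by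
    ext; simp [hedges]
  rw [this]
  exact isClosed_biInter fun P _ => isClosed_ae_le (P : Measure Y) (fun w => h (x, w)) fun w => D (x, w)

theorem convex_hedges (D : X × Y → Fin d → ℝ) (h : X × Y → ℝ) (x : X) :
    Convex ℝ (hedges PX D h x) := by
  have : hedges PX D h x = ⋂ P ∈ PX x,
      {y | ∀ᵐ w ∂(P : Measure Y), h (x, w) ≤ y ⬝ᵥ D (x, w)} := by
    ext; simp [hedges]
  rw [this]
  exact convex_iInter₂ fun P _ => convex_ae_le (P : Measure Y) (fun w => h (x, w)) fun w => D (x, w)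

theorem measurableSet_hedges_inter (π : Param PX) (hne : ∀ x, (PX x).Nonempty)
    (hconv : ∀ x, ConvexPM (PX x)) {D : X × Y → Fin d → ℝ} (hD : Measurable D) {f : X × Y → ℝ}
    (hf : UpperSemianalytic f) {g : X → ℝ} (hg : Measurable[univComp X] g)
    {K : Set (Fin d → ℝ)} (hK : IsCompact K) :
    MeasurableSet[univComp X] {x | (hedges PX D (fun p => f p - g p.1) x ∩ K).Nonempty} := by
  let k : Kernel ((ℕ → ℕ) × ℝ) Y := π.kernel.comap Prod.fst measurable_fst
  let E : Set ((ℕ → ℕ) × ℝ) := {z | ∀ y ∈ K, ¬ ∀ᵐ w ∂(k z),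
    f (π.base z.1, w) - z.2 ≤ y ⬝ᵥ D (π.base z.1, w)}
  have hE : AnalyticSet E := by
    have hcont : Continuous fun p : ((ℕ → ℕ) × ℝ) × Y => (π.base p.1.1, p.2) :=
      (π.cont_base.comp (continuous_fst.comp continuous_fst)).prodMk continuous_snd
    exact analyticSet_forall_compact_not_ae_le (Z := (ℕ → ℕ) × ℝ) k
      (h := fun p => f (π.base p.1.1, p.2) - p.1.2)
      ((hf.comp_continuous hcont).sub_measurable (measurable_snd.comp measurable_fst))
      (D := fun p => D (π.base p.1.1, p.2)) (hD.comp hcont.measurable) hK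
  have hE' : AnalyticSet ((fun z : (ℕ → ℕ) × ℝ => (π.base z.1, z.2)) '' E) :=
    hE.image_of_continuous ((π.cont_base.comp continuous_fst).prodMk continuous_snd)
  have hφ : Measurable[univComp X] fun x => (x, g x) := by
    have h1 : Measurable[univComp X] (fun x : X => x) := measurable_id'' le_univComp
    generalize univComp X = m at *
    exact h1.prodMk hg
  have hms := measurable_univComp_univComp hφ (measurableSet_univComp_of_analyticSet hE')
  have heq : {x | (hedges PX D (fun p => f p - g p.1) x ∩ K).Nonempty} =
      ((fun x => (x, g x)) ⁻¹' ((fun z : (ℕ → ℕ) × ℝ => (π.base z.1, z.2)) '' E))ᶜ := by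
    ext x
    constructor
    · rintro ⟨y, hy, hyK⟩ ⟨⟨σ, r⟩, hσ, heq⟩
      simp only [Prod.mk.injEq] at heq
      obtain ⟨h1, rfl⟩ := heq
      refine hσ y hyK ?_
      have := hy (π.meas σ) (h1 ▸ π.meas_mem σ)
      rw [← h1] at this
      rw [← h1]
      exact this
    · intro hx
      obtain ⟨y, hyK, hy⟩ := exists_mem_compact_forall_ae_le (hconv x) (hne x)
        (fun w => f (x, w) - g x) (fun w => D (x, w)) hK (by
          intro P hP
          by_contra hcon
          obtain ⟨σ, hσ, rfl⟩ := (π.mem_iff x P).1 hP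
          refine hx ⟨(σ, g x), ?_, by simp [hσ]⟩
          intro y hy hae
          refine hcon ⟨y, hy, ?_⟩
          rw [← hσ] at hae ⊢
          exact hae)
      exact ⟨y, hy, hyK⟩
  rw [heq]
  exact @MeasurableSet.compl _ _ (univComp X) hms

theorem exists_hedges_selection (π : Param PX) (hne : ∀ x, (PX x).Nonempty)
    (hconv : ∀ x, ConvexPM (PX x)) {D : X × Y → Fin d → ℝ} (hD : Measurable D) {f : X × Y → ℝ}
    (hf : UpperSemianalytic f) {g : X → ℝ} (hg : Measurable[univComp X] g) :
    MeasurableSet[univComp X] {x | (hedges PX D (fun p => f p - g p.1) x).Nonempty} ∧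
      ∃ h : X → Fin d → ℝ, Measurable[univComp X] h ∧
        ∀ x, (hedges PX D (fun p => f p - g p.1) x).Nonempty →
          h x ∈ hedges PX D (fun p => f p - g p.1) x := by
  have := fun K (hK : IsCompact K) => measurableSet_hedges_inter π hne hconv hD hf hg hK
  have hcl := isClosed_hedges (PX := PX) D fun p => f p - g p.1
  have hcv := convex_hedges (PX := PX) D fun p => f p - g p.1
  generalize univComp X = m at *
  exact exists_measurable_selection_closed_convex _ hcl hcv this

end OneStep

/-! ### One-period markets under a single measure -/

section SingleMeasure

open scoped Matrix

variable {Y : Type*} [MeasurableSpace Y] {d : ℕ}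

/-- No arbitrage for a single measure in a one-period market. -/
def NAm (P : Measure Y) (D : Y → Fin d → ℝ) : Prop :=
  ∀ y : Fin d → ℝ, (∀ᵐ w ∂P, 0 ≤ y ⬝ᵥ D w) → ∀ᵐ w ∂P, y ⬝ᵥ D w = 0

/-- Strategies whose gain vanishes almost surely. -/
def nullStrat (P : Measure Y) (D : Y → Fin d → ℝ) : Submodule ℝ (Fin d → ℝ) where
  carrier := {y | ∀ᵐ w ∂P, y ⬝ᵥ D w = 0}
  add_mem' {x y} hx hy := by
    change ∀ᵐ w ∂P, (x + y) ⬝ᵥ D w = 0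
    filter_upwards [hx, hy] with w h1 h2
    rw [add_dotProduct, h1, h2, add_zero]
  zero_mem' := by simp
  smul_mem' c x hx := by
    change ∀ᵐ w ∂P, (c • x) ⬝ᵥ D w = 0
    filter_upwards [hx] with w h1
    rw [smul_dotProduct, h1, smul_zero]

theorem mem_nullStrat {P : Measure Y} {D : Y → Fin d → ℝ} {y : Fin d → ℝ} :
    y ∈ nullStrat P D ↔ ∀ᵐ w ∂P, y ⬝ᵥ D w = 0 := Iff.rfl

theorem abs_dotProduct_le (y v : Fin d → ℝ) : |y ⬝ᵥ v| ≤ ‖y‖ * ∑ i, |v i| := by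
  rw [dotProduct, Finset.mul_sum]
  refine (Finset.abs_sum_le_sum_abs _ _).trans (Finset.sum_le_sum fun i _ => ?_)
  rw [abs_mul]
  gcongr
  exact norm_le_pi_norm y i

theorem integrable_dot {P : Measure Y} {D : Y → Fin d → ℝ}
    (hD : ∀ i, Integrable (fun w => D w i) P) (y : Fin d → ℝ) :
    Integrable (fun w => y ⬝ᵥ D w) P :=
  integrable_finsetSum _ fun i _ => (hD i).const_mul _

theorem integrable_lipschitz_comp {P : Measure Y} [IsFiniteMeasure P] {φ : ℝ → ℝ}
    {C : ℝ≥0} (hφ : LipschitzWith C φ) {u : Y → ℝ} (hu : Integrable u P) :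
    Integrable (fun w => φ (u w)) P := by
  refine Integrable.mono' ((hu.abs.const_mul (C : ℝ)).add (integrable_const |φ 0|))
    (hφ.continuous.comp_aestronglyMeasurable hu.1) (Eventually.of_forall fun w => ?_)
  have := hφ.dist_le_mul (u w) 0
  rw [Real.dist_eq, Real.dist_eq, sub_zero] at this
  simp only [Real.norm_eq_abs, Pi.add_apply]
  linarith [abs_sub_abs_le_abs_sub (φ (u w)) (φ 0)]

theorem continuous_integral_lipschitz_comp {P : Measure Y} [IsFiniteMeasure P] {φ : ℝ → ℝ}
    {C : ℝ≥0} (hφ : LipschitzWith C φ) {D : Y → Fin d → ℝ}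
    (hD : ∀ i, Integrable (fun w => D w i) P) {h : Y → ℝ} (hh : Integrable h P) :
    Continuous fun y : Fin d → ℝ => ∫ w, φ (y ⬝ᵥ D w + h w) ∂P := by
  have h_int : ∀ y : Fin d → ℝ, Integrable (fun w => φ (y ⬝ᵥ D w + h w)) P :=
    fun y => integrable_lipschitz_comp hφ ((integrable_dot hD y).add hh)
  have hDs : Integrable (fun w => ∑ i, |D w i|) P := integrable_finsetSum _ fun i _ => (hD i).abs
  refine LipschitzWith.continuous (K := C * (∫ w, ∑ i, |D w i| ∂P).toNNReal)
    (LipschitzWith.of_dist_le_mul fun y z => ?_)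
  rw [Real.dist_eq, ← integral_sub (h_int y) (h_int z), NNReal.coe_mul, Real.coe_toNNReal _
    (integral_nonneg fun w => Finset.sum_nonneg fun i _ => abs_nonneg _)]
  refine (abs_integral_le_integral_abs).trans ?_
  calc ∫ w, |φ (y ⬝ᵥ D w + h w) - φ (z ⬝ᵥ D w + h w)| ∂P
      ≤ ∫ w, C * dist y z * ∑ i, |D w i| ∂P := by
        refine integral_mono ((h_int y).sub (h_int z)).abs (hDs.const_mul _) fun w => ?_
        have := hφ.dist_le_mul (y ⬝ᵥ D w + h w) (z ⬝ᵥ D w + h w)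
        rw [Real.dist_eq, Real.dist_eq, add_sub_add_right_eq_sub, ← sub_dotProduct] at this
        refine this.trans ?_
        rw [mul_assoc, dist_eq_norm]
        gcongr
        exact abs_dotProduct_le _ _
    _ = _ := by rw [integral_const_mul]; ring

theorem lipschitzWith_negPart : LipschitzWith 1 fun u : ℝ => max (-u) 0 := by
  refine LipschitzWith.of_dist_le_mul fun u v => ?_
  simp only [Real.dist_eq, NNReal.coe_one, one_mul]
  refine (abs_max_sub_max_le_abs _ _ _).trans ?_
  rw [neg_sub_neg, abs_sub_comm]

theorem exists_coercive {P : Measure Y} [IsFiniteMeasure P] {D : Y → Fin d → ℝ}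
    (hD : ∀ i, Integrable (fun w => D w i) P) (hNA : NAm P D) {L : Submodule ℝ (Fin d → ℝ)}
    (hL : IsCompl (nullStrat P D) L) :
    ∃ c : ℝ, 0 < c ∧ ∀ y ∈ L, c * ‖y‖ ≤ ∫ w, max (-(y ⬝ᵥ D w)) 0 ∂P := by
  have hcont : Continuous fun y : Fin d → ℝ => ∫ w, max (-(y ⬝ᵥ D w)) 0 ∂P := by
    simpa using continuous_integral_lipschitz_comp lipschitzWith_negPart hD (integrable_zero _ ℝ P)
  have h_int : ∀ y, Integrable (fun w => max (-(y ⬝ᵥ D w)) 0) P := fun y =>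
    integrable_lipschitz_comp lipschitzWith_negPart (integrable_dot hD y)
  have hcpt : IsCompact ((L : Set (Fin d → ℝ)) ∩ Metric.sphere 0 1) :=
    (isCompact_sphere _ _).inter_left L.closed_of_finiteDimensional
  have hpos : ∀ y ∈ (L : Set (Fin d → ℝ)) ∩ Metric.sphere 0 1,
      0 < ∫ w, max (-(y ⬝ᵥ D w)) 0 ∂P := by
    rintro y ⟨hyL, hy1⟩
    refine lt_of_le_of_ne (integral_nonneg fun w => le_max_right _ _) fun h0 => ?_
    have h1 := (integral_eq_zero_iff_of_nonneg (fun w => le_max_right _ _) (h_int y)).1 h0.symm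
    have h2 : y ∈ nullStrat P D := hNA y (by
      filter_upwards [h1] with w hw
      have := le_max_left (-(y ⬝ᵥ D w)) 0
      simp only [Pi.zero_apply] at hw
      linarith)
    have h3 : y = 0 := by
      simpa using hL.disjoint.le_bot (show y ∈ nullStrat P D ⊓ L from ⟨h2, hyL⟩)
    simp [h3] at hy1
  rcases ((L : Set (Fin d → ℝ)) ∩ Metric.sphere 0 1).eq_empty_or_nonempty with hemp | hne
  · refine ⟨1, one_pos, fun y hy => ?_⟩
    rcases eq_or_ne y 0 with rfl | hy0
    · simp
    · exfalso
      have : ‖y‖⁻¹ • y ∈ (L : Set (Fin d → ℝ)) ∩ Metric.sphere 0 1 :=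
        ⟨L.smul_mem _ hy, by simp [norm_smul, hy0]⟩
      rw [hemp] at this
      exact this
  · obtain ⟨y₀, hy₀, hmin⟩ := hcpt.exists_isMinOn hne hcont.continuousOn
    refine ⟨_, hpos y₀ hy₀, fun y hy => ?_⟩
    rcases eq_or_ne y 0 with rfl | hy0
    · simp
    have hn : 0 < ‖y‖ := norm_pos_iff.2 hy0
    have := hmin (show ‖y‖⁻¹ • y ∈ (L : Set (Fin d → ℝ)) ∩ Metric.sphere 0 1 from
      ⟨L.smul_mem _ hy, by simp [norm_smul, hy0]⟩)
    simp only [mem_ofPred_eq] at this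
    have h2 : ∫ w, max (-((‖y‖⁻¹ • y) ⬝ᵥ D w)) 0 ∂P = ‖y‖⁻¹ * ∫ w, max (-(y ⬝ᵥ D w)) 0 ∂P := by
      rw [← integral_const_mul]
      congr 1 with w
      rw [smul_dotProduct, smul_eq_mul, ← mul_neg, mul_max_of_nonneg _ _ (inv_nonneg.2 hn.le),
        mul_zero]
    rw [h2, inv_mul_eq_div, le_div_iff₀ hn] at this
    exact this

theorem exists_minimizer {Φ : (Fin d → ℝ) → ℝ} (hΦ : Continuous Φ)
    {N L : Submodule ℝ (Fin d → ℝ)} (hL : IsCompl N L) (hinv : ∀ y, ∀ n ∈ N, Φ (n + y) = Φ y)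
    {c C : ℝ} (hc : 0 < c) (hcoer : ∀ y ∈ L, c * ‖y‖ - C ≤ Φ y) : ∃ y, ∀ z, Φ y ≤ Φ z := by
  have hcpt : IsCompact ((L : Set (Fin d → ℝ)) ∩ Metric.closedBall 0 (max ((Φ 0 + C) / c) 0)) :=
    (isCompact_closedBall _ _).inter_left L.closed_of_finiteDimensional
  obtain ⟨y, hy, hmin⟩ := hcpt.exists_isMinOn ⟨0, L.zero_mem, by simp⟩ hΦ.continuousOn
  refine ⟨y, fun z => ?_⟩
  obtain ⟨n, hn, l, hl, rfl⟩ := Submodule.mem_sup.1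
    (show z ∈ N ⊔ L by rw [hL.sup_eq_top]; trivial)
  rw [hinv l n hn]
  by_cases hlb : ‖l‖ ≤ max ((Φ 0 + C) / c) 0
  · exact hmin ⟨hl, by simpa using hlb⟩
  · have h0 : Φ y ≤ Φ 0 := hmin ⟨L.zero_mem, by simp⟩
    have h1 := (le_max_left _ _).trans_lt (not_le.1 hlb)
    rw [div_lt_iff₀ hc] at h1
    linarith [hcoer l hl]

theorem exists_integral_minimizer {P : Measure Y} [IsFiniteMeasure P] {D : Y → Fin d → ℝ}
    (hD : ∀ i, Integrable (fun w => D w i) P) (hNA : NAm P D) {h : Y → ℝ} (hh : Integrable h P)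
    {φ : ℝ → ℝ} {C : ℝ≥0} (hφ : LipschitzWith C φ) (hφn : ∀ u, max (-u) 0 ≤ φ u) :
    ∃ y : Fin d → ℝ, ∀ z : Fin d → ℝ,
      ∫ w, φ (y ⬝ᵥ D w + h w) ∂P ≤ ∫ w, φ (z ⬝ᵥ D w + h w) ∂P := by
  obtain ⟨L, hL⟩ := Submodule.exists_isCompl (nullStrat P D)
  obtain ⟨c, hc, hcoer⟩ := exists_coercive hD hNA hL
  refine exists_minimizer (continuous_integral_lipschitz_comp hφ hD hh) hL ?_ hc
    (C := ∫ w, |h w| ∂P) fun y hy => ?_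
  · intro y n hn
    refine integral_congr_ae ?_
    filter_upwards [mem_nullStrat.1 hn] with w hw
    rw [add_dotProduct, hw, zero_add]
  · refine (sub_le_sub_right (hcoer y hy) _).trans ?_
    rw [← integral_sub (integrable_lipschitz_comp lipschitzWith_negPart (integrable_dot hD y)) hh.abs]
    refine integral_mono ((integrable_lipschitz_comp lipschitzWith_negPart
      (integrable_dot hD y)).sub hh.abs)
      (integrable_lipschitz_comp hφ ((integrable_dot hD y).add hh)) fun w => ?_
    refine le_trans ?_ (hφn _)
    simp only [sub_le_iff_le_add]
    refine max_le ?_ (by positivity)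
    have := le_abs_self (h w)
    have := le_max_left (-(y ⬝ᵥ D w + h w)) 0
    linarith

end SingleMeasure

section Tilt

open scoped Matrix

variable {Y : Type*} [MeasurableSpace Y] {d : ℕ}

/-- A smooth convex decreasing loss function. -/
def loss (u : ℝ) : ℝ := √(1 + u ^ 2) - u

/-- The negative of the derivative of `loss`. -/
def tilt (u : ℝ) : ℝ := 1 - u / √(1 + u ^ 2)

theorem sqrt_one_add_sq_pos (u : ℝ) : 0 < √(1 + u ^ 2) := Real.sqrt_pos.2 (by positivity)

theorem abs_lt_sqrt_one_add_sq (u : ℝ) : |u| < √(1 + u ^ 2) := by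
  rw [← Real.sqrt_sq_eq_abs]
  exact Real.sqrt_lt_sqrt (sq_nonneg _) (by linarith)

theorem tilt_pos (u : ℝ) : 0 < tilt u := by
  rw [tilt, sub_pos, div_lt_one (sqrt_one_add_sq_pos u)]
  exact (le_abs_self u).trans_lt (abs_lt_sqrt_one_add_sq u)

theorem tilt_le_two (u : ℝ) : tilt u ≤ 2 := by
  have : -1 ≤ u / √(1 + u ^ 2) := by
    rw [le_div_iff₀ (sqrt_one_add_sq_pos u)]
    linarith [neg_abs_le u, abs_lt_sqrt_one_add_sq u]
  rw [tilt]; linarith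

theorem abs_tilt_le_two (u : ℝ) : |tilt u| ≤ 2 := by
  rw [abs_of_pos (tilt_pos u)]; exact tilt_le_two u

theorem continuous_tilt : Continuous tilt :=
  continuous_const.sub (continuous_id.div (by fun_prop) fun u => (sqrt_one_add_sq_pos u).ne')

theorem hasDerivAt_loss (u : ℝ) : HasDerivAt loss (-tilt u) u := by
  have h1 : HasDerivAt (fun u : ℝ => 1 + u ^ 2) (2 * u) u := by
    simpa using ((hasDerivAt_id u).pow 2).const_add 1
  have h2 := (h1.sqrt (by positivity)).sub (hasDerivAt_id u)
  have h3 : -tilt u = 2 * u / (2 * √(1 + u ^ 2)) - 1 := by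
    have := sqrt_one_add_sq_pos u
    unfold tilt
    field_simp
    ring
  rw [h3]
  exact h2

theorem lipschitzWith_loss : LipschitzWith 2 loss := by
  refine lipschitzWith_of_nnnorm_deriv_le (fun u => (hasDerivAt_loss u).differentiableAt) fun u => ?_
  rw [(hasDerivAt_loss u).deriv, nnnorm_neg, ← NNReal.coe_le_coe, coe_nnnorm, Real.norm_eq_abs]
  exact abs_tilt_le_two u

theorem negPart_le_loss (u : ℝ) : max (-u) 0 ≤ loss u := by
  have := abs_lt_sqrt_one_add_sq u
  rw [loss]
  exact max_le (by linarith [Real.sqrt_nonneg (1 + u ^ 2)]) (by linarith [le_abs_self u])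

theorem two_mul_negPart_le_loss (u : ℝ) : 2 * max (-u) 0 ≤ loss u := by
  have := abs_lt_sqrt_one_add_sq u
  rw [loss]
  rcases le_total 0 u with h | h
  · rw [max_eq_right (by linarith)]; linarith [le_abs_self u]
  · rw [max_eq_left (by linarith)]; linarith [neg_abs_le u]

theorem loss_add_tilt_mul_le_one (u : ℝ) : loss u + tilt u * u ≤ 1 := by
  have h := sqrt_one_add_sq_pos u
  have h2 : √(1 + u ^ 2) ^ 2 = 1 + u ^ 2 := Real.sq_sqrt (by positivity)
  have h3 : loss u + tilt u * u = 1 / √(1 + u ^ 2) := by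
    rw [loss, tilt]
    field_simp
    linear_combination h2
  rw [h3, div_le_one h]
  exact Real.one_le_sqrt.2 (by nlinarith [sq_nonneg u])

theorem integrable_tilt_mul {P : Measure Y} {u h : Y → ℝ} (hu : AEStronglyMeasurable u P)
    (hh : Integrable h P) : Integrable (fun w => tilt (u w) * h w) P :=
  hh.bdd_mul (continuous_tilt.comp_aestronglyMeasurable hu)
    (Eventually.of_forall fun w => abs_tilt_le_two (u w))

theorem integral_tilt_mul_eq_zero {P : Measure Y} [IsFiniteMeasure P] {D : Y → Fin d → ℝ}
    (hD : ∀ i, Integrable (fun w => D w i) P) {h : Y → ℝ} (hh : Integrable h P) {y : Fin d → ℝ}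
    (hy : ∀ z : Fin d → ℝ, ∫ w, loss (y ⬝ᵥ D w + h w) ∂P ≤ ∫ w, loss (z ⬝ᵥ D w + h w) ∂P)
    (i : Fin d) : ∫ w, tilt (y ⬝ᵥ D w + h w) * D w i ∂P = 0 := by
  have hlin : ∀ (s : ℝ) w, (y + s • Pi.single i 1) ⬝ᵥ D w + h w = y ⬝ᵥ D w + h w + s * D w i := by
    intro s w
    simp [add_dotProduct]
    ring
  have hu : Integrable (fun w => y ⬝ᵥ D w + h w) P := (integrable_dot hD y).add hh
  have hderiv := (hasDerivAt_integral_of_dominated_loc_of_deriv_le (μ := P) (𝕜 := ℝ) (x₀ := 0)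
    (s := univ) (F := fun s w => loss (y ⬝ᵥ D w + h w + s * D w i))
    (F' := fun s w => -tilt (y ⬝ᵥ D w + h w + s * D w i) * D w i)
    (bound := fun w => 2 * |D w i|) univ_mem
    (Eventually.of_forall fun s =>
      (integrable_lipschitz_comp lipschitzWith_loss (hu.add ((hD i).const_mul s))).1)
    (by simpa using integrable_lipschitz_comp lipschitzWith_loss hu)
    (((continuous_tilt.comp_aestronglyMeasurable
      (hu.add ((hD i).const_mul 0)).1).neg).mul (hD i).1)
    (Eventually.of_forall fun w s _ => by
      rw [norm_mul, norm_neg, Real.norm_eq_abs, Real.norm_eq_abs]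
      gcongr
      exact abs_tilt_le_two _)
    ((hD i).abs.const_mul 2)
    (Eventually.of_forall fun w s _ => by
      have h1 : HasDerivAt (fun s : ℝ => y ⬝ᵥ D w + h w + s * D w i) (D w i) s := by
        simpa using ((hasDerivAt_id s).mul_const (D w i)).const_add (y ⬝ᵥ D w + h w)
      exact (hasDerivAt_loss _).comp s h1)).2
  have hmin : IsLocalMin (fun s => ∫ w, loss (y ⬝ᵥ D w + h w + s * D w i) ∂P) 0 := by
    refine Eventually.of_forall fun s => ?_
    have := hy (y + s • Pi.single i 1)
    simp only [hlin] at this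
    simpa using this
  have := hmin.hasDerivAt_eq_zero hderiv
  simp only [zero_mul, add_zero, neg_mul] at this
  rw [integral_neg] at this
  linarith

theorem exists_tilt {P : Measure Y} [IsFiniteMeasure P] {D : Y → Fin d → ℝ}
    (hD : ∀ i, Integrable (fun w => D w i) P) (hNA : NAm P D) {f : Y → ℝ} (hf : Integrable f P) :
    ∃ (y : Fin d → ℝ) (a : ℝ), (∀ i, ∫ w, tilt (y ⬝ᵥ D w + a * f w) * D w i ∂P = 0) ∧
      ((¬ ∃ y : Fin d → ℝ, ∀ᵐ w ∂P, f w ≤ y ⬝ᵥ D w) →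
        0 < ∫ w, tilt (y ⬝ᵥ D w + a * f w) * f w ∂P) := by
  by_cases hno : ∃ y : Fin d → ℝ, ∀ᵐ w ∂P, f w ≤ y ⬝ᵥ D w
  · obtain ⟨y, hy⟩ := exists_integral_minimizer hD hNA (hf.const_mul 0) lipschitzWith_loss
      negPart_le_loss
    exact ⟨y, 0, integral_tilt_mul_eq_zero hD (hf.const_mul 0) hy, fun h => absurd hno h⟩
  obtain ⟨z₀, hz₀⟩ := exists_integral_minimizer hD hNA hf.neg lipschitzWith_negPart
    fun u => le_rfl
  set δ := ∫ w, max (-(z₀ ⬝ᵥ D w + (-f) w)) 0 ∂P with hδ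
  have hδ0 : 0 < δ := by
    refine lt_of_le_of_ne (integral_nonneg fun w => le_max_right _ _) fun h0 => hno ⟨z₀, ?_⟩
    have h1 := (integral_eq_zero_iff_of_nonneg (fun w => le_max_right _ _)
      (integrable_lipschitz_comp lipschitzWith_negPart ((integrable_dot hD z₀).add hf.neg))).1
      (hδ ▸ h0.symm)
    filter_upwards [h1] with w hw
    have := le_max_left (-(z₀ ⬝ᵥ D w + (-f) w)) 0
    simp only [Pi.zero_apply, Pi.add_apply, Pi.neg_apply] at hw this
    linarith
  obtain ⟨n, hn⟩ := exists_nat_gt (P.real univ / (2 * δ))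
  have hn0 : (0 : ℝ) < n := lt_of_le_of_lt (by positivity) hn
  rw [div_lt_iff₀ (by positivity)] at hn
  obtain ⟨y, hy⟩ := exists_integral_minimizer hD hNA (hf.const_mul (-n : ℝ)) lipschitzWith_loss
      negPart_le_loss
  have hzero := integral_tilt_mul_eq_zero hD (hf.const_mul (-n : ℝ)) hy
  refine ⟨y, -n, hzero, fun _ => ?_⟩
  set u : Y → ℝ := fun w => y ⬝ᵥ D w + -n * f w with hu
  have hui : Integrable u P := (integrable_dot hD y).add (hf.const_mul (-n : ℝ))
  have hlow : 2 * n * δ ≤ ∫ w, loss (u w) ∂P := by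
    have h1 := hz₀ ((n : ℝ)⁻¹ • y)
    have h_int : Integrable (fun w => max (-(((n : ℝ)⁻¹ • y) ⬝ᵥ D w + (-f) w)) 0) P :=
      integrable_lipschitz_comp lipschitzWith_negPart ((integrable_dot hD _).add hf.neg)
    refine (mul_le_mul_of_nonneg_left h1 (by positivity)).trans ?_
    rw [← integral_const_mul]
    refine integral_mono (h_int.const_mul _) (integrable_lipschitz_comp lipschitzWith_loss hui)
      fun w => ?_
    refine le_trans (le_of_eq ?_) (two_mul_negPart_le_loss _)
    rw [mul_assoc]
    congr 1
    simp only [mul_max_of_nonneg _ _ hn0.le, mul_zero, hu, smul_dotProduct, smul_eq_mul,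
      Pi.neg_apply]
    congr 1
    field_simp
  have hup : ∫ w, loss (u w) ∂P + ∫ w, tilt (u w) * u w ∂P ≤ P.real univ := by
    rw [← integral_add (integrable_lipschitz_comp lipschitzWith_loss hui)
      (integrable_tilt_mul hui.1 hui)]
    calc _ ≤ ∫ w, (1 : ℝ) ∂P := integral_mono ((integrable_lipschitz_comp lipschitzWith_loss hui).add
          (integrable_tilt_mul hui.1 hui)) (integrable_const _) fun w => loss_add_tilt_mul_le_one _
      _ = _ := by simp
  have hexp : ∫ w, tilt (u w) * u w ∂P = -n * ∫ w, tilt (u w) * f w ∂P := by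
    have h1 : ∀ w, tilt (u w) * u w = (∑ i, y i * (tilt (u w) * D w i)) + -n * (tilt (u w) * f w) := by
      intro w
      have : u w = y ⬝ᵥ D w + -n * f w := rfl
      generalize tilt (u w) = c
      rw [this, mul_add, dotProduct, Finset.mul_sum]
      congr 1
      · exact Finset.sum_congr rfl fun i _ => by ring
      · ring
    simp_rw [h1]
    rw [integral_add (integrable_finsetSum _ fun i _ =>
        (integrable_tilt_mul hui.1 (hD i)).const_mul _)
      ((integrable_tilt_mul hui.1 hf).const_mul _),
      integral_finsetSum _ fun i _ => (integrable_tilt_mul hui.1 (hD i)).const_mul _]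
    simp_rw [integral_const_mul]
    rw [Finset.sum_eq_zero fun i _ => by rw [hzero i, mul_zero], zero_add]
  rw [hexp] at hup
  by_contra hcon
  have : ∫ w, tilt (u w) * f w ∂P ≤ 0 := not_lt.1 hcon
  nlinarith

theorem NAm_of_integral_eq_zero {P : Measure Y} {D : Y → Fin d → ℝ} {Z : Y → ℝ}
    (hZ : ∀ w, 0 < Z w) (h_int : ∀ i, Integrable (fun w => Z w * D w i) P)
    (h0 : ∀ i, ∫ w, Z w * D w i ∂P = 0) : NAm P D := by
  intro y hy
  have h1 : ∀ w, Z w * (y ⬝ᵥ D w) = ∑ i, y i * (Z w * D w i) := fun w => by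
    rw [dotProduct, Finset.mul_sum]
    exact Finset.sum_congr rfl fun i _ => by ring
  have h2 : ∫ w, Z w * (y ⬝ᵥ D w) ∂P = 0 := by
    simp_rw [h1]
    rw [integral_finsetSum _ fun i _ => (h_int i).const_mul _]
    simp_rw [integral_const_mul]
    exact Finset.sum_eq_zero fun i _ => by rw [h0 i, mul_zero]
  have h3 : Integrable (fun w => Z w * (y ⬝ᵥ D w)) P := by
    simp_rw [h1]
    exact integrable_finsetSum _ fun i _ => (h_int i).const_mul _
  have h4 := (integral_eq_zero_iff_of_nonneg_ae
    (hy.mono fun w hw => mul_nonneg (hZ w).le hw) h3).1 h2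
  filter_upwards [h4] with w hw
  exact (mul_eq_zero.1 hw).resolve_left (hZ w).ne'

end Tilt

section OneStepDuality

open scoped Matrix

variable {Y : Type*} [MeasurableSpace Y] {d : ℕ}

/-- No arbitrage for a family of one-step measures. -/
def NAC (C : Set (ProbabilityMeasure Y)) (D : Y → Fin d → ℝ) : Prop :=
  ∀ y : Fin d → ℝ, (∀ P ∈ C, ∀ᵐ w ∂(P : Measure Y), 0 ≤ y ⬝ᵥ D w) →
    ∀ P ∈ C, ∀ᵐ w ∂(P : Measure Y), y ⬝ᵥ D w = 0

/-- Strategies whose gain vanishes under every measure of a family. -/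
def nullStratC (C : Set (ProbabilityMeasure Y)) (D : Y → Fin d → ℝ) :
    Submodule ℝ (Fin d → ℝ) :=
  ⨅ P ∈ C, nullStrat (P : Measure Y) D

theorem mem_nullStratC {C : Set (ProbabilityMeasure Y)} {D : Y → Fin d → ℝ} {y : Fin d → ℝ} :
    y ∈ nullStratC C D ↔ ∀ P ∈ C, ∀ᵐ w ∂(P : Measure Y), y ⬝ᵥ D w = 0 := by
  simp [nullStratC, Submodule.mem_iInf, mem_nullStrat]

theorem exists_reference {C : Set (ProbabilityMeasure Y)} (hC : ConvexPM C) (hne : C.Nonempty)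
    {D : Y → Fin d → ℝ} (hNA : NAC C D) {L : Submodule ℝ (Fin d → ℝ)}
    (hL : IsCompl (nullStratC C D) L) :
    ∃ P₀ ∈ C, ∀ l ∈ L, (∀ᵐ w ∂(P₀ : Measure Y), 0 ≤ l ⬝ᵥ D w) → l = 0 := by
  have hK : IsCompact ((L : Set (Fin d → ℝ)) ∩ Metric.sphere 0 1) :=
    (isCompact_sphere _ _).inter_left L.closed_of_finiteDimensional
  have h1 : ∃ P₀ ∈ C, ∀ l ∈ (L : Set (Fin d → ℝ)) ∩ Metric.sphere 0 1,
      ¬ ∀ᵐ w ∂(P₀ : Measure Y), 0 ≤ l ⬝ᵥ D w := by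
    by_contra! hcon
    obtain ⟨y, ⟨hyL, hy1⟩, hy⟩ := exists_mem_compact_forall_ae_le hC hne (fun _ => 0) D hK hcon
    have h0 : y = 0 := (Submodule.disjoint_def.1 hL.disjoint) y
      (mem_nullStratC.2 (hNA y hy)) hyL
    simp [h0] at hy1
  obtain ⟨P₀, hP₀, h⟩ := h1
  refine ⟨P₀, hP₀, fun l hl hpos => ?_⟩
  by_contra h0
  have hn : 0 < ‖l‖ := norm_pos_iff.2 h0
  refine h (‖l‖⁻¹ • l) ⟨L.smul_mem _ hl, by simp [norm_smul, hn.ne']⟩ ?_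
  filter_upwards [hpos] with w hw
  rw [smul_dotProduct]
  exact smul_nonneg (by positivity) hw

theorem NAm_of_reference {C : Set (ProbabilityMeasure Y)} {D : Y → Fin d → ℝ}
    {L : Submodule ℝ (Fin d → ℝ)} (hL : IsCompl (nullStratC C D) L)
    {P₀ : ProbabilityMeasure Y}
    (hP₀ : ∀ l ∈ L, (∀ᵐ w ∂(P₀ : Measure Y), 0 ≤ l ⬝ᵥ D w) → l = 0)
    {P : ProbabilityMeasure Y} (hP : P ∈ C) (hac : (P₀ : Measure Y) ≪ P) :
    NAm (P : Measure Y) D := by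
  intro y hy
  obtain ⟨n, hn, l, hl, rfl⟩ : ∃ n ∈ nullStratC C D, ∃ l ∈ L, n + l = y :=
    Submodule.mem_sup.1 (hL.sup_eq_top ▸ Submodule.mem_top)
  have hn' := mem_nullStratC.1 hn P hP
  have hl0 : l = 0 := by
    refine hP₀ l hl (hac.ae_le ?_)
    filter_upwards [hy, hn'] with w h1 h2
    rw [add_dotProduct, h2, zero_add] at h1
    exact h1
  simpa [hl0] using hn'

theorem exists_NAm_of_ac {C : Set (ProbabilityMeasure Y)} (hC : ConvexPM C)
    {D : Y → Fin d → ℝ} (hNA : NAC C D) {R : ProbabilityMeasure Y} (hR : R ∈ C) :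
    ∃ P ∈ C, (R : Measure Y) ≪ P ∧ NAm (P : Measure Y) D := by
  obtain ⟨L, hL⟩ := Submodule.exists_isCompl (nullStratC C D)
  obtain ⟨P₀, hP₀, h⟩ := exists_reference hC ⟨R, hR⟩ hNA hL
  obtain ⟨M, hM, hMe⟩ := exists_midpoint hC hP₀ hR
  refine ⟨M, hM, Measure.AbsolutelyContinuous.mk fun s _ hs => ?_,
    NAm_of_reference hL h hM (Measure.AbsolutelyContinuous.mk fun s _ hs => ?_)⟩ <;>
  · rw [hMe] at hs
    simp at hs
    tauto

theorem isCompact_hedges_of_reference {L : Submodule ℝ (Fin d → ℝ)} {D : Y → Fin d → ℝ}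
    {P : Measure Y} (hP : ∀ l ∈ L, (∀ᵐ w ∂P, 0 ≤ l ⬝ᵥ D w) → l = 0) (f : Y → ℝ) :
    IsCompact ((L : Set (Fin d → ℝ)) ∩ {y | ∀ᵐ w ∂P, f w ≤ y ⬝ᵥ D w}) := by
  refine Metric.isCompact_of_isClosed_isBounded
    (L.closed_of_finiteDimensional.inter (isClosed_ae_le P f D)) ?_
  by_contra hb
  have hb' : ∀ n : ℕ, ∃ y ∈ (L : Set (Fin d → ℝ)) ∩ {y | ∀ᵐ w ∂P, f w ≤ y ⬝ᵥ D w},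
      (n + 1 : ℝ) < ‖y‖ := by
    intro n
    by_contra! hcon
    exact hb ((Metric.isBounded_closedBall (x := 0) (r := (n + 1 : ℝ))).subset
      fun y hy => by simpa using hcon y hy)
  choose y hy hyn using hb'
  have hpos : ∀ n, 0 < ‖y n‖ := fun n => lt_trans (by positivity) (hyn n)
  have hK : IsCompact ((L : Set (Fin d → ℝ)) ∩ Metric.sphere 0 1) :=
    (isCompact_sphere _ _).inter_left L.closed_of_finiteDimensional
  obtain ⟨u, ⟨huL, hu1⟩, φ, hφ, hlim⟩ := hK.tendsto_subseq (x := fun n => ‖y n‖⁻¹ • y n)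
    fun n => ⟨L.smul_mem _ (hy n).1, by simp [norm_smul, (hpos n).ne']⟩
  have hu0 : u = 0 := by
    refine hP u huL ?_
    have : ∀ᵐ w ∂P, ∀ n, f w ≤ y n ⬝ᵥ D w := ae_all_iff.2 fun n => (hy n).2
    filter_upwards [this] with w hw
    have hcont : Continuous fun y : Fin d → ℝ => y ⬝ᵥ D w :=
      Continuous.dotProduct continuous_id continuous_const
    have hinv : Tendsto (fun n => ‖y (φ n)‖⁻¹ * f w) atTop (𝓝 (0 * f w)) := by
      refine Tendsto.mul_const _ (Tendsto.comp (g := fun n => ‖y n‖⁻¹) ?_ hφ.tendsto_atTop)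
      refine tendsto_inv_atTop_zero.comp (tendsto_atTop_mono (fun n => (hyn n).le) ?_)
      exact tendsto_atTop_add_const_right _ _ tendsto_natCast_atTop_atTop
    rw [zero_mul] at hinv
    refine le_of_tendsto_of_tendsto' hinv ((hcont.tendsto u).comp hlim) fun n => ?_
    simp only [Function.comp, smul_dotProduct, smul_eq_mul]
    exact mul_le_mul_of_nonneg_left (hw _) (by positivity)
  simp [hu0] at hu1

theorem exists_NAm_not_hedgeable {C : Set (ProbabilityMeasure Y)} (hC : ConvexPM C)
    (hne : C.Nonempty) {D : Y → Fin d → ℝ} (hNA : NAC C D) {f : Y → ℝ}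
    (hf : ¬ ∃ y : Fin d → ℝ, ∀ P ∈ C, ∀ᵐ w ∂(P : Measure Y), f w ≤ y ⬝ᵥ D w) :
    ∃ P ∈ C, NAm (P : Measure Y) D ∧
      ∀ y : Fin d → ℝ, ¬ ∀ᵐ w ∂(P : Measure Y), f w ≤ y ⬝ᵥ D w := by
  obtain ⟨L, hL⟩ := Submodule.exists_isCompl (nullStratC C D)
  obtain ⟨P₀, hP₀, h⟩ := exists_reference hC hne hNA hL
  by_contra! hcon
  obtain ⟨y, -, hy⟩ := exists_mem_compact_forall_ae_le hC hne f D
    (isCompact_hedges_of_reference h f) (by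
      intro R hR
      obtain ⟨M, hM, hMe⟩ := exists_midpoint hC hP₀ hR
      obtain ⟨y, hy⟩ := hcon M hM (NAm_of_reference hL h hM
        (Measure.AbsolutelyContinuous.mk fun s _ hs => by
          rw [hMe] at hs
          simp at hs
          tauto))
      obtain ⟨n, hn, l, hl, rfl⟩ : ∃ n ∈ nullStratC C D, ∃ l ∈ L, n + l = y :=
        Submodule.mem_sup.1 (hL.sup_eq_top ▸ Submodule.mem_top)
      have hn' := mem_nullStratC.1 hn M hM
      have hy' : ∀ᵐ w ∂(M : Measure Y), f w ≤ l ⬝ᵥ D w := by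
        filter_upwards [hy, hn'] with w h1 h2
        rw [add_dotProduct, h2, zero_add] at h1
        exact h1
      rw [ae_midpoint_iff hMe] at hy'
      exact ⟨l, ⟨hl, hy'.1⟩, hy'.2⟩)
  exact hf ⟨y, hy⟩

/-- Weighted version of `exists_tilt`. -/
theorem exists_weighted_tilt {P : Measure Y} [IsFiniteMeasure P] {D : Y → Fin d → ℝ}
    (hNA : NAm P D) {f : Y → ℝ} {g : Y → ℝ} (hg : Measurable g) (hgpos : ∀ w, 0 < g w)
    (hg1 : ∀ w, g w ≤ 1) (hD : ∀ i, Integrable (fun w => g w * D w i) P)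
    (hf : Integrable (fun w => g w * f w) P) :
    ∃ (y : Fin d → ℝ) (a : ℝ), (∀ i, ∫ w, g w * tilt (y ⬝ᵥ D w + a * f w) * D w i ∂P = 0) ∧
      ((∀ y : Fin d → ℝ, ¬ ∀ᵐ w ∂P, f w ≤ y ⬝ᵥ D w) →
        0 < ∫ w, g w * tilt (y ⬝ᵥ D w + a * f w) * f w ∂P) := by
  set μ := P.withDensity fun w => ENNReal.ofReal (g w) with hμ
  have hgm : Measurable fun w => (g w).toNNReal := hg.real_toNNReal
  have hcoe : ∀ w, ((g w).toNNReal : ℝ) = g w := fun w => Real.coe_toNNReal _ (hgpos w).le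
  have hac1 : μ ≪ P := withDensity_absolutelyContinuous _ _
  have hac2 : P ≪ μ := withDensity_absolutelyContinuous' hg.ennreal_ofReal.aemeasurable
    (Eventually.of_forall fun w => by simpa using hgpos w)
  have hfin : IsFiniteMeasure μ := isFiniteMeasure_withDensity (by
    refine ne_top_of_le_ne_top (measure_ne_top P univ) ?_
    calc ∫⁻ w, ENNReal.ofReal (g w) ∂P ≤ ∫⁻ w, 1 ∂P :=
          lintegral_mono fun w => by simpa using hg1 w
      _ = P univ := by simp)
  have h_int : ∀ h : Y → ℝ, Integrable (fun w => g w * h w) P → Integrable h μ := fun h hh =>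
    (integrable_withDensity_iff_integrable_smul hgm).2
      (hh.congr (Eventually.of_forall fun w => by
        change g w * h w = ((g w).toNNReal : ℝ) * h w
        rw [hcoe]))
  have hval : ∀ h : Y → ℝ, ∫ w, h w ∂μ = ∫ w, g w * h w ∂P := fun h => by
    rw [hμ]
    refine (integral_withDensity_eq_integral_smul hgm h).trans ?_
    refine integral_congr_ae (Eventually.of_forall fun w => ?_)
    change ((g w).toNNReal : ℝ) * h w = g w * h w
    rw [hcoe]
  obtain ⟨y, a, h1, h2⟩ := exists_tilt (P := μ) (fun i => h_int _ (hD i))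
    (fun y hy => hac1.ae_le (hNA y (hac2.ae_le hy))) (h_int f hf)
  refine ⟨y, a, fun i => ?_, fun hno => ?_⟩
  · rw [← h1 i, hval]
    simp_rw [mul_assoc]
  · have := h2 (by rintro ⟨y, hy⟩; exact hno y (hac2.ae_le hy))
    rw [hval] at this
    simpa [mul_assoc] using this

end OneStepDuality

section KernelVersion

open ProbabilityTheory

variable {X Y : Type*} [MeasurableSpace X] [MeasurableSpace Y]

theorem exists_kernel_ae_eq [StandardBorelSpace Y] {κ : X → Measure Y}
    [hκp : ∀ x, IsProbabilityMeasure (κ x)] (hκ : Measurable[univComp X] κ) (ν : Measure X)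
    [IsProbabilityMeasure ν] :
    ∃ k : Kernel X Y, IsMarkovKernel k ∧ ∀ᵐ x ∂ν, κ x = k x := by
  have hX : Nonempty X := nonempty_of_isProbabilityMeasure ν
  obtain ⟨x₀⟩ := hX
  let e : Y → ℝ := embeddingReal Y
  have he : MeasurableEmbedding e := measurableEmbedding_embeddingReal Y
  have hφ : ∀ q : ℚ, AEMeasurable (fun x => κ x (e ⁻¹' Iic (q : ℝ))) ν := fun q => by
    have hm : Measurable[univComp X] fun x => κ x (e ⁻¹' Iic (q : ℝ)) := by
      have := Measure.measurable_coe (he.measurable (measurableSet_Iic (a := (q : ℝ))))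
      exact this.comp hκ
    exact aemeasurable_of_univComp hm ν
  have hae : ∀ᵐ x ∂ν, ∀ q : ℚ, κ x (e ⁻¹' Iic (q : ℝ)) = (hφ q).mk _ x :=
    ae_all_iff.2 fun q => (hφ q).ae_eq_mk
  obtain ⟨E, hEsub, hEm, hE0⟩ := exists_measurable_superset_of_null hae
  classical
  let k : X → Measure Y := fun x => if x ∈ E then κ x₀ else κ x
  have hkp : ∀ x, IsProbabilityMeasure (k x) := fun x => by
    by_cases hx : x ∈ E <;> simp only [k, hx, if_true, if_false] <;> infer_instance
  have hkm : Measurable k := by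
    refine Measurable.measure_of_isPiSystem_of_isProbabilityMeasure
      (S := preimage e '' (⋃ a : ℚ, {Iic (a : ℝ)})) ?_ ?_ ?_
    · rw [← MeasurableSpace.comap_generateFrom, ← Real.borel_eq_generateFrom_Iic_rat,
        ← BorelSpace.measurable_eq (α := ℝ)]
      exact he.comap_eq.symm
    · exact IsPiSystem.comap Real.isPiSystem_Iic_rat e
    · rintro _ ⟨s, hs, rfl⟩
      simp only [mem_iUnion, mem_singleton_iff] at hs
      obtain ⟨q, rfl⟩ := hs
      have : (fun x => k x (e ⁻¹' Iic (q : ℝ))) =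
          fun x => if x ∈ E then κ x₀ (e ⁻¹' Iic (q : ℝ)) else (hφ q).mk _ x := by
        funext x
        by_cases hx : x ∈ E
        · simp [k, hx]
        · simp only [k, hx, if_false]
          by_contra hne
          exact hx (hEsub fun h => hne (h q))
      rw [this]
      exact Measurable.ite hEm measurable_const (hφ q).measurable_mk
  refine ⟨⟨k, hkm⟩, ⟨hkp⟩, ?_⟩
  filter_upwards [measure_eq_zero_iff_ae_notMem.1 hE0] with x hx
  simp [k, hx]

end KernelVersion

section Density

open ProbabilityTheory
open scoped Matrix

variable {X Y : Type*} [TopologicalSpace X] [PolishSpace X] [MeasurableSpace X] [BorelSpace X]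
  [MeasurableSpace Y] {d : ℕ}

theorem exists_tilt_density (ν : Measure X) [IsProbabilityMeasure ν] (κ : Kernel X Y)
    [IsMarkovKernel κ] {D : X × Y → Fin d → ℝ} (hD : Measurable D) {f G : X × Y → ℝ}
    (hf : Measurable f) (hG : Measurable G) (hG0 : ∀ p, 0 ≤ G p) (hfG : ∀ p, |f p| ≤ G p)
    (hDG : ∀ p i, |D p i| ≤ G p) {N : Set X}
    (hN : MeasurableSet N) (hNA : ∀ᵐ x ∂ν, NAm (κ x) fun w => D (x, w))
    (hno : ∀ᵐ x ∂ν, x ∈ N → ∀ y : Fin d → ℝ, ¬ ∀ᵐ w ∂(κ x), f (x, w) ≤ y ⬝ᵥ D (x, w)) :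
    ∃ Z : X × Y → ℝ, Measurable Z ∧ (∀ p, 0 < Z p) ∧ (∀ x, ∫ w, Z (x, w) ∂(κ x) = 1) ∧
      (∀ x, ∃ c, ∀ w, Z (x, w) * (1 + G (x, w)) ≤ c) ∧
      ∀ᵐ x ∂ν, (∀ i, ∫ w, Z (x, w) * D (x, w) i ∂(κ x) = 0) ∧
        (x ∈ N → 0 < ∫ w, Z (x, w) * f (x, w) ∂(κ x)) := by
  set g : X × Y → ℝ := fun p => (1 + G p)⁻¹ with hg
  have hG1 : ∀ p, 0 < 1 + G p := fun p => by linarith [hG0 p]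
  have hgm : Measurable g := (hG.const_add 1).inv
  have hgpos : ∀ p, 0 < g p := fun p => inv_pos.2 (hG1 p)
  have hg1 : ∀ p, g p ≤ 1 := fun p => inv_le_one_of_one_le₀ (by linarith [hG0 p])
  have hgG : ∀ p, g p * G p ≤ 1 := fun p => by
    rw [hg, inv_mul_le_iff₀ (hG1 p)]; linarith
  have hgb : ∀ p (a : ℝ), |a| ≤ G p → |g p * a| ≤ 1 := fun p a ha => by
    rw [abs_mul, abs_of_pos (hgpos p)]
    exact (mul_le_mul_of_nonneg_left ha (hgpos p).le).trans (hgG p)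
  let tl : X × ((Fin d → ℝ) × ℝ) → Y → ℝ := fun q w =>
    g (q.1, w) * tilt (q.2.1 ⬝ᵥ D (q.1, w) + q.2.2 * f (q.1, w))
  have htl : Measurable fun r : (X × ((Fin d → ℝ) × ℝ)) × Y => tl r.1 r.2 := by
    have h1 : Measurable fun r : (X × ((Fin d → ℝ) × ℝ)) × Y => (r.1.1, r.2) := by fun_prop
    have h2 := hD.comp h1
    refine (hgm.comp h1).mul (continuous_tilt.measurable.comp (Measurable.add ?_ ?_))
    · refine Finset.measurable_sum _ fun i _ => Measurable.mul ?_ ((measurable_pi_apply i).comp h2)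
      fun_prop
    · exact Measurable.mul (by fun_prop) (hf.comp h1)
  have htlpos : ∀ q w, 0 < tl q w := fun q w => mul_pos (hgpos _) (tilt_pos _)
  have htlb : ∀ q w (a : ℝ), |a| ≤ G (q.1, w) → ‖tl q w * a‖ ≤ 2 := fun q w a ha => by
    have : tl q w * a = tilt (q.2.1 ⬝ᵥ D (q.1, w) + q.2.2 * f (q.1, w)) * (g (q.1, w) * a) := by
      simp only [tl]; ring
    rw [this, norm_mul]
    have h1 := abs_tilt_le_two (q.2.1 ⬝ᵥ D (q.1, w) + q.2.2 * f (q.1, w))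
    have h2 := hgb _ a ha
    calc _ ≤ (2 : ℝ) * 1 := mul_le_mul h1 h2 (abs_nonneg _) (by norm_num)
      _ = 2 := by norm_num
  let k' : Kernel (X × ((Fin d → ℝ) × ℝ)) Y := Kernel.prodMkRight _ κ
  have hI : ∀ h : X × Y → ℝ, Measurable h →
      Measurable fun q : X × ((Fin d → ℝ) × ℝ) => ∫ w, tl q w * h (q.1, w) ∂(κ q.1) := by
    intro h hh
    have h1 : Measurable fun r : (X × ((Fin d → ℝ) × ℝ)) × Y => tl r.1 r.2 * h (r.1.1, r.2) :=
      htl.mul (hh.comp (by fun_prop))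
    exact (StronglyMeasurable.integral_kernel_prod_right' (κ := k') h1.stronglyMeasurable).measurable
  let B : Set (X × ((Fin d → ℝ) × ℝ)) := {q | (∀ i, ∫ w, tl q w * D (q.1, w) i ∂(κ q.1) = 0) ∧
    (q.1 ∈ N → 0 < ∫ w, tl q w * f (q.1, w) ∂(κ q.1))}
  have hB : MeasurableSet B := by
    have h1 : MeasurableSet (⋂ i, {q : X × ((Fin d → ℝ) × ℝ) |
        ∫ w, tl q w * D (q.1, w) i ∂(κ q.1) = 0}) := MeasurableSet.iInter fun i =>
      (hI (fun p => D p i) ((measurable_pi_apply i).comp hD)) (measurableSet_singleton 0)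
    have h2 : MeasurableSet ((Prod.fst ⁻¹' N)ᶜ ∪ {q : X × ((Fin d → ℝ) × ℝ) |
        0 < ∫ w, tl q w * f (q.1, w) ∂(κ q.1)}) :=
      (measurable_fst hN).compl.union ((hI f hf) measurableSet_Ioi)
    convert h1.inter h2 using 1
    ext q
    simp [B, imp_iff_not_or]
  obtain ⟨φ, hφ, hφB⟩ := exists_univComp_selection hB.analyticSet
  have hφae := aemeasurable_of_univComp hφ ν
  set ψ := hφae.mk φ with hψ
  have hψm : Measurable ψ := hφae.measurable_mk
  have hψae : φ =ᵐ[ν] ψ := hφae.ae_eq_mk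
  let U : X × Y → ℝ := fun p => tl (p.1, ψ p.1) p.2
  have hU : Measurable U := by
    have h1 : Measurable fun p : X × Y => ((p.1, ψ p.1), p.2) := by fun_prop
    exact htl.comp h1
  have hUpos : ∀ p, 0 < U p := fun p => htlpos _ _
  have hUle : ∀ p, U p * (1 + G p) ≤ 2 := fun p => by
    have : U p * (1 + G p) = tilt (((ψ p.1).1 ⬝ᵥ D p + (ψ p.1).2 * f p)) := by
      simp only [U, tl, hg]
      field_simp [(hG1 p).ne']
    rw [this]
    exact tilt_le_two _
  have hUint : ∀ x, Integrable (fun w => U (x, w)) (κ x) := fun x =>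
    Integrable.of_bound (C := 2) (hU.comp measurable_prodMk_left).aestronglyMeasurable
      (Eventually.of_forall fun w => by
        rw [Real.norm_of_nonneg (hUpos _).le]
        refine le_trans ?_ (hUle (x, w))
        nlinarith [hUpos (x, w), hG0 (x, w)])
  let n : X → ℝ := fun x => ∫ w, U (x, w) ∂(κ x)
  have hn : Measurable n :=
    (StronglyMeasurable.integral_kernel_prod_right' (κ := κ) hU.stronglyMeasurable).measurable
  have hnpos : ∀ x, 0 < n x := fun x => by
    refine (integral_pos_iff_support_of_nonneg (fun w => (hUpos _).le) (hUint x)).2 ?_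
    have : Function.support (fun w => U (x, w)) = univ := by
      ext w; simp [(hUpos (x, w)).ne']
    rw [this]; simp
  refine ⟨fun p => (n p.1)⁻¹ * U p, (hn.comp measurable_fst).inv.mul hU,
    fun p => mul_pos (inv_pos.2 (hnpos _)) (hUpos p), fun x => ?_,
    fun x => ⟨(n x)⁻¹ * 2, fun w => ?_⟩, ?_⟩
  · simp only [integral_const_mul]
    exact inv_mul_cancel₀ (hnpos x).ne'
  · rw [mul_assoc]
    exact mul_le_mul_of_nonneg_left (hUle _) (inv_pos.2 (hnpos x)).le
  · filter_upwards [hNA, hno, hψae] with x h1 h2 h3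
    obtain ⟨y, a, h4, h5⟩ := exists_weighted_tilt h1 (f := fun w => f (x, w))
      (g := fun w => g (x, w)) (hgm.comp measurable_prodMk_left) (fun w => hgpos _)
      (fun w => hg1 _)
      (fun i => Integrable.of_bound (C := 1)
        ((hgm.comp measurable_prodMk_left).mul ((measurable_pi_apply i).comp
          (hD.comp measurable_prodMk_left))).aestronglyMeasurable
        (Eventually.of_forall fun w => hgb _ _ (hDG _ i)))
      (Integrable.of_bound (C := 1)
        ((hgm.comp measurable_prodMk_left).mul (hf.comp measurable_prodMk_left)).aestronglyMeasurable
        (Eventually.of_forall fun w => hgb _ _ (hfG _)))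
    have hmem : (x, φ x) ∈ B := hφB x (y, a) ⟨h4, fun hx => h5 (h2 hx)⟩
    rw [h3] at hmem
    simp only [mul_assoc, integral_const_mul]
    refine ⟨fun i => ?_, fun hx => ?_⟩
    · exact mul_eq_zero_of_right _ (hmem.1 i)
    · exact mul_pos (inv_pos.2 (hnpos x)) (hmem.2 hx)

end Density

section Step

open ProbabilityTheory
open scoped Matrix

variable {X Y : Type*} [TopologicalSpace X] [PolishSpace X] [MeasurableSpace X] [BorelSpace X]
  [MeasurableSpace Y] {d : ℕ}

theorem exists_martingale_step (ν : Measure X) [IsProbabilityMeasure ν] (κ : Kernel X Y)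
    [IsMarkovKernel κ] {D : X × Y → Fin d → ℝ} (hD : Measurable D) {f W : X × Y → ℝ}
    (hf : Measurable f) (hW : Measurable W) {N : Set X}
    (hN : MeasurableSet N) (hNA : ∀ᵐ x ∂ν, NAm (κ x) fun w => D (x, w))
    (hno : ∀ᵐ x ∂ν, x ∈ N → ∀ y : Fin d → ℝ, ¬ ∀ᵐ w ∂(κ x), f (x, w) ≤ y ⬝ᵥ D (x, w)) :
    ∃ W' : X → ℝ, Measurable W' ∧ ∀ Q : Measure X, IsProbabilityMeasure Q → Q ≪ ν → ν ≪ Q →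
      Integrable W' Q → ∃ Q' : Measure (X × Y), IsProbabilityMeasure Q' ∧ Q'.fst = Q ∧
        Q' ≪ ν ⊗ₘ κ ∧ ν ⊗ₘ κ ≪ Q' ∧ Integrable W Q' ∧ Integrable f Q' ∧
        (∀ i, Integrable (fun p => D p i) Q') ∧
        (∀ i (A : Set X), MeasurableSet A → ∫ p in A ×ˢ univ, D p i ∂Q' = 0) ∧
        (ν N ≠ 0 → 0 < ∫ p in N ×ˢ univ, f p ∂Q') := by
  have hDi : ∀ i, Measurable fun p => D p i := fun i => (measurable_pi_apply i).comp hD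
  let G : X × Y → ℝ := fun p => |W p| + |f p| + ∑ i, |D p i|
  have hG : Measurable G := (hW.abs.add hf.abs).add
    (Finset.measurable_sum _ fun i _ => (hDi i).abs)
  have hsum : ∀ p, 0 ≤ ∑ i, |D p i| := fun p => Finset.sum_nonneg fun i _ => abs_nonneg _
  have hG0 : ∀ p, 0 ≤ G p := fun p =>
    add_nonneg (add_nonneg (abs_nonneg _) (abs_nonneg _)) (hsum p)
  have hfG : ∀ p, |f p| ≤ G p := fun p => by
    have := hsum p; have := abs_nonneg (W p); simp only [G]; linarith
  have hWG : ∀ p, |W p| ≤ G p := fun p => by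
    have := hsum p; have := abs_nonneg (f p); simp only [G]; linarith
  have hDG : ∀ p i, |D p i| ≤ G p := fun p i => by
    have h1 := Finset.single_le_sum (f := fun i => |D p i|) (fun i _ => abs_nonneg _)
      (Finset.mem_univ i)
    have := abs_nonneg (f p); have := abs_nonneg (W p)
    simp only [G]; linarith
  obtain ⟨Z, hZ, hZpos, hZ1, hZb, hZae⟩ := exists_tilt_density ν κ hD hf hG hG0 hfG hDG hN hNA hno
  have hZm : ∀ x, Measurable fun w => Z (x, w) := fun x => hZ.comp measurable_prodMk_left
  have hZh : ∀ (h : X × Y → ℝ), Measurable h → (∀ p, |h p| ≤ G p) → ∀ x,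
      Integrable (fun w => Z (x, w) * h (x, w)) (κ x) := by
    intro h hh hhG x
    obtain ⟨c, hc⟩ := hZb x
    refine Integrable.of_bound (C := c)
      ((hZm x).mul (hh.comp measurable_prodMk_left)).aestronglyMeasurable
      (Eventually.of_forall fun w => ?_)
    rw [norm_mul, Real.norm_of_nonneg (hZpos _).le]
    refine le_trans (mul_le_mul_of_nonneg_left ?_ (hZpos _).le) (hc w)
    rw [Real.norm_eq_abs]
    linarith [hhG (x, w)]
  have hZint : ∀ x, Integrable (fun w => Z (x, w)) (κ x) := fun x => by
    by_contra hcon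
    have := hZ1 x
    rw [integral_undef hcon] at this
    exact zero_ne_one this
  have hd : Measurable (Function.uncurry fun x w => ENNReal.ofReal (Z (x, w))) :=
    hZ.ennreal_ofReal
  let κ' : Kernel X Y := κ.withDensity fun x w => ENNReal.ofReal (Z (x, w))
  have hκ' : ∀ x, κ' x = (κ x).withDensity fun w => ENNReal.ofReal (Z (x, w)) := fun x =>
    Kernel.withDensity_apply κ hd x
  have hMk : IsMarkovKernel κ' := ⟨fun x => ⟨by
    rw [hκ', withDensity_apply _ MeasurableSet.univ, Measure.restrict_univ,
      ← ofReal_integral_eq_lintegral_ofReal (hZint x) (Eventually.of_forall fun w => (hZpos _).le),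
      hZ1 x, ENNReal.ofReal_one]⟩⟩
  have hcoe : ∀ p, ((Z p).toNNReal : ℝ) = Z p := fun p => Real.coe_toNNReal _ (hZpos p).le
  have hval : ∀ (h : X × Y → ℝ) x, ∫ w, h (x, w) ∂(κ' x) = ∫ w, Z (x, w) * h (x, w) ∂(κ x) := by
    intro h x
    rw [hκ']
    refine (integral_withDensity_eq_integral_smul (hZm x).real_toNNReal _).trans ?_
    refine integral_congr_ae (Eventually.of_forall fun w => ?_)
    change ((Z (x, w)).toNNReal : ℝ) * h (x, w) = Z (x, w) * h (x, w)
    rw [hcoe]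
  have h_int : ∀ (h : X × Y → ℝ), Measurable h → (∀ p, |h p| ≤ G p) → ∀ x,
      Integrable (fun w => h (x, w)) (κ' x) := by
    intro h hh hhG x
    rw [hκ']
    refine (integrable_withDensity_iff_integrable_smul (hZm x).real_toNNReal).2
      ((hZh h hh hhG x).congr (Eventually.of_forall fun w => ?_))
    change Z (x, w) * h (x, w) = ((Z (x, w)).toNNReal : ℝ) * h (x, w)
    rw [hcoe]
  have hac1 : ∀ x, κ' x ≪ κ x := fun x => hκ' x ▸ withDensity_absolutelyContinuous _ _
  have hac2 : ∀ x, κ x ≪ κ' x := fun x => hκ' x ▸ withDensity_absolutelyContinuous'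
    (hZm x).ennreal_ofReal.aemeasurable
    (Eventually.of_forall fun w => by simpa using hZpos (x, w))
  have hGm : Measurable fun x => ∫ w, G (x, w) ∂(κ' x) :=
    (StronglyMeasurable.integral_kernel_prod_right' (κ := κ') hG.stronglyMeasurable).measurable
  refine ⟨fun x => ∫ w, G (x, w) ∂(κ' x), hGm, fun Q hQ hQν hνQ hQW => ?_⟩
  have hQint : ∀ (h : X × Y → ℝ), Measurable h → (∀ p, |h p| ≤ G p) → Integrable h (Q ⊗ₘ κ') := by
    intro h hh hhG
    refine (Measure.integrable_compProd_iff hh.aestronglyMeasurable).2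
      ⟨Eventually.of_forall fun x => h_int h hh hhG x, ?_⟩
    refine hQW.mono' (StronglyMeasurable.integral_kernel_prod_right' (κ := κ')
      (f := fun p => ‖h p‖) hh.norm.stronglyMeasurable).aestronglyMeasurable
      (Eventually.of_forall fun x => ?_)
    rw [Real.norm_of_nonneg (integral_nonneg fun w => norm_nonneg _)]
    exact integral_mono (h_int h hh hhG x).norm
      (h_int G hG (fun p => (abs_of_nonneg (hG0 p)).le) x) fun w => hhG (x, w)
  have hset : ∀ (h : X × Y → ℝ), Measurable h → (∀ p, |h p| ≤ G p) → ∀ A : Set X,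
      MeasurableSet A → ∫ p in A ×ˢ univ, h p ∂(Q ⊗ₘ κ') =
        ∫ x in A, ∫ w, Z (x, w) * h (x, w) ∂(κ x) ∂Q := by
    intro h hh hhG A hA
    rw [Measure.setIntegral_compProd hA MeasurableSet.univ (hQint h hh hhG).integrableOn]
    simp only [Measure.restrict_univ, hval]
  have hZQ := hQν.ae_le hZae
  refine ⟨Q ⊗ₘ κ', inferInstance, Measure.fst_compProd _ _,
    Measure.AbsolutelyContinuous.compProd hQν (Eventually.of_forall hac1),
    Measure.AbsolutelyContinuous.compProd hνQ (Eventually.of_forall hac2),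
    hQint W hW hWG, hQint f hf hfG, fun i => hQint _ (hDi i) fun p => hDG p i,
    fun i A hA => ?_, fun hνN => ?_⟩
  · rw [hset _ (hDi i) (fun p => hDG p i) A hA]
    refine integral_eq_zero_of_ae (ae_restrict_of_ae ?_)
    filter_upwards [hZQ] with x hx
    exact hx.1 i
  · rw [hset f hf hfG N hN]
    have hQN : Q N ≠ 0 := fun h => hνN (hνQ h)
    have hpos : ∀ᵐ x ∂(Q.restrict N), 0 < ∫ w, Z (x, w) * f (x, w) ∂(κ x) := by
      rw [ae_restrict_iff' hN]
      filter_upwards [hZQ] with x hx hxN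
      exact hx.2 hxN
    have hi : Integrable (fun x => ∫ w, Z (x, w) * f (x, w) ∂(κ x)) (Q.restrict N) := by
      have h1 := ((Measure.integrable_compProd_iff hf.aestronglyMeasurable).1
        (hQint f hf hfG)).2
      have h2 : Integrable (fun x => ∫ w, f (x, w) ∂(κ' x)) Q :=
        h1.mono' (StronglyMeasurable.integral_kernel_prod_right' (κ := κ')
          hf.stronglyMeasurable).aestronglyMeasurable
          (Eventually.of_forall fun x => norm_integral_le_integral_norm _)
      simp only [hval] at h2
      exact h2.restrict
    rw [integral_pos_iff_support_of_nonneg_ae (hpos.mono fun x hx => hx.le) hi]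
    have : (Q.restrict N) univ ≤ (Q.restrict N)
        (Function.support fun x => ∫ w, Z (x, w) * f (x, w) ∂(κ x)) :=
      measure_mono_ae (hpos.mono fun x hx _ => hx.ne')
    refine lt_of_lt_of_le ?_ this
    rw [Measure.restrict_apply_univ]
    exact pos_iff_ne_zero.2 hQN

end Step

section Paths

open ProbabilityTheory

variable {Ω₁ : Type} [MeasurableSpace Ω₁]

/-- Appending a coordinate to a path. -/
def snocMap {t : ℕ} (p : (Fin t → Ω₁) × Ω₁) : Fin (t + 1) → Ω₁ := Fin.snoc p.1 p.2

theorem restr_snocMap {t s : ℕ} (h : s ≤ t) (p : (Fin t → Ω₁) × Ω₁) :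
    restr Ω₁ s (h.trans t.le_succ) (snocMap p) = restr Ω₁ s h p.1 := by
  funext i
  have : Fin.castLE (h.trans t.le_succ) i = Fin.castSucc (Fin.castLE h i) := rfl
  simp only [restr, snocMap, this, Fin.snoc_castSucc]

theorem restr_self {t : ℕ} (ω : Fin t → Ω₁) : restr Ω₁ t le_rfl ω = ω := rfl

theorem restr_snocMap_self {t : ℕ} (p : (Fin t → Ω₁) × Ω₁) :
    restr Ω₁ t t.le_succ (snocMap p) = p.1 := restr_snocMap le_rfl p

theorem restr_restr {r s t : ℕ} (h₁ : r ≤ s) (h₂ : s ≤ t) (ω : Fin t → Ω₁) :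
    restr Ω₁ r h₁ (restr Ω₁ s h₂ ω) = restr Ω₁ r (h₁.trans h₂) ω := rfl

theorem measurable_restr {s t : ℕ} (h : s ≤ t) : Measurable (restr Ω₁ s h) :=
  measurable_pi_lambda _ fun _ => measurable_pi_apply _

theorem measurable_snocMap {t : ℕ} : Measurable (snocMap (Ω₁ := Ω₁) (t := t)) := by
  refine measurable_pi_lambda _ fun i => ?_
  refine Fin.lastCases ?_ (fun j => ?_) i
  · simpa [snocMap] using measurable_snd
  · simp only [snocMap, Fin.snoc_castSucc]
    exact (measurable_pi_apply j).comp measurable_fst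

theorem bind_eq_map_compProd {t : ℕ} {ν : Measure (Fin t → Ω₁)} [IsProbabilityMeasure ν]
    {κ : (Fin t → Ω₁) → Measure Ω₁} {k : Kernel (Fin t → Ω₁) Ω₁} [IsMarkovKernel k]
    (hk : ∀ᵐ x ∂ν, κ x = k x) :
    ν.bind (fun ω => Measure.map (Fin.snoc ω) (κ ω)) = (ν ⊗ₘ k).map snocMap := by
  have hsn : ∀ x : Fin t → Ω₁, Measurable fun w : Ω₁ => (Fin.snoc x w : Fin (t + 1) → Ω₁) :=
    fun x => measurable_snocMap.comp (measurable_prodMk_left (x := x))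
  have h1 : (fun ω => Measure.map (Fin.snoc (α := fun _ => Ω₁) ω) (κ ω)) =ᵐ[ν]
      fun ω => Measure.map (Fin.snoc (α := fun _ => Ω₁) ω) (k ω) := by
    filter_upwards [hk] with x hx
    rw [hx]
  have h2 : ∀ s : Set (Fin (t + 1) → Ω₁), MeasurableSet s → ∀ x,
      Measure.map (Fin.snoc (α := fun _ => Ω₁) x) (k x) s =
        k x (Prod.mk x ⁻¹' (snocMap ⁻¹' s)) := by
    intro s hs x
    rw [Measure.map_apply (hsn x) hs]
    rfl
  have h3 : Measurable fun x => Measure.map (Fin.snoc (α := fun _ => Ω₁) x) (k x) := by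
    refine Measure.measurable_of_measurable_coe _ fun s hs => ?_
    simp_rw [h2 s hs]
    exact Kernel.measurable_kernel_prodMk_left (measurable_snocMap hs)
  rw [Measure.bind_congr_right h1]
  ext s hs
  rw [Measure.bind_apply hs h3.aemeasurable, Measure.map_apply measurable_snocMap hs,
    Measure.compProd_apply (measurable_snocMap hs)]
  simp_rw [h2 s hs]

variable [TopologicalSpace Ω₁] [PolishSpace Ω₁] [BorelSpace Ω₁]

theorem continuous_restr {s t : ℕ} (h : s ≤ t) : Continuous (restr Ω₁ s h) :=
  continuous_pi fun _ => continuous_apply _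

theorem continuous_snocMap {t : ℕ} : Continuous (snocMap (Ω₁ := Ω₁) (t := t)) := by
  refine continuous_pi fun i => ?_
  refine Fin.lastCases ?_ (fun j => ?_) i
  · simpa [snocMap] using continuous_snd
  · simp only [snocMap, Fin.snoc_castSucc]
    exact (continuous_apply j).comp continuous_fst

variable {Pt : (t : ℕ) → (Fin t → Ω₁) → Set (ProbabilityMeasure Ω₁)}

theorem measurable_coe_measure {X : Type*} [MeasurableSpace X] {κ : X → ProbabilityMeasure Ω₁}
    (hκ : @Measurable _ _ (univComp X) (borel (ProbabilityMeasure Ω₁)) κ) :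
    Measurable[univComp X] fun x => (κ x : Measure Ω₁) :=
  (measurable_toMeasure_borel (Y := Ω₁)).comp hκ

theorem isProbabilityMeasure_of_mem_measFam {t : ℕ} {μ : Measure (Fin t → Ω₁)}
    (hμ : μ ∈ MeasFam Ω₁ Pt t) : IsProbabilityMeasure μ := by
  induction t with
  | zero =>
    have : μ = Measure.dirac Fin.elim0 := hμ
    rw [this]; infer_instance
  | succ t ih =>
    obtain ⟨ν, hν, κ, hκ, -, rfl⟩ := hμ
    have := ih hν
    obtain ⟨k, hk, hae⟩ := exists_kernel_ae_eq (measurable_coe_measure hκ) ν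
    rw [bind_eq_map_compProd hae]
    exact Measure.isProbabilityMeasure_map measurable_snocMap.aemeasurable

theorem exists_compProd_of_mem_measFam {t : ℕ} {μ : Measure (Fin (t + 1) → Ω₁)}
    (hμ : μ ∈ MeasFam Ω₁ Pt (t + 1)) :
    ∃ ν ∈ MeasFam Ω₁ Pt t, ∃ k : Kernel (Fin t → Ω₁) Ω₁, IsMarkovKernel k ∧
      (∀ᵐ x ∂ν, ∃ P ∈ Pt t x, (P : Measure Ω₁) = k x) ∧ μ = (ν ⊗ₘ k).map snocMap := by
  obtain ⟨ν, hν, κ, hκ, hmem, rfl⟩ := hμ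
  have := isProbabilityMeasure_of_mem_measFam hν
  obtain ⟨k, hk, hae⟩ := exists_kernel_ae_eq (measurable_coe_measure hκ) ν
  exact ⟨ν, hν, k, hk, hae.mono fun x hx => ⟨κ x, hmem x, hx⟩, bind_eq_map_compProd hae⟩

theorem map_restr_map_snocMap {t s : ℕ} (h : s ≤ t) (Q : Measure ((Fin t → Ω₁) × Ω₁)) :
    (Q.map snocMap).map (restr Ω₁ s (h.trans t.le_succ)) = Q.fst.map (restr Ω₁ s h) := by
  rw [Measure.map_map (measurable_restr _) measurable_snocMap, Measure.fst,
    Measure.map_map (measurable_restr _) measurable_fst]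
  congr 1
  funext p
  exact restr_snocMap h p

theorem map_restr_self {t : ℕ} (Q : Measure (Fin t → Ω₁)) : Q.map (restr Ω₁ t le_rfl) = Q :=
  Measure.map_id

theorem map_restr_mem_measFam {s t : ℕ} (h : s ≤ t) {μ : Measure (Fin t → Ω₁)}
    (hμ : μ ∈ MeasFam Ω₁ Pt t) : μ.map (restr Ω₁ s h) ∈ MeasFam Ω₁ Pt s := by
  induction t with
  | zero =>
    obtain rfl : s = 0 := Nat.le_zero.1 h
    rwa [map_restr_self]
  | succ t ih =>
    rcases h.eq_or_lt with rfl | hlt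
    · rwa [map_restr_self]
    · obtain ⟨ν, hν, k, hk, -, rfl⟩ := exists_compProd_of_mem_measFam hμ
      have := isProbabilityMeasure_of_mem_measFam hν
      rw [map_restr_map_snocMap (Nat.lt_succ_iff.1 hlt), Measure.fst_compProd]
      exact ih _ hν

theorem exists_measFam_step {t : ℕ} (π : Param (Pt t)) (hne : ∀ x, (Pt t x).Nonempty)
    {ν : Measure (Fin t → Ω₁)} (hν : ν ∈ MeasFam Ω₁ Pt t) {A : Set ((Fin t → Ω₁) × (ℕ → ℕ))}
    (hA : AnalyticSet A) (hbase : ∀ p ∈ A, π.base p.2 = p.1) :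
    ∃ k : Kernel (Fin t → Ω₁) Ω₁, IsMarkovKernel k ∧
      (ν ⊗ₘ k).map snocMap ∈ MeasFam Ω₁ Pt (t + 1) ∧
      ∀ᵐ x ∂ν, (∃ ρ, (x, ρ) ∈ A) → ∃ ρ, (x, ρ) ∈ A ∧ k x = π.kernel ρ := by
  have := isProbabilityMeasure_of_mem_measFam hν
  obtain ⟨σ₁, hσ₁, h₁⟩ := exists_univComp_selection hA
  have hgr : AnalyticSet {p : (Fin t → Ω₁) × (ℕ → ℕ) | π.base p.2 = p.1} :=
    (isClosed_eq (π.cont_base.comp continuous_snd) continuous_fst).analyticSet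
  obtain ⟨σ₀, hσ₀, h₀⟩ := exists_univComp_selection hgr
  have h₀' : ∀ x, π.base (σ₀ x) = x := fun x => by
    obtain ⟨P, hP⟩ := hne x
    obtain ⟨ρ, hρ, -⟩ := (π.mem_iff x P).1 hP
    exact h₀ x ρ hρ
  have hE : MeasurableSet[univComp (Fin t → Ω₁)] (Prod.fst '' A) :=
    measurableSet_univComp_of_analyticSet (hA.image_of_continuous continuous_fst)
  classical
  let σ : (Fin t → Ω₁) → ℕ → ℕ := fun x => if x ∈ Prod.fst '' A then σ₁ x else σ₀ x
  have hσ : Measurable[univComp (Fin t → Ω₁)] σ := Measurable.ite hE hσ₁ hσ₀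
  have hσb : ∀ x, π.base (σ x) = x := fun x => by
    by_cases hx : x ∈ Prod.fst '' A
    · simp only [σ, hx, if_true]
      obtain ⟨⟨x', ρ⟩, hp, rfl⟩ := hx
      exact hbase _ (h₁ _ _ hp)
    · simp only [σ, hx, if_false, h₀']
  have hae := aemeasurable_of_univComp hσ ν
  let k : Kernel (Fin t → Ω₁) Ω₁ := π.kernel.comap (hae.mk σ) hae.measurable_mk
  have hk : ∀ᵐ x ∂ν, (π.meas (σ x) : Measure Ω₁) = k x := by
    filter_upwards [hae.ae_eq_mk] with x hx
    rw [hx]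
    rfl
  refine ⟨k, inferInstance, ⟨ν, hν, fun x => π.meas (σ x),
    @Param.measurable_meas_comp _ _ _ _ _ _ _ _ π _ (univComp (Fin t → Ω₁)) σ hσ, fun x => ?_,
    (bind_eq_map_compProd hk).symm⟩, ?_⟩
  · have := π.meas_mem (σ x)
    rwa [hσb] at this
  · filter_upwards [hk] with x hx
    rintro ⟨ρ, hρ⟩
    refine ⟨σ x, ?_, hx.symm⟩
    have hx' : x ∈ Prod.fst '' A := ⟨_, hρ, rfl⟩
    simp only [σ, hx', if_true]
    exact h₁ x ρ hρ

theorem exists_extend_measFam [Nonempty Ω₁] {T : ℕ}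
    (hne : ∀ t, t < T → ∀ ω, (Pt t ω).Nonempty)
    (hgraph : ∀ t, t < T →
      AnalyticSet {p : (Fin t → Ω₁) × ProbabilityMeasure Ω₁ | p.2 ∈ Pt t p.1})
    {s t : ℕ} (h : s ≤ t) (htT : t ≤ T) {ν : Measure (Fin s → Ω₁)} (hν : ν ∈ MeasFam Ω₁ Pt s) :
    ∃ μ ∈ MeasFam Ω₁ Pt t, μ.map (restr Ω₁ s h) = ν := by
  induction t, h using Nat.le_induction with
  | base => exact ⟨ν, hν, map_restr_self ν⟩
  | succ t hst ih =>
    obtain ⟨μ, hμ, hμν⟩ := ih (by omega)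
    obtain ⟨π⟩ := exists_param (hne t (by omega)) (hgraph t (by omega))
    obtain ⟨k, hk, hmem, -⟩ := exists_measFam_step π (hne t (by omega)) hμ
      (A := ∅) isClosed_empty.analyticSet (by simp)
    have := isProbabilityMeasure_of_mem_measFam hμ
    refine ⟨_, hmem, ?_⟩
    rw [map_restr_map_snocMap hst, Measure.fst_compProd, hμν]

end Paths

section AnalyticNA

open ProbabilityTheory
open scoped Matrix

variable {Z Y : Type*} [TopologicalSpace Z] [PolishSpace Z] [MeasurableSpace Z] [BorelSpace Z]
  [MeasurableSpace Y] {d : ℕ}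

theorem analyticSet_NAm (k : Kernel Z Y) [IsMarkovKernel k] {D : Z × Y → Fin d → ℝ}
    (hD : Measurable D) : AnalyticSet {z | NAm (k z) fun w => D (z, w)} := by
  have hDi : ∀ i, Measurable fun p => D p i := fun i => (measurable_pi_apply i).comp hD
  let g : Z × Y → ℝ := fun p => (1 + ∑ i, |D p i|)⁻¹
  have hs : ∀ p, 0 ≤ ∑ i, |D p i| := fun p => Finset.sum_nonneg fun i _ => abs_nonneg _
  have hgm : Measurable g :=
    ((Finset.measurable_sum _ fun i _ => (hDi i).abs).const_add 1).inv
  have hgpos : ∀ p, 0 < g p := fun p => inv_pos.2 (by linarith [hs p])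
  have hg1 : ∀ p, g p ≤ 1 := fun p => inv_le_one_of_one_le₀ (by linarith [hs p])
  have hgD : ∀ p i, ‖g p * D p i‖ ≤ 1 := fun p i => by
    rw [norm_mul, Real.norm_of_nonneg (hgpos p).le, Real.norm_eq_abs]
    rw [inv_mul_le_iff₀ (by linarith [hs p])]
    have := Finset.single_le_sum (f := fun i => |D p i|) (fun i _ => abs_nonneg _)
      (Finset.mem_univ i)
    linarith
  let B : Set (Z × (Fin d → ℝ)) :=
    {q | ∀ i, ∫ w, g (q.1, w) * tilt (q.2 ⬝ᵥ D (q.1, w)) * D (q.1, w) i ∂(k q.1) = 0}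
  have hB : MeasurableSet B := by
    have : B = ⋂ i, {q : Z × (Fin d → ℝ) |
        ∫ w, g (q.1, w) * tilt (q.2 ⬝ᵥ D (q.1, w)) * D (q.1, w) i ∂(k q.1) = 0} := by
      ext; simp [B]
    rw [this]
    refine MeasurableSet.iInter fun i => ?_
    have h1 : Measurable fun r : (Z × (Fin d → ℝ)) × Y => (r.1.1, r.2) := by fun_prop
    have h2 : Measurable fun r : (Z × (Fin d → ℝ)) × Y =>
        g (r.1.1, r.2) * tilt (r.1.2 ⬝ᵥ D (r.1.1, r.2)) * D (r.1.1, r.2) i := by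
      refine ((hgm.comp h1).mul (continuous_tilt.measurable.comp
        (Finset.measurable_sum _ fun j _ => Measurable.mul ?_ ((hDi j).comp h1)))).mul
        ((hDi i).comp h1)
      fun_prop
    let k' : Kernel (Z × (Fin d → ℝ)) Y := Kernel.prodMkRight _ k
    have h3 := (StronglyMeasurable.integral_kernel_prod_right' (κ := k')
      h2.stronglyMeasurable).measurable
    exact h3 (measurableSet_singleton 0)
  convert hB.analyticSet.image_of_continuous continuous_fst using 1
  ext z
  constructor
  · intro hz
    have hgz : Measurable fun w => g (z, w) := hgm.comp measurable_prodMk_left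
    obtain ⟨y, a, h1, -⟩ := exists_weighted_tilt (f := fun _ => 0) hz hgz (fun w => hgpos _)
      (fun w => hg1 _)
      (fun i => Integrable.of_bound (C := 1)
        (hgz.mul ((hDi i).comp measurable_prodMk_left)).aestronglyMeasurable
        (Eventually.of_forall fun w => hgD _ i)) (by simp)
    refine ⟨(z, y), fun i => ?_, rfl⟩
    simpa using h1 i
  · rintro ⟨⟨z', y⟩, h, rfl⟩
    refine NAm_of_integral_eq_zero (Z := fun w => g (z', w) * tilt (y ⬝ᵥ D (z', w)))
      (fun w => mul_pos (hgpos _) (tilt_pos _)) (fun i => ?_) h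
    have hgz : Measurable fun w => g (z', w) := hgm.comp measurable_prodMk_left
    have hDz : Measurable fun w => D (z', w) := hD.comp measurable_prodMk_left
    refine Integrable.of_bound (C := 2) ((hgz.mul (continuous_tilt.measurable.comp
      (measurable_dot hDz y))).mul ((measurable_pi_apply i).comp hDz)).aestronglyMeasurable
      (Eventually.of_forall fun w => ?_)
    have : g (z', w) * tilt (y ⬝ᵥ D (z', w)) * D (z', w) i =
      tilt (y ⬝ᵥ D (z', w)) * (g (z', w) * D (z', w) i) := by ring
    rw [this, norm_mul]
    calc _ ≤ (2 : ℝ) * 1 := mul_le_mul (abs_tilt_le_two _) (hgD _ i) (norm_nonneg _) (by norm_num)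
      _ = 2 := by norm_num

end AnalyticNA

section Martingales

open ProbabilityTheory
open scoped Matrix

variable {Ω₁ : Type} [MeasurableSpace Ω₁] [TopologicalSpace Ω₁] [PolishSpace Ω₁] [BorelSpace Ω₁]
  {d T : ℕ} {S : (t : ℕ) → (Fin t → Ω₁) → Fin d → ℝ}

/-- The one-step increment as a function on the product space. -/
def stepD (S : (t : ℕ) → (Fin t → Ω₁) → Fin d → ℝ) (t : ℕ) (p : (Fin t → Ω₁) × Ω₁) : Fin d → ℝ :=
  S (t + 1) (snocMap p) - S t p.1

theorem measurable_stepD (hS : ∀ t, t ≤ T → Measurable (S t)) {t : ℕ} (ht : t < T) :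
    Measurable (stepD S t) :=
  ((hS _ ht).comp measurable_snocMap).sub ((hS _ ht.le).comp measurable_fst)

/-- The martingale property tested on Borel sets. -/
def BMart (S : (t : ℕ) → (Fin t → Ω₁) → Fin d → ℝ) {t : ℕ} (Q : Measure (Fin t → Ω₁)) : Prop :=
  (∀ (s : ℕ) (h : s ≤ t) (i : Fin d), Integrable (fun ω => S s (restr Ω₁ s h ω) i) Q) ∧
  ∀ (s : ℕ) (h : s + 1 ≤ t) (i : Fin d) (B : Set (Fin s → Ω₁)), MeasurableSet B →
    ∫ ω in restr Ω₁ s (s.le_succ.trans h) ⁻¹' B, (S (s + 1) (restr Ω₁ (s + 1) h ω) i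
      - S s (restr Ω₁ s (s.le_succ.trans h) ω) i) ∂Q = 0

theorem exists_borel_ae_eq_filtr {t s : ℕ} (h : s ≤ t) (Q : Measure (Fin t → Ω₁))
    [IsProbabilityMeasure Q] {A : Set (Fin t → Ω₁)} (hA : MeasurableSet[filtr Ω₁ t s h] A) :
    ∃ B : Set (Fin s → Ω₁), MeasurableSet B ∧ A =ᵐ[Q] restr Ω₁ s h ⁻¹' B := by
  obtain ⟨B, hB, rfl⟩ := hA
  have := Measure.isProbabilityMeasure_map (μ := Q) (measurable_restr (Ω₁ := Ω₁) h).aemeasurable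
  obtain ⟨B', hB', hae⟩ := hB (Q.map (restr Ω₁ s h)) this
  exact ⟨B', hB', (ae_eq_comp (measurable_restr h).aemeasurable hae :)⟩

theorem BMart.isMartMeas {t : ℕ} {Q : Measure (Fin t → Ω₁)} [IsProbabilityMeasure Q]
    (hQ : BMart S Q) : IsMartMeas Ω₁ S Q := by
  refine ⟨hQ.1, fun s h i A hA => ?_⟩
  obtain ⟨B, hB, hae⟩ := exists_borel_ae_eq_filtr _ Q hA
  rw [setIntegral_congr_set hae, setIntegral_congr_set hae, ← sub_eq_zero,
    ← integral_sub (hQ.1 _ _ i).integrableOn (hQ.1 _ _ i).integrableOn]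
  exact hQ.2 s h i B hB

theorem bmart_zero (Q : Measure (Fin 0 → Ω₁)) [IsProbabilityMeasure Q] : BMart S Q :=
  ⟨fun _ _ _ => Integrable.of_finite, fun s h => absurd h (by omega)⟩

theorem bmart_succ (hS : ∀ t, t ≤ T → Measurable (S t)) {t : ℕ} (ht : t < T)
    {Q' : Measure ((Fin t → Ω₁) × Ω₁)} (hQ : BMart S Q'.fst)
    (h_int : ∀ i, Integrable (fun p => stepD S t p i) Q')
    (hzero : ∀ i (A : Set (Fin t → Ω₁)), MeasurableSet A →
      ∫ p in A ×ˢ univ, stepD S t p i ∂Q' = 0) : BMart S (Q'.map snocMap) := by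
  have hSm : ∀ (s r : ℕ) (h : s ≤ r), s ≤ T → ∀ i : Fin d,
      Measurable fun ω : Fin r → Ω₁ => S s (restr Ω₁ s h ω) i := fun s r h hsT i =>
    (measurable_pi_apply i).comp ((hS s hsT).comp (measurable_restr h))
  constructor
  · intro s h i
    rw [integrable_map_measure (hSm s _ h (by omega) i).aestronglyMeasurable
      measurable_snocMap.aemeasurable]
    rcases Nat.lt_or_ge t s with hlt | hle
    · obtain rfl : s = t + 1 := by omega
      have h1 := hQ.1 t le_rfl i
      rw [Measure.fst, integrable_map_measure (hSm t _ le_rfl (by omega) i).aestronglyMeasurable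
        measurable_fst.aemeasurable] at h1
      refine (h1.add (h_int i)).congr (Eventually.of_forall fun p => ?_)
      simp [stepD, restr_self]
    · have h1 := hQ.1 s hle i
      rw [Measure.fst, integrable_map_measure (hSm s _ hle (by omega) i).aestronglyMeasurable
        measurable_fst.aemeasurable] at h1
      refine h1.congr (Eventually.of_forall fun p => ?_)
      simp only [Function.comp, restr_snocMap hle p]
  · intro s h i B hB
    have hm : Measurable fun ω : Fin (t + 1) → Ω₁ => S (s + 1) (restr Ω₁ (s + 1) h ω) i
      - S s (restr Ω₁ s (s.le_succ.trans h) ω) i :=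
      (hSm _ _ _ (by omega) i).sub (hSm _ _ _ (by omega) i)
    rw [setIntegral_map (measurable_restr _ hB) hm.aestronglyMeasurable
      measurable_snocMap.aemeasurable]
    rcases Nat.lt_or_ge s t with hlt | hle
    · have h1 := hQ.2 s hlt i B hB
      have hm' : Measurable fun ω : Fin t → Ω₁ => S (s + 1) (restr Ω₁ (s + 1) hlt ω) i
        - S s (restr Ω₁ s (s.le_succ.trans hlt) ω) i :=
        (hSm _ _ _ (by omega) i).sub (hSm _ _ _ (by omega) i)
      rw [Measure.fst, setIntegral_map (measurable_restr _ hB) hm'.aestronglyMeasurable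
        measurable_fst.aemeasurable] at h1
      rw [← h1]
      have hset : snocMap ⁻¹' (restr Ω₁ s (s.le_succ.trans h) ⁻¹' B) =
          Prod.fst ⁻¹' (restr Ω₁ s (s.le_succ.trans hlt) ⁻¹' B) := by
        ext p
        simp only [mem_preimage, restr_snocMap (s.le_succ.trans hlt) p]
      rw [hset]
      refine setIntegral_congr_fun (measurable_fst (measurable_restr _ hB)) fun p _ => ?_
      simp only [restr_snocMap hlt p, restr_snocMap (s.le_succ.trans hlt) p]
    · obtain rfl : s = t := by omega
      have hset : snocMap ⁻¹' (restr Ω₁ s (s.le_succ.trans h) ⁻¹' B) = B ×ˢ (univ : Set Ω₁) := by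
        ext p
        simp only [mem_preimage, restr_snocMap_self p, mem_prod, mem_univ, and_true]
      rw [hset, ← hzero i B hB]
      refine setIntegral_congr_fun (hB.prod MeasurableSet.univ) fun p _ => ?_
      simp only [restr_snocMap_self p, stepD, Pi.sub_apply, restr_self]

/-- `ν` is equivalent to martingale measures in `R` integrating any prescribed function. -/
def Good (S : (t : ℕ) → (Fin t → Ω₁) → Fin d → ℝ) {t : ℕ} (ν : Measure (Fin t → Ω₁))
    (R : Set (Measure (Fin t → Ω₁))) : Prop :=
  ∀ W : (Fin t → Ω₁) → ℝ, Measurable W → ∃ Q ∈ R, IsProbabilityMeasure Q ∧ Q ≪ ν ∧ ν ≪ Q ∧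
    Integrable W Q ∧ BMart S Q

theorem good_zero (ν : Measure (Fin 0 → Ω₁)) [IsProbabilityMeasure ν] : Good S ν univ :=
  fun _ _ => ⟨ν, mem_univ _, inferInstance, Measure.AbsolutelyContinuous.rfl,
    Measure.AbsolutelyContinuous.rfl, Integrable.of_finite, bmart_zero ν⟩

theorem Good.step (hS : ∀ t, t ≤ T → Measurable (S t)) {t : ℕ} (ht : t < T)
    {ν : Measure (Fin t → Ω₁)} [IsProbabilityMeasure ν] {R : Set (Measure (Fin t → Ω₁))}
    (hν : Good S ν R) (k : Kernel (Fin t → Ω₁) Ω₁) [IsMarkovKernel k]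
    (hNA : ∀ᵐ x ∂ν, NAm (k x) fun w => stepD S t (x, w)) {F : (Fin (t + 1) → Ω₁) → ℝ}
    (hF : Measurable F) {N : Set (Fin t → Ω₁)} (hN : MeasurableSet N)
    (hno : ∀ᵐ x ∂ν, x ∈ N → ∀ y : Fin d → ℝ,
      ¬ ∀ᵐ w ∂(k x), F (snocMap (x, w)) ≤ y ⬝ᵥ stepD S t (x, w)) :
    Good S ((ν ⊗ₘ k).map snocMap) {Q | Q.map (restr Ω₁ t t.le_succ) ∈ R ∧ Integrable F Q ∧
      (ν N ≠ 0 → 0 < ∫ ω in restr Ω₁ t t.le_succ ⁻¹' N, F ω ∂Q)} := by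
  intro W hW
  obtain ⟨W', hW', hstep⟩ := exists_martingale_step ν k (measurable_stepD hS ht)
    (hF.comp measurable_snocMap) (hW.comp measurable_snocMap) hN hNA hno
  obtain ⟨Q, hQR, hQp, hQν, hνQ, hQW, hQm⟩ := hν W' hW'
  obtain ⟨Q', hp, hfst, hac1, hac2, hiW, hiF, hiD, hz, hpos⟩ := hstep Q hQp hQν hνQ hQW
  have hsm : AEMeasurable (snocMap (Ω₁ := Ω₁) (t := t)) Q' := measurable_snocMap.aemeasurable
  refine ⟨Q'.map snocMap, ⟨?_, ?_, fun hνN => ?_⟩, Measure.isProbabilityMeasure_map hsm,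
    hac1.map measurable_snocMap, hac2.map measurable_snocMap, ?_,
    bmart_succ hS ht (hfst.symm ▸ hQm) hiD hz⟩
  · rw [map_restr_map_snocMap le_rfl, hfst, map_restr_self]
    exact hQR
  · exact (integrable_map_measure hF.aestronglyMeasurable hsm).2 hiF
  · rw [setIntegral_map (measurable_restr _ hN) hF.aestronglyMeasurable hsm]
    have hset : snocMap ⁻¹' (restr Ω₁ t t.le_succ ⁻¹' N) = N ×ˢ (univ : Set Ω₁) := by
      ext p
      simp only [mem_preimage, restr_snocMap_self p, mem_prod, mem_univ, and_true]
    rw [hset]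
    exact hpos hνN
  · exact (integrable_map_measure hW.aestronglyMeasurable hsm).2 hiW

variable {Pt : (t : ℕ) → (Fin t → Ω₁) → Set (ProbabilityMeasure Ω₁)}

theorem Good.normal_step (hS : ∀ t, t ≤ T → Measurable (S t)) {t : ℕ} (ht : t < T)
    (π : Param (Pt t)) (hconv : ∀ x, ConvexPM (Pt t x))
    (hne : ∀ x, (Pt t x).Nonempty)
    {ν : Measure (Fin t → Ω₁)} (hνm : ν ∈ MeasFam Ω₁ Pt t) {R : Set (Measure (Fin t → Ω₁))}
    (hν : Good S ν R) (hNA : ∀ᵐ x ∂ν, NAC (Pt t x) fun w => stepD S t (x, w))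
    {ν₀ : Measure (Fin t → Ω₁)} [SFinite ν₀] (hac : ν₀ ≪ ν) (k₀ : Kernel (Fin t → Ω₁) Ω₁) [IsMarkovKernel k₀]
    (hk₀ : ∀ᵐ x ∂ν₀, ∃ P ∈ Pt t x, (P : Measure Ω₁) = k₀ x) :
    ∃ μ ∈ MeasFam Ω₁ Pt (t + 1), (ν₀ ⊗ₘ k₀).map snocMap ≪ μ ∧
      Good S μ {Q | Q.map (restr Ω₁ t t.le_succ) ∈ R} := by
  have := isProbabilityMeasure_of_mem_measFam hνm
  let kz : Kernel ((Fin t → Ω₁) × (ℕ → ℕ)) Ω₁ := π.kernel.comap Prod.snd measurable_snd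
  let k₁ : Kernel ((Fin t → Ω₁) × (ℕ → ℕ)) Ω₁ := k₀.comap Prod.fst measurable_fst
  have hDm : Measurable fun p : ((Fin t → Ω₁) × (ℕ → ℕ)) × Ω₁ => stepD S t (p.1.1, p.2) :=
    (measurable_stepD hS ht).comp (by fun_prop)
  let A₀ : Set ((Fin t → Ω₁) × (ℕ → ℕ)) := {z | π.base z.2 = z.1} ∩
    {z | NAm (kz z) fun w => stepD S t (z.1, w)}
  have hA₀ : AnalyticSet A₀ := AnalyticSet.inter'
    (isClosed_eq (π.cont_base.comp continuous_snd) continuous_fst).analyticSet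
    (analyticSet_NAm kz hDm)
  obtain ⟨N₀, hEN, hN₀, hνN₀⟩ := exists_measurable_superset_of_null (ae_iff.1 hk₀)
  let A : Set ((Fin t → Ω₁) × (ℕ → ℕ)) := A₀ ∩ ({z | z.1 ∈ N₀} ∪ {z | k₁ z ≪ kz z})
  have hA : AnalyticSet A := AnalyticSet.inter' hA₀ ((measurable_fst hN₀).union
    (Kernel.measurableSet_absolutelyContinuous k₁ kz)).analyticSet
  obtain ⟨k, hk, hkm, hkA⟩ := exists_measFam_step π hne hνm hA fun p hp => hp.1.1
  have hex : ∀ᵐ x ∂ν, ∃ ρ, (x, ρ) ∈ A := by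
    filter_upwards [hNA] with x hx
    by_cases hxN : x ∈ N₀
    · obtain ⟨P₀, hP₀⟩ := hne x
      obtain ⟨P, hP, -, hPN⟩ := exists_NAm_of_ac (hconv x) hx hP₀
      obtain ⟨ρ, hρ, rfl⟩ := (π.mem_iff x P).1 hP
      exact ⟨ρ, ⟨hρ, hPN⟩, Or.inl hxN⟩
    · obtain ⟨P₀, hP₀, hP₀k⟩ : ∃ P ∈ Pt t x, (P : Measure Ω₁) = k₀ x := by
        by_contra h
        exact hxN (hEN h)
      obtain ⟨P, hP, hPac, hPN⟩ := exists_NAm_of_ac (hconv x) hx hP₀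
      obtain ⟨ρ, hρ, rfl⟩ := (π.mem_iff x P).1 hP
      refine ⟨ρ, ⟨hρ, hPN⟩, Or.inr ?_⟩
      change k₀ x ≪ π.kernel ρ
      rw [← hP₀k]
      exact hPac
  have hkk : ∀ᵐ x ∂ν, NAm (k x) (fun w => stepD S t (x, w)) ∧ (x ∉ N₀ → k₀ x ≪ k x) := by
    filter_upwards [hex, hkA] with x hx1 hx2
    obtain ⟨ρ, hρ, hkρ⟩ := hx2 hx1
    rw [hkρ]
    exact ⟨hρ.1.2, fun h => hρ.2.resolve_left h⟩
  refine ⟨_, hkm, (hac.compProd ?_).map measurable_snocMap, ?_⟩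
  · filter_upwards [hac.ae_le hkk, measure_eq_zero_iff_ae_notMem.1 hνN₀] with x h1 h2
    exact h1.2 h2
  · intro W hW
    obtain ⟨Q, hQ, h⟩ := Good.step hS ht hν k (hkk.mono fun x h => h.1) (F := fun _ => 0)
      measurable_const (N := ∅) MeasurableSet.empty (by simp) W hW
    exact ⟨Q, hQ.1, h⟩

end Martingales

section LocalNA

open ProbabilityTheory
open scoped Matrix

theorem ae_compProd_of_ae_ae_of_nullMeasurableSet {X Y : Type*} [MeasurableSpace X]
    [MeasurableSpace Y] {μ : Measure X} [SFinite μ] {k : Kernel X Y} [IsSFiniteKernel k]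
    {p : X × Y → Prop} (hp : NullMeasurableSet {z | p z} (μ ⊗ₘ k))
    (h : ∀ᵐ x ∂μ, ∀ᵐ w ∂(k x), p (x, w)) : ∀ᵐ z ∂(μ ⊗ₘ k), p z := by
  obtain ⟨B, hB, hae⟩ := hp
  have hpB : ∀ᵐ z ∂(μ ⊗ₘ k), p z ↔ z ∈ B := hae.mem_iff
  have h1 := Measure.ae_ae_of_ae_compProd hpB
  have h2 : ∀ᵐ z ∂(μ ⊗ₘ k), z ∈ B := by
    refine Measure.ae_compProd_of_ae_ae hB ?_
    filter_upwards [h, h1] with x hx hx1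
    filter_upwards [hx, hx1] with w hw hw1
    exact hw1.1 hw
  filter_upwards [hpB, h2] with z h3 h4
  exact h3.2 h4

theorem ae_map_iff_of_nullMeasurableSet {X Y : Type*} [MeasurableSpace X] [MeasurableSpace Y]
    {μ : Measure X} {f : X → Y} (hf : AEMeasurable f μ) {p : Y → Prop}
    (hp : NullMeasurableSet {y | p y} (μ.map f)) :
    (∀ᵐ y ∂(μ.map f), p y) ↔ ∀ᵐ x ∂μ, p (f x) := by
  refine ⟨fun h => ae_of_ae_map hf h, fun h => ?_⟩
  change μ.map f {y | p y}ᶜ = 0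
  rw [Measure.map_apply₀ hf hp.compl]
  exact h

variable {Ω₁ : Type} [MeasurableSpace Ω₁] [TopologicalSpace Ω₁] [PolishSpace Ω₁] [BorelSpace Ω₁]
  {d T : ℕ} {S : (t : ℕ) → (Fin t → Ω₁) → Fin d → ℝ}
  {Pt : (t : ℕ) → (Fin t → Ω₁) → Set (ProbabilityMeasure Ω₁)}

theorem ae_measFam_succ {t : ℕ} {p : (Fin (t + 1) → Ω₁) → Prop}
    (hp : MeasurableSet[univComp (Fin (t + 1) → Ω₁)] {ω | p ω})
    (h : ∀ ν ∈ MeasFam Ω₁ Pt t, ∀ᵐ x ∂ν, ∀ P ∈ Pt t x, ∀ᵐ w ∂(P : Measure Ω₁),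
      p (snocMap (x, w))) {μ : Measure (Fin (t + 1) → Ω₁)} (hμ : μ ∈ MeasFam Ω₁ Pt (t + 1)) :
    ∀ᵐ ω ∂μ, p ω := by
  have hμp := isProbabilityMeasure_of_mem_measFam hμ
  obtain ⟨ν, hν, k, hk, hkP, rfl⟩ := exists_compProd_of_mem_measFam hμ
  have := isProbabilityMeasure_of_mem_measFam hν
  have hnull := hp _ hμp
  have hsm : AEMeasurable (snocMap (Ω₁ := Ω₁) (t := t)) (ν ⊗ₘ k) := measurable_snocMap.aemeasurable
  have h1 : ∀ᵐ z ∂(ν ⊗ₘ k), p (snocMap z) := by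
    refine ae_compProd_of_ae_ae_of_nullMeasurableSet
      (hnull.preimage (measurable_snocMap.quasiMeasurePreserving _)) ?_
    filter_upwards [h ν hν, hkP] with x h1 h2
    obtain ⟨P, hP, hPk⟩ := h2
    rw [← hPk]
    exact h1 P hP
  exact (ae_map_iff_of_nullMeasurableSet hsm hnull).2 h1

theorem ae_restr_of_forall_measFam {s t : ℕ} (hst : s ≤ t) {p : (Fin s → Ω₁) → Prop}
    (h : ∀ ν ∈ MeasFam Ω₁ Pt s, ∀ᵐ ω ∂ν, p ω) {μ : Measure (Fin t → Ω₁)}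
    (hμ : μ ∈ MeasFam Ω₁ Pt t) : ∀ᵐ ω ∂μ, p (restr Ω₁ s hst ω) :=
  ae_of_ae_map (measurable_restr hst).aemeasurable (h _ (map_restr_mem_measFam hst hμ))

theorem quasiSure_of_ae {α : Type*} [MeasurableSpace α] {PP : Set (Measure α)} {p : α → Prop}
    (hp : MeasurableSet[univComp α] {ω | p ω}) (h : ∀ P ∈ PP, ∀ᵐ ω ∂P, p ω) :
    QuasiSure PP (univComp α) p :=
  ⟨{ω | ¬ p ω}, @MeasurableSet.compl _ _ (univComp α) hp, subset_rfl, h⟩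

theorem QuasiSure.ae {α : Type*} [MeasurableSpace α] {PP : Set (Measure α)}
    {p : α → Prop} (h : QuasiSure PP (univComp α) p) {P : Measure α} (hP : P ∈ PP) : ∀ᵐ ω ∂P, p ω := by
  obtain ⟨A, -, hsub, h0⟩ := h
  exact measure_mono_null hsub (h0 P hP)

/-- The gain over the period `(t, t + 1]` of the strategy `y`. -/
def stepGain (S : (t : ℕ) → (Fin t → Ω₁) → Fin d → ℝ) (t : ℕ) (y : (Fin t → Ω₁) → Fin d → ℝ)
    (ω : Fin (t + 1) → Ω₁) : ℝ :=
  y (restr Ω₁ t t.le_succ ω) ⬝ᵥ (S (t + 1) ω - S t (restr Ω₁ t t.le_succ ω))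

theorem stepGain_snocMap (t : ℕ) (y : (Fin t → Ω₁) → Fin d → ℝ) (p : (Fin t → Ω₁) × Ω₁) :
    stepGain S t y (snocMap p) = y p.1 ⬝ᵥ stepD S t p := by
  simp only [stepGain, stepD, restr_snocMap_self p]

theorem gain_eq_sum_stepGain (H : (u : ℕ) → (Fin u → Ω₁) → Fin d → ℝ) (t : ℕ) (h : t ≤ T)
    (ω : Fin T → Ω₁) :
    gain Ω₁ S H t h ω = ∑ u : Fin t, stepGain S u (H u) (restr Ω₁ (u + 1) (u.2.trans_le h) ω) :=
  rfl

theorem measurable_comp_restr {s t : ℕ} (h : s ≤ t) {β : Type*} [MeasurableSpace β]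
    {f : (Fin s → Ω₁) → β} (hf : Measurable[univComp (Fin s → Ω₁)] f) :
    Measurable[univComp (Fin t → Ω₁)] fun ω => f (restr Ω₁ s h ω) :=
  @Measurable.comp _ _ _ (univComp _) (univComp _) _ _ _ hf
    (measurable_univComp_univComp ((measurable_restr h).mono le_univComp le_rfl))

theorem measurable_univComp_of_measurable {α β : Type*} [MeasurableSpace α] [MeasurableSpace β]
    {f : α → β} (hf : Measurable f) : Measurable[univComp α] f := hf.mono le_univComp le_rfl

theorem measurable_stepGain (hS : ∀ t, t ≤ T → Measurable (S t)) {t : ℕ} (ht : t < T)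
    {y : (Fin t → Ω₁) → Fin d → ℝ} (hy : Measurable[univComp (Fin t → Ω₁)] y) :
    Measurable[univComp (Fin (t + 1) → Ω₁)] (stepGain S t y) := by
  have h1 := measurable_comp_restr t.le_succ hy
  have h2 := measurable_univComp_of_measurable (hS (t + 1) ht)
  have h3 := measurable_univComp_of_measurable ((hS t ht.le).comp (measurable_restr t.le_succ))
  generalize univComp (Fin (t + 1) → Ω₁) = m at h1 h2 h3 ⊢
  unfold stepGain
  refine Finset.measurable_sum _ fun i _ => ?_
  exact ((measurable_pi_apply i).comp h1).mul ((measurable_pi_apply i).comp (h2.sub h3))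

theorem gain_update_zero {t : ℕ} (ht : t < T) (y : (Fin t → Ω₁) → Fin d → ℝ) (ω : Fin T → Ω₁) :
    gain Ω₁ S (Function.update (fun _ _ => 0) t y) T le_rfl ω =
      stepGain S t y (restr Ω₁ (t + 1) ht ω) := by
  rw [gain_eq_sum_stepGain, Finset.sum_eq_single ⟨t, ht⟩]
  · simp
  · intro u _ hu
    have : (u : ℕ) ≠ t := fun h => hu (Fin.ext h)
    simp [stepGain, Function.update_of_ne this]
  · simp

theorem ae_stepGain_eq_zero [Nonempty Ω₁] (hne : ∀ t, t < T → ∀ ω, (Pt t ω).Nonempty)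
    (hgraph : ∀ t, t < T →
      AnalyticSet {p : (Fin t → Ω₁) × ProbabilityMeasure Ω₁ | p.2 ∈ Pt t p.1})
    (hS : ∀ t, t ≤ T → Measurable (S t))
    (hNA : NA Ω₁ (MeasFam Ω₁ Pt T) S (fun i : Fin 0 => i.elim0)) {t : ℕ} (ht : t < T)
    {y : (Fin t → Ω₁) → Fin d → ℝ} (hy : Measurable[univComp (Fin t → Ω₁)] y)
    (hpos : ∀ x, ∀ P ∈ Pt t x, ∀ᵐ w ∂(P : Measure Ω₁), 0 ≤ y x ⬝ᵥ stepD S t (x, w))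
    {ν : Measure (Fin t → Ω₁)} (hν : ν ∈ MeasFam Ω₁ Pt t) :
    ∀ᵐ x ∂ν, ∀ P ∈ Pt t x, ∀ᵐ w ∂(P : Measure Ω₁), y x ⬝ᵥ stepD S t (x, w) = 0 := by
  have hνp := isProbabilityMeasure_of_mem_measFam hν
  have hgm := measurable_stepGain hS ht hy
  have hzero : ∀ μ ∈ MeasFam Ω₁ Pt T, ∀ᵐ ω ∂μ, stepGain S t y (restr Ω₁ (t + 1) ht ω) = 0 := by
    have hH : Pred Ω₁ d (Function.update (fun _ _ => 0) t y) := by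
      intro u
      rcases eq_or_ne u t with rfl | hu
      · simpa using hy
      · rw [Function.update_of_ne hu]
        exact @measurable_const _ _ _ (univComp _) _
    have h1 := hNA _ hH (fun _ => 0) (by
      simp only [gain_update_zero ht, Finset.univ_eq_empty, Finset.sum_empty, add_zero]
      refine quasiSure_of_ae ?_ ?_
      · have := measurable_comp_restr (t := T) ht hgm
        exact this measurableSet_Ici
      · intro μ hμ
        refine ae_restr_of_forall_measFam ht (p := fun ω => 0 ≤ stepGain S t y ω)
          (fun ν hν => ae_measFam_succ (hgm measurableSet_Ici) (fun ν _ => ?_) hν) hμ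
        refine Eventually.of_forall fun x P hP => ?_
        filter_upwards [hpos x P hP] with w hw
        rwa [mem_Ici, stepGain_snocMap])
    intro μ hμ
    simpa [gain_update_zero ht] using QuasiSure.ae h1 hμ
  obtain ⟨π⟩ := exists_param (hne t ht) (hgraph t ht)
  have hae := aemeasurable_of_univComp hy ν
  let y' := hae.mk y
  have hy' : Measurable y' := hae.measurable_mk
  let kz : Kernel ((Fin t → Ω₁) × (ℕ → ℕ)) Ω₁ := π.kernel.comap Prod.snd measurable_snd
  let B : Set (((Fin t → Ω₁) × (ℕ → ℕ)) × Ω₁) := {q | y' q.1.1 ⬝ᵥ stepD S t (q.1.1, q.2) ≠ 0}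
  have hB : MeasurableSet B := by
    have h1 : Measurable fun q : ((Fin t → Ω₁) × (ℕ → ℕ)) × Ω₁ => (q.1.1, q.2) := by fun_prop
    have h2 : Measurable fun q : ((Fin t → Ω₁) × (ℕ → ℕ)) × Ω₁ => y' q.1.1 :=
      hy'.comp (by fun_prop)
    have h3 : Measurable fun q : ((Fin t → Ω₁) × (ℕ → ℕ)) × Ω₁ =>
        y' q.1.1 ⬝ᵥ stepD S t (q.1.1, q.2) :=
      Finset.measurable_sum _ fun i _ => ((measurable_pi_apply i).comp h2).mul
        ((measurable_pi_apply i).comp ((measurable_stepD hS ht).comp h1))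
    exact (h3 (measurableSet_singleton 0)).compl
  let A : Set ((Fin t → Ω₁) × (ℕ → ℕ)) := {z | π.base z.2 = z.1} ∩
    {z | kz z (Prod.mk z ⁻¹' B) ≠ 0}
  have hA : AnalyticSet A := by
    refine AnalyticSet.inter'
      (isClosed_eq (π.cont_base.comp continuous_snd) continuous_fst).analyticSet ?_
    exact ((Kernel.measurable_kernel_prodMk_left (κ := kz) hB)
      (measurableSet_singleton 0)).compl.analyticSet
  obtain ⟨k, hk, hkm, hkA⟩ := exists_measFam_step π (hne t ht) hν hA fun p hp => hp.1
  have hz : ∀ᵐ x ∂ν, ∀ᵐ w ∂(k x), y x ⬝ᵥ stepD S t (x, w) = 0 := by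
    obtain ⟨μ, hμ, hμr⟩ := exists_extend_measFam hne hgraph (Nat.succ_le_of_lt ht) le_rfl hkm
    have h1 := hzero μ hμ
    have hp := isProbabilityMeasure_of_mem_measFam hkm
    have h2 : ∀ᵐ ω ∂((ν ⊗ₘ k).map snocMap), stepGain S t y ω = 0 := by
      have hm := hgm (measurableSet_singleton 0) _ hp
      rw [← hμr] at hm ⊢
      exact (ae_map_iff_of_nullMeasurableSet (measurable_restr _).aemeasurable hm).2 h1
    have h3 := Measure.ae_ae_of_ae_compProd (ae_of_ae_map measurable_snocMap.aemeasurable h2)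
    simpa only [stepGain_snocMap] using h3
  filter_upwards [hz, hkA, hae.ae_eq_mk] with x h1 h2 h3
  by_contra hcon
  push Not at hcon
  obtain ⟨P, hP, hPn⟩ := hcon
  obtain ⟨ρ, hρ, rfl⟩ := (π.mem_iff x P).1 hP
  obtain ⟨ρ', hρ', hkρ'⟩ := h2 ⟨ρ, hρ, fun h0 => hPn (by
    rw [h3]
    filter_upwards [measure_eq_zero_iff_ae_notMem.1 h0] with w hw
    exact hw)⟩
  refine hρ'.2 ?_
  rw [hkρ', h3] at h1
  refine measure_eq_zero_iff_ae_notMem.2 ?_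
  change ∀ᵐ w ∂(π.kernel ρ'), _
  filter_upwards [h1] with w hw
  exact not_not.2 hw

theorem ae_NAC [Nonempty Ω₁] (hne : ∀ t, t < T → ∀ ω, (Pt t ω).Nonempty)
    (hconv : ∀ t, t < T → ∀ ω, ConvexPM (Pt t ω))
    (hgraph : ∀ t, t < T →
      AnalyticSet {p : (Fin t → Ω₁) × ProbabilityMeasure Ω₁ | p.2 ∈ Pt t p.1})
    (hS : ∀ t, t ≤ T → Measurable (S t))
    (hNA : NA Ω₁ (MeasFam Ω₁ Pt T) S (fun i : Fin 0 => i.elim0)) {t : ℕ} (ht : t < T)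
    {ν : Measure (Fin t → Ω₁)} (hν : ν ∈ MeasFam Ω₁ Pt t) :
    ∀ᵐ x ∂ν, NAC (Pt t x) fun w => stepD S t (x, w) := by
  obtain ⟨π⟩ := exists_param (hne t ht) (hgraph t ht)
  have hDm := measurable_stepD hS ht
  have h0 : UpperSemianalytic fun _ : (Fin t → Ω₁) × Ω₁ => (0 : ℝ) := fun c =>
    (MeasurableSet.const (c < 0)).analyticSet
  have hg0 : Measurable[univComp (Fin t → Ω₁)] fun _ : Fin t → Ω₁ => (0 : ℝ) :=
    @measurable_const _ _ _ (univComp _) _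
  let Γ := hedges (Pt t) (stepD S t) (fun p => (fun _ : (Fin t → Ω₁) × Ω₁ => (0 : ℝ)) p -
    (fun _ : Fin t → Ω₁ => (0 : ℝ)) p.1)
  let Γ' := hedges (Pt t) (-stepD S t) (fun p => (fun _ : (Fin t → Ω₁) × Ω₁ => (0 : ℝ)) p -
    (fun _ : Fin t → Ω₁ => (0 : ℝ)) p.1)
  have hΓ := fun K (hK : IsCompact K) =>
    measurableSet_hedges_inter π (hne t ht) (hconv t ht) hDm h0 hg0 hK
  have hΓ' := fun K (hK : IsCompact K) =>
    measurableSet_hedges_inter π (hne t ht) (hconv t ht) hDm.neg h0 hg0 hK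
  have hcl : ∀ x, IsClosed (Γ x) := isClosed_hedges _ _
  have hcl' : ∀ x, IsClosed (Γ' x) := isClosed_hedges _ _
  have hcv : ∀ x, Convex ℝ (Γ x) := convex_hedges _ _
  let K : ℕ × ℕ → Set (Fin d → ℝ) := fun n =>
    Metric.closedBall (TopologicalSpace.denseSeq (Fin d → ℝ) n.1) (1 / (n.2 + 1))
  have hKc : ∀ n, IsCompact (K n) := fun n => isCompact_closedBall _ _
  have hmain : ∀ n, ∀ᵐ x ∂ν, (Γ x ∩ K n).Nonempty → (Γ' x ∩ K n).Nonempty := by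
    intro n
    obtain ⟨h, hhm, hh⟩ : ∃ h : (Fin t → Ω₁) → Fin d → ℝ, Measurable[univComp (Fin t → Ω₁)] h ∧
        ∀ x, (Γ x ∩ K n).Nonempty → h x ∈ Γ x ∩ K n := by
      generalize univComp (Fin t → Ω₁) = m at hΓ ⊢
      refine (exists_measurable_selection_closed_convex (fun x => Γ x ∩ K n)
        (fun x => (hcl x).inter (hKc n).isClosed)
        (fun x => (hcv x).inter (convex_closedBall _ _)) fun K' hK' => ?_).2
      simp only [inter_assoc]
      exact hΓ _ ((hKc n).inter hK')
    classical
    let y : (Fin t → Ω₁) → Fin d → ℝ := {x | (Γ x ∩ K n).Nonempty}.indicator h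
    have hym : Measurable[univComp (Fin t → Ω₁)] y := by
      have := hΓ _ (hKc n)
      generalize univComp (Fin t → Ω₁) = m at hhm this ⊢
      exact hhm.indicator this
    have hypos : ∀ x, ∀ P ∈ Pt t x, ∀ᵐ w ∂(P : Measure Ω₁), 0 ≤ y x ⬝ᵥ stepD S t (x, w) := by
      intro x P hP
      by_cases hx : (Γ x ∩ K n).Nonempty
      · have : y x = h x := indicator_of_mem (s := {x | (Γ x ∩ K n).Nonempty}) hx h
        rw [this]
        simpa using (hh x hx).1 P hP
      · have : y x = 0 := indicator_of_notMem (s := {x | (Γ x ∩ K n).Nonempty}) hx h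
        simp [this]
    filter_upwards [ae_stepGain_eq_zero hne hgraph hS hNA ht hym hypos hν] with x hx hxn
    have hyx : y x = h x := indicator_of_mem (s := {x | (Γ x ∩ K n).Nonempty}) hxn h
    rw [hyx] at hx
    refine ⟨h x, fun P hP => ?_, (hh x hxn).2⟩
    filter_upwards [hx P hP] with w hw
    simp [hw]
  filter_upwards [ae_all_iff.2 hmain] with x hx y hy P hP
  have hyΓ : y ∈ Γ x := fun P hP => by simpa using hy P hP
  by_contra hcon
  have hyΓ' : y ∉ Γ' x := fun h => hcon (by
    filter_upwards [hy P hP, h P hP] with w h1 h2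
    simp only [sub_zero, Pi.neg_apply, dotProduct_neg] at h2
    linarith)
  obtain ⟨ε, hε, hball⟩ := Metric.isOpen_iff.1 (hcl' x).isOpen_compl y hyΓ'
  obtain ⟨m, hm⟩ := exists_nat_one_div_lt (half_pos hε)
  obtain ⟨n, hn⟩ := (TopologicalSpace.denseRange_denseSeq (Fin d → ℝ)).exists_dist_lt y
    (Nat.one_div_pos_of_nat (α := ℝ) (n := m))
  obtain ⟨z, hz, hzK⟩ := hx (n, m) ⟨y, hyΓ, hn.le⟩
  refine hball ?_ hz
  rw [Metric.mem_ball]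
  have h1 : dist z (TopologicalSpace.denseSeq (Fin d → ℝ) n) ≤ 1 / ((m : ℝ) + 1) := hzK
  have h2 := dist_triangle_right z y (TopologicalSpace.denseSeq (Fin d → ℝ) n)
  linarith

end LocalNA

section OneStepHedge

open ProbabilityTheory
open scoped Matrix

variable {Ω₁ : Type} [MeasurableSpace Ω₁] [TopologicalSpace Ω₁] [PolishSpace Ω₁] [BorelSpace Ω₁]
  {d T : ℕ} {S : (t : ℕ) → (Fin t → Ω₁) → Fin d → ℝ}
  {Pt : (t : ℕ) → (Fin t → Ω₁) → Set (ProbabilityMeasure Ω₁)}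

theorem exists_good [Nonempty Ω₁] (hne : ∀ t, t < T → ∀ ω, (Pt t ω).Nonempty)
    (hconv : ∀ t, t < T → ∀ ω, ConvexPM (Pt t ω))
    (hgraph : ∀ t, t < T →
      AnalyticSet {p : (Fin t → Ω₁) × ProbabilityMeasure Ω₁ | p.2 ∈ Pt t p.1})
    (hS : ∀ t, t ≤ T → Measurable (S t))
    (hNA : NA Ω₁ (MeasFam Ω₁ Pt T) S (fun i : Fin 0 => i.elim0)) {t : ℕ} (ht : t ≤ T)
    {ν : Measure (Fin t → Ω₁)} (hν : ν ∈ MeasFam Ω₁ Pt t) :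
    ∃ ν' ∈ MeasFam Ω₁ Pt t, ν ≪ ν' ∧ Good S ν' univ := by
  induction t with
  | zero =>
    have := isProbabilityMeasure_of_mem_measFam hν
    exact ⟨ν, hν, Measure.AbsolutelyContinuous.rfl, good_zero ν⟩
  | succ t ih =>
    obtain ⟨ν₀, hν₀, k₀, hk₀, hkP, rfl⟩ := exists_compProd_of_mem_measFam hν
    have := isProbabilityMeasure_of_mem_measFam hν₀
    obtain ⟨ν', hν', hac, hgood⟩ := ih (by omega) hν₀
    obtain ⟨π⟩ := exists_param (hne t ht) (hgraph t ht)
    obtain ⟨μ, hμ, hμac, hμg⟩ := hgood.normal_step hS ht π (hconv t ht) (hne t ht) hν'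
      (ae_NAC hne hconv hgraph hS hNA ht hν') hac k₀ hkP
    refine ⟨μ, hμ, hμac, ?_⟩
    simpa using hμg

theorem Good.exists_extend [Nonempty Ω₁] (hne : ∀ t, t < T → ∀ ω, (Pt t ω).Nonempty)
    (hconv : ∀ t, t < T → ∀ ω, ConvexPM (Pt t ω))
    (hgraph : ∀ t, t < T →
      AnalyticSet {p : (Fin t → Ω₁) × ProbabilityMeasure Ω₁ | p.2 ∈ Pt t p.1})
    (hS : ∀ t, t ≤ T → Measurable (S t))
    (hNA : NA Ω₁ (MeasFam Ω₁ Pt T) S (fun i : Fin 0 => i.elim0)) {s t : ℕ} (hst : s ≤ t)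
    (ht : t ≤ T) {ν : Measure (Fin s → Ω₁)} (hν : ν ∈ MeasFam Ω₁ Pt s)
    {R : Set (Measure (Fin s → Ω₁))} (hg : Good S ν R) :
    ∃ μ ∈ MeasFam Ω₁ Pt t, Good S μ {Q | Q.map (restr Ω₁ s hst) ∈ R} := by
  induction t, hst using Nat.le_induction with
  | base => exact ⟨ν, hν, by simpa only [map_restr_self, ofPred_mem_eq] using hg⟩
  | succ t hst ih =>
    obtain ⟨μ, hμ, hμg⟩ := ih (by omega)
    obtain ⟨π⟩ := exists_param (hne t ht) (hgraph t ht)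
    obtain ⟨μ', hμ', -, hμ'g⟩ := hμg.normal_step hS ht π (hconv t ht) (hne t ht) hμ
      (ae_NAC hne hconv hgraph hS hNA ht hμ) (ν₀ := 0) (Measure.AbsolutelyContinuous.zero _)
      (Kernel.const _ (Measure.dirac (Classical.arbitrary Ω₁))) (by simp)
    refine ⟨μ', hμ', fun W hW => ?_⟩
    obtain ⟨Q, hQ, h⟩ := hμ'g W hW
    refine ⟨Q, ?_, h⟩
    have hQ' : (Q.map (restr Ω₁ t t.le_succ)).map (restr Ω₁ s hst) ∈ R := hQ
    rwa [Measure.map_map (measurable_restr _) (measurable_restr _)] at hQ'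

theorem ae_nonempty_hedges [Nonempty Ω₁] (hne : ∀ t, t < T → ∀ ω, (Pt t ω).Nonempty)
    (hconv : ∀ t, t < T → ∀ ω, ConvexPM (Pt t ω))
    (hgraph : ∀ t, t < T →
      AnalyticSet {p : (Fin t → Ω₁) × ProbabilityMeasure Ω₁ | p.2 ∈ Pt t p.1})
    (hS : ∀ t, t ≤ T → Measurable (S t))
    (hNA : NA Ω₁ (MeasFam Ω₁ Pt T) S (fun i : Fin 0 => i.elim0)) {t : ℕ} (ht : t < T)
    {f : (Fin (t + 1) → Ω₁) → ℝ} (hf : UpperSemianalytic f)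
    {g : (Fin t → Ω₁) → ℝ} (hg : Measurable[univComp (Fin t → Ω₁)] g)
    (hsuper : ∀ Q ∈ QSet Ω₁ (MeasFam Ω₁ Pt T) S (fun i : Fin 0 => i.elim0),
      Integrable (fun ω => f (restr Ω₁ (t + 1) ht ω)) Q ∧
      Integrable (fun ω => g (restr Ω₁ t ht.le ω)) Q ∧
      ∀ B : Set (Fin t → Ω₁), MeasurableSet B →
        ∫ ω in restr Ω₁ t ht.le ⁻¹' B, f (restr Ω₁ (t + 1) ht ω) ∂Q ≤
          ∫ ω in restr Ω₁ t ht.le ⁻¹' B, g (restr Ω₁ t ht.le ω) ∂Q)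
    {ν : Measure (Fin t → Ω₁)} (hν : ν ∈ MeasFam Ω₁ Pt t) :
    ∀ᵐ x ∂ν, (hedges (Pt t) (stepD S t) (fun p => f (snocMap p) - g p.1) x).Nonempty := by
  obtain ⟨ν', hν', hac, hgood⟩ := exists_good hne hconv hgraph hS hNA ht.le hν
  refine hac.ae_le ?_
  have hνp := isProbabilityMeasure_of_mem_measFam hν'
  obtain ⟨π⟩ := exists_param (hne t ht) (hgraph t ht)
  have hDm := measurable_stepD hS ht
  have hf' : UpperSemianalytic fun p : (Fin t → Ω₁) × Ω₁ => f (snocMap p) :=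
    hf.comp_continuous continuous_snocMap
  obtain ⟨N, hN, hNae⟩ :=
    (exists_hedges_selection π (hne t ht) (hconv t ht) hDm hf' hg).1 ν' hνp
  by_contra hcon
  have hN0 : ν' Nᶜ ≠ 0 := fun h0 => hcon (by
    filter_upwards [hNae.mem_iff, measure_eq_zero_iff_ae_notMem.1 h0] with x h1 h2
    exact h1.2 (not_not.1 h2))
  have hgae := aemeasurable_of_univComp hg ν'
  let g' := hgae.mk g
  have hg' : Measurable g' := hgae.measurable_mk
  let kz : Kernel ((Fin t → Ω₁) × (ℕ → ℕ)) Ω₁ := π.kernel.comap Prod.snd measurable_snd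
  have hpair : Continuous fun p : ((Fin t → Ω₁) × (ℕ → ℕ)) × Ω₁ => (p.1.1, p.2) := by fun_prop
  let A : Set ((Fin t → Ω₁) × (ℕ → ℕ)) := ({z | π.base z.2 = z.1} ∩
    {z | NAm (kz z) fun w => stepD S t (z.1, w)}) ∩ ({z | z.1 ∈ N} ∪
      ⋂ n : ℕ, {z | ∀ y ∈ Metric.closedBall (0 : Fin d → ℝ) n,
        ¬ ∀ᵐ w ∂(kz z), f (snocMap (z.1, w)) - g' z.1 ≤ y ⬝ᵥ stepD S t (z.1, w)})
  have hA : AnalyticSet A := by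
    refine AnalyticSet.inter' (AnalyticSet.inter'
      (isClosed_eq (π.cont_base.comp continuous_snd) continuous_fst).analyticSet
      (analyticSet_NAm kz (D := fun p => stepD S t (p.1.1, p.2)) (hDm.comp hpair.measurable)))
      (AnalyticSet.union' (measurable_fst hN).analyticSet (AnalyticSet.iInter fun n => ?_))
    exact analyticSet_forall_compact_not_ae_le kz
      (h := fun p => f (snocMap (p.1.1, p.2)) - g' p.1.1)
      ((hf'.comp_continuous hpair).sub_measurable (hg'.comp (measurable_fst.comp measurable_fst)))
      (D := fun p => stepD S t (p.1.1, p.2)) (hDm.comp hpair.measurable) (isCompact_closedBall _ _)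
  obtain ⟨k, hk, hkm, hkA⟩ := exists_measFam_step π (hne t ht) hν' hA fun p hp => hp.1.1
  have hex : ∀ᵐ x ∂ν', ∃ ρ, (x, ρ) ∈ A := by
    filter_upwards [ae_NAC hne hconv hgraph hS hNA ht hν', hNae.mem_iff, hgae.ae_eq_mk]
      with x hx1 hx2 hx3
    by_cases hxN : x ∈ N
    · obtain ⟨P₀, hP₀⟩ := hne t ht x
      obtain ⟨P, hP, -, hPN⟩ := exists_NAm_of_ac (hconv t ht x) hx1 hP₀
      obtain ⟨ρ, hρ, rfl⟩ := (π.mem_iff x P).1 hP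
      exact ⟨ρ, ⟨hρ, hPN⟩, Or.inl hxN⟩
    · have hno : ¬ (hedges (Pt t) (stepD S t) (fun p => f (snocMap p) - g p.1) x).Nonempty :=
        fun h => hxN (hx2.1 h)
      obtain ⟨P, hP, hPN, hPh⟩ := exists_NAm_not_hedgeable (hconv t ht x) (hne t ht x) hx1
        (f := fun w => f (snocMap (x, w)) - g x) hno
      obtain ⟨ρ, hρ, rfl⟩ := (π.mem_iff x P).1 hP
      refine ⟨ρ, ⟨hρ, hPN⟩, Or.inr (mem_iInter.2 fun n y _ => ?_)⟩
      have := hPh y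
      rw [hx3] at this
      exact this
  set μ₁ := (ν' ⊗ₘ k).map snocMap with hμ₁
  have hμ₁p := isProbabilityMeasure_of_mem_measFam hkm
  have hμ₁r : μ₁.map (restr Ω₁ t t.le_succ) = ν' := by
    rw [hμ₁, map_restr_map_snocMap le_rfl, Measure.fst_compProd, map_restr_self]
  have hfae := aemeasurable_of_univComp hf.measurable_univComp μ₁
  let f' := hfae.mk f
  have hf'm : Measurable f' := hfae.measurable_mk
  let F : (Fin (t + 1) → Ω₁) → ℝ := fun ω => f' ω - g' (restr Ω₁ t t.le_succ ω)
  have hF : Measurable F := hf'm.sub (hg'.comp (measurable_restr _))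
  have hkk : ∀ᵐ x ∂ν', NAm (k x) (fun w => stepD S t (x, w)) ∧ (x ∈ Nᶜ → ∀ y : Fin d → ℝ,
      ¬ ∀ᵐ w ∂(k x), F (snocMap (x, w)) ≤ y ⬝ᵥ stepD S t (x, w)) := by
    filter_upwards [hex, hkA, Measure.ae_ae_of_ae_compProd
      (ae_of_ae_map measurable_snocMap.aemeasurable hfae.ae_eq_mk)] with x h1 h2 h3
    obtain ⟨ρ, hρ, hkρ⟩ := h2 h1
    refine ⟨by rw [hkρ]; exact hρ.1.2, fun hxN y hy => ?_⟩
    obtain ⟨n, hn⟩ := exists_nat_ge ‖y‖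
    refine mem_iInter.1 (hρ.2.resolve_left hxN) n y (mem_closedBall_zero_iff.2 hn) ?_
    change ∀ᵐ w ∂(π.kernel ρ), _
    rw [← hkρ]
    filter_upwards [hy, h3] with w hw1 hw2
    simp only [F, restr_snocMap_self (x, w)] at hw1
    rw [hw2]
    exact hw1
  have hg1 := Good.step hS ht hgood k (hkk.mono fun x h => h.1) hF hN.compl
    (hkk.mono fun x h => h.2)
  have hg2 : Good S μ₁ {Q | Q ≪ μ₁ ∧ 0 < ∫ ω in restr Ω₁ t t.le_succ ⁻¹' Nᶜ, F ω ∂Q} := by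
    intro W hW
    obtain ⟨Q, hQ, hQp, hQ1, hQ2⟩ := hg1 W hW
    exact ⟨Q, ⟨hQ1, hQ.2.2 hN0⟩, hQp, hQ1, hQ2⟩
  obtain ⟨μ, hμ, hμg⟩ := hg2.exists_extend hne hconv hgraph hS hNA ht le_rfl hkm
  obtain ⟨Q, ⟨hQac, hQpos⟩, hQp, hQμ, -, -, hQm⟩ := hμg (fun _ => 0) measurable_const
  obtain ⟨hif, hig, hle⟩ := hsuper Q ⟨hQp, ⟨μ, hμ, hQμ⟩, hQm.isMartMeas, fun i => i.elim0⟩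
  have hFae : ∀ᵐ ω ∂μ₁, F ω = f ω - g (restr Ω₁ t t.le_succ ω) := by
    have h1 : g =ᵐ[ν'] g' := hgae.ae_eq_mk
    rw [← hμ₁r] at h1
    filter_upwards [hfae.ae_eq_mk, ae_of_ae_map (measurable_restr _).aemeasurable h1] with ω h2 h3
    simp only [F]
    rw [h2, h3]
  have hFQ := ae_of_ae_map (measurable_restr ht).aemeasurable (hQac.ae_le hFae)
  rw [setIntegral_map (measurable_restr _ hN.compl) hF.aestronglyMeasurable
    (measurable_restr ht).aemeasurable, setIntegral_congr_ae
      (measurable_restr ht (measurable_restr _ hN.compl)) (hFQ.mono fun ω h _ => h)]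
    at hQpos
  have h1 := hle Nᶜ hN.compl
  rw [← sub_nonpos, ← integral_sub hif.integrableOn hig.integrableOn] at h1
  exact absurd hQpos (not_lt.2 h1)

end OneStepHedge

section Decomposition

open ProbabilityTheory
open scoped Matrix

theorem integral_comp_mul_eq_zero {X Y : Type*} [MeasurableSpace X] [MeasurableSpace Y]
    {Q : Measure X} [IsFiniteMeasure Q] {r : X → Y} (hr : Measurable r) {D : X → ℝ}
    (hD : Integrable D Q) (h0 : ∀ B, MeasurableSet B → ∫ ω in r ⁻¹' B, D ω ∂Q = 0)
    {z : Y → ℝ} (hz : Measurable z) {C : ℝ} (hC : ∀ x, ‖z x‖ ≤ C) :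
    Integrable (fun ω => z (r ω) * D ω) Q ∧ ∫ ω, z (r ω) * D ω ∂Q = 0 := by
  have h_int : Integrable (fun ω => z (r ω) * D ω) Q :=
    hD.bdd_mul (hz.comp hr).aestronglyMeasurable (Eventually.of_forall fun ω => hC (r ω))
  refine ⟨h_int, ?_⟩
  have hm : MeasurableSpace.comap r ‹_› ≤ ‹MeasurableSpace X› := hr.comap_le
  have hzm : StronglyMeasurable[MeasurableSpace.comap r ‹_›] fun ω => z (r ω) :=
    (hz.comp (comap_measurable r)).stronglyMeasurable
  have hcond : (fun _ => (0 : ℝ)) =ᵐ[Q] Q[D|MeasurableSpace.comap r ‹_›] := by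
    refine ae_eq_condExp_of_forall_setIntegral_eq hm hD (fun s _ _ => integrableOn_zero) ?_
      stronglyMeasurable_const.aestronglyMeasurable
    rintro s ⟨B, hB, rfl⟩ -
    simp [h0 B hB]
  have hpull : Q[(fun ω => z (r ω)) * D|MeasurableSpace.comap r ‹_›] =ᵐ[Q] fun _ => 0 := by
    refine (condExp_mul_of_stronglyMeasurable_left hzm h_int hD).trans ?_
    filter_upwards [hcond] with ω hω
    simp [← hω]
  rw [show (fun ω => z (r ω) * D ω) = (fun ω => z (r ω)) * D from rfl, ← integral_condExp hm,
    integral_congr_ae hpull, integral_zero]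

variable {Ω₁ : Type} [MeasurableSpace Ω₁] [TopologicalSpace Ω₁] [PolishSpace Ω₁] [BorelSpace Ω₁]
  {d T : ℕ} {S : (t : ℕ) → (Fin t → Ω₁) → Fin d → ℝ}
  {Pt : (t : ℕ) → (Fin t → Ω₁) → Set (ProbabilityMeasure Ω₁)}

theorem restr_surjective [Nonempty Ω₁] {s t : ℕ} (h : s ≤ t) :
    Function.Surjective (restr Ω₁ s h) := by
  intro x
  refine ⟨fun i => if hi : (i : ℕ) < s then x ⟨i, hi⟩ else Classical.arbitrary _, ?_⟩
  ext i
  simp [restr]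

theorem exists_comp_restr [Nonempty Ω₁] {t : ℕ} (h : t ≤ T) {F : (Fin T → Ω₁) → ℝ}
    (hF : Measurable[filtr Ω₁ T t h] F) (hu : UpperSemianalytic F) :
    ∃ f : (Fin t → Ω₁) → ℝ, Measurable[univComp (Fin t → Ω₁)] f ∧ UpperSemianalytic f ∧
      ∀ ω, F ω = f (restr Ω₁ t h ω) := by
  obtain ⟨f, hf, rfl⟩ := @Measurable.exists_eq_measurable_comp _ _ _ (univComp _) _ _ _ _ _ hF
  refine ⟨f, hf, fun c => ?_, fun ω => rfl⟩
  convert (hu c).image_of_continuous (continuous_restr h) using 1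
  ext x
  constructor
  · intro hx
    obtain ⟨ω, rfl⟩ := restr_surjective h x
    exact ⟨ω, hx, rfl⟩
  · rintro ⟨ω, hω, rfl⟩
    exact hω

theorem measurable_filtr_comp_restr {s t : ℕ} (hst : s ≤ t) (ht : t ≤ T) {β : Type*}
    [MeasurableSpace β] {f : (Fin s → Ω₁) → β} (hf : Measurable[univComp (Fin s → Ω₁)] f) :
    Measurable[filtr Ω₁ T t ht] fun ω => f (restr Ω₁ s (hst.trans ht) ω) := by
  intro A hA
  exact ⟨_, measurable_comp_restr hst hf hA, rfl⟩

theorem setIntegral_stepGain_eq_zero {Q : Measure (Fin T → Ω₁)} [IsProbabilityMeasure Q] (hQ : IsMartMeas Ω₁ S Q) {t : ℕ}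
    (ht : t < T) {y : (Fin t → Ω₁) → Fin d → ℝ} (hy : Measurable y) {B : Set (Fin t → Ω₁)}
    (hB : MeasurableSet B) {C : ℝ} (hC : ∀ x ∈ B, ‖y x‖ ≤ C) :
    IntegrableOn (fun ω => stepGain S t y (restr Ω₁ (t + 1) ht ω)) (restr Ω₁ t ht.le ⁻¹' B) Q ∧
      ∫ ω in restr Ω₁ t ht.le ⁻¹' B, stepGain S t y (restr Ω₁ (t + 1) ht ω) ∂Q = 0 := by
  classical
  let D : Fin d → (Fin T → Ω₁) → ℝ := fun i ω =>
    S (t + 1) (restr Ω₁ (t + 1) ht ω) i - S t (restr Ω₁ t ht.le ω) i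
  have hD : ∀ i, Integrable (D i) Q := fun i => (hQ.1 _ ht i).sub (hQ.1 _ ht.le i)
  have h0 : ∀ i B, MeasurableSet B → ∫ ω in restr Ω₁ t ht.le ⁻¹' B, D i ω ∂Q = 0 := by
    intro i B hB
    rw [integral_sub (hQ.1 _ ht i).integrableOn (hQ.1 _ ht.le i).integrableOn, sub_eq_zero]
    exact hQ.2 t ht i _ ⟨B, le_univComp _ hB, rfl⟩
  let z : Fin d → (Fin t → Ω₁) → ℝ := fun i => B.indicator fun x => y x i
  have hz : ∀ i, Measurable (z i) := fun i => ((measurable_pi_apply i).comp hy).indicator hB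
  have hzC : ∀ i x, ‖z i x‖ ≤ max C 0 := by
    intro i x
    by_cases hx : x ∈ B
    · simp only [z, indicator_of_mem hx]
      exact ((norm_le_pi_norm (y x) i).trans (hC x hx)).trans (le_max_left _ _)
    · simp [z, indicator_of_notMem hx]
  have key := fun i => integral_comp_mul_eq_zero (measurable_restr ht.le) (hD i) (h0 i) (hz i)
    (hzC i)
  have hBm := measurable_restr ht.le hB
  have heq : (restr Ω₁ t ht.le ⁻¹' B).indicator
      (fun ω => stepGain S t y (restr Ω₁ (t + 1) ht ω)) =
      fun ω => ∑ i, z i (restr Ω₁ t ht.le ω) * D i ω := by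
    ext ω
    by_cases hx : restr Ω₁ t ht.le ω ∈ B
    · rw [indicator_of_mem (mem_preimage.2 hx)]
      simp only [z, indicator_of_mem hx]
      rfl
    · rw [indicator_of_notMem (mt mem_preimage.1 hx)]
      simp [z, indicator_of_notMem hx]
  rw [← integrable_indicator_iff hBm, ← integral_indicator hBm, heq]
  refine ⟨integrable_finsetSum _ fun i _ => (key i).1, ?_⟩
  rw [integral_finsetSum _ fun i _ => (key i).1]
  exact Finset.sum_eq_zero fun i _ => (key i).2

theorem setIntegral_le_of_le_stepGain {Q : Measure (Fin T → Ω₁)} [IsProbabilityMeasure Q] (hQ : IsMartMeas Ω₁ S Q) {t : ℕ}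
    (ht : t < T) {y : (Fin t → Ω₁) → Fin d → ℝ} (hy : Measurable[univComp (Fin t → Ω₁)] y)
    {U : (Fin T → Ω₁) → ℝ} (hU : Integrable U Q)
    (hle : ∀ᵐ ω ∂Q, U ω ≤ stepGain S t y (restr Ω₁ (t + 1) ht ω)) {A : Set (Fin T → Ω₁)}
    (hA : MeasurableSet[filtr Ω₁ T t ht.le] A) : ∫ ω in A, U ω ∂Q ≤ 0 := by
  obtain ⟨B, hB, hAB⟩ := exists_borel_ae_eq_filtr ht.le Q hA
  rw [setIntegral_congr_set hAB]
  have hp := Measure.isProbabilityMeasure_map (μ := Q)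
    (measurable_restr (Ω₁ := Ω₁) ht.le).aemeasurable
  have hae := aemeasurable_of_univComp hy (Q.map (restr Ω₁ t ht.le))
  have hae' := ae_of_ae_map (measurable_restr ht.le).aemeasurable hae.ae_eq_mk
  have hle' : ∀ᵐ ω ∂Q, U ω ≤ stepGain S t (hae.mk y) (restr Ω₁ (t + 1) ht ω) := by
    filter_upwards [hle, hae'] with ω h1 h2
    simp only [stepGain, restr_restr] at h1 ⊢
    rwa [← h2]
  let s : ℕ → Set (Fin t → Ω₁) := fun n => B ∩ {x | ‖hae.mk y x‖ ≤ n}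
  have hs : ∀ n, MeasurableSet (s n) := fun n =>
    hB.inter (hae.measurable_mk.norm measurableSet_Iic)
  have hmono : Monotone s := fun m n hmn =>
    inter_subset_inter_right _ fun x hx => le_trans (mem_ofPred.1 hx) (Nat.cast_le.2 hmn)
  have hunion : ⋃ n, restr Ω₁ t ht.le ⁻¹' s n = restr Ω₁ t ht.le ⁻¹' B := by
    rw [← preimage_iUnion]
    congr 1
    ext x
    simp only [s, mem_iUnion, mem_inter_iff]
    exact ⟨fun ⟨n, h, _⟩ => h, fun h => (exists_nat_ge ‖hae.mk y x‖).imp fun n hn => ⟨h, hn⟩⟩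
  have hlim := tendsto_setIntegral_of_monotone (μ := Q) (f := U)
    (fun n => measurable_restr ht.le (hs n)) (fun m n h => preimage_mono (hmono h))
    hU.integrableOn
  rw [hunion] at hlim
  refine le_of_tendsto' hlim fun n => ?_
  obtain ⟨h1, h2⟩ := setIntegral_stepGain_eq_zero hQ ht hae.measurable_mk (hs n)
    fun x hx => hx.2
  rw [← h2]
  exact setIntegral_mono_ae hU.integrableOn h1 hle'

theorem exists_step_hedge [Nonempty Ω₁] (hne : ∀ t, t < T → ∀ ω, (Pt t ω).Nonempty)
    (hconv : ∀ t, t < T → ∀ ω, ConvexPM (Pt t ω))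
    (hgraph : ∀ t, t < T →
      AnalyticSet {p : (Fin t → Ω₁) × ProbabilityMeasure Ω₁ | p.2 ∈ Pt t p.1})
    (hS : ∀ t, t ≤ T → Measurable (S t))
    (hNA : NA Ω₁ (MeasFam Ω₁ Pt T) S (fun i : Fin 0 => i.elim0)) {t : ℕ} (ht : t < T)
    {f : (Fin (t + 1) → Ω₁) → ℝ} (hf : UpperSemianalytic f) {g : (Fin t → Ω₁) → ℝ}
    (hg : Measurable[univComp (Fin t → Ω₁)] g)
    (hsuper : ∀ Q ∈ QSet Ω₁ (MeasFam Ω₁ Pt T) S (fun i : Fin 0 => i.elim0),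
      Integrable (fun ω => f (restr Ω₁ (t + 1) ht ω)) Q ∧
      Integrable (fun ω => g (restr Ω₁ t ht.le ω)) Q ∧
      ∀ B : Set (Fin t → Ω₁), MeasurableSet B →
        ∫ ω in restr Ω₁ t ht.le ⁻¹' B, f (restr Ω₁ (t + 1) ht ω) ∂Q ≤
          ∫ ω in restr Ω₁ t ht.le ⁻¹' B, g (restr Ω₁ t ht.le ω) ∂Q) :
    ∃ y : (Fin t → Ω₁) → Fin d → ℝ, Measurable[univComp (Fin t → Ω₁)] y ∧
      ∀ μ ∈ MeasFam Ω₁ Pt T, ∀ᵐ ω ∂μ,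
        f (restr Ω₁ (t + 1) ht ω) - g (restr Ω₁ t ht.le ω) ≤
          stepGain S t y (restr Ω₁ (t + 1) ht ω) := by
  obtain ⟨π⟩ := exists_param (hne t ht) (hgraph t ht)
  obtain ⟨-, y, hy, hyh⟩ := exists_hedges_selection π (hne t ht) (hconv t ht)
    (measurable_stepD hS ht) (hf.comp_continuous continuous_snocMap) hg
  refine ⟨y, hy, fun μ hμ => ?_⟩
  refine ae_restr_of_forall_measFam ht (p := fun ω => f ω - g (restr Ω₁ t t.le_succ ω) ≤
    stepGain S t y ω) (fun μ' hμ' => ?_) hμ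
  refine ae_measFam_succ ?_ (fun ν hν => ?_) hμ'
  · have h1 := hf.measurable_univComp
    have h2 := measurable_comp_restr t.le_succ hg
    have h3 := measurable_stepGain hS ht hy
    generalize univComp (Fin (t + 1) → Ω₁) = m at h1 h2 h3 ⊢
    exact measurableSet_le (h1.sub h2) h3
  · filter_upwards [ae_nonempty_hedges hne hconv hgraph hS hNA ht hf hg hsuper hν] with x hx P hP
    filter_upwards [hyh x hx P hP] with w hw
    rw [stepGain_snocMap, restr_snocMap_self]
    exact hw

theorem exists_decomposition [Nonempty Ω₁] (hne : ∀ t, t < T → ∀ ω, (Pt t ω).Nonempty)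
    (hconv : ∀ t, t < T → ∀ ω, ConvexPM (Pt t ω))
    (hgraph : ∀ t, t < T →
      AnalyticSet {p : (Fin t → Ω₁) × ProbabilityMeasure Ω₁ | p.2 ∈ Pt t p.1})
    (hS : ∀ t, t ≤ T → Measurable (S t))
    (hNA : NA Ω₁ (MeasFam Ω₁ Pt T) S (fun i : Fin 0 => i.elim0))
    {V : ℕ → (Fin T → Ω₁) → ℝ}
    (hV : ∀ (t : ℕ) (h : t ≤ T), Measurable[filtr Ω₁ T t h] (V t))
    (hu : ∀ t : ℕ, t ≤ T → UpperSemianalytic (V t))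
    (hsuper : ∀ Q ∈ QSet Ω₁ (MeasFam Ω₁ Pt T) S (fun i : Fin 0 => i.elim0),
      IsSupermart Ω₁ V Q) :
    ∃ H : (u : ℕ) → (Fin u → Ω₁) → Fin d → ℝ, Pred Ω₁ d H ∧
      ∃ K : ℕ → (Fin T → Ω₁) → ℝ,
        (∀ (t : ℕ) (h : t ≤ T), Measurable[filtr Ω₁ T t h] (K t)) ∧
        (∀ ω, K 0 ω = 0) ∧
        (∀ t : ℕ, t + 1 ≤ T → ∀ ω, K t ω ≤ K (t + 1) ω) ∧
        (∀ (t : ℕ) (h : t ≤ T),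
          QuasiSure (MeasFam Ω₁ Pt T) (univComp (Fin T → Ω₁))
            (fun ω => V t ω = V 0 ω + gain Ω₁ S H t h ω - K t ω)) := by
  choose v hvm hvu hvV using fun t (h : t ≤ T) => exists_comp_restr h (hV t h) (hu t h)
  have hex : ∀ t, ∃ y : (Fin t → Ω₁) → Fin d → ℝ, Measurable[univComp (Fin t → Ω₁)] y ∧
      ∀ ht : t < T, ∀ μ ∈ MeasFam Ω₁ Pt T, ∀ᵐ ω ∂μ,
        V (t + 1) ω - V t ω ≤ stepGain S t y (restr Ω₁ (t + 1) ht ω) := by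
    intro t
    by_cases ht : t < T
    · obtain ⟨y, hy, h⟩ := exists_step_hedge hne hconv hgraph hS hNA ht (hvu (t + 1) ht)
        (hvm t ht.le) fun Q hQ => by
          simp only [← hvV]
          exact ⟨(hsuper Q hQ).1 _ ht, (hsuper Q hQ).1 _ ht.le,
            fun B hB => (hsuper Q hQ).2 t ht _ ⟨B, le_univComp _ hB, rfl⟩⟩
      refine ⟨y, hy, fun _ μ hμ => ?_⟩
      simpa only [← hvV] using h μ hμ
    · exact ⟨fun _ => 0, @measurable_const _ _ _ (univComp _) _, fun h => absurd h ht⟩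
  choose H hHm hH using hex
  let E : ℕ → (Fin T → Ω₁) → ℝ := fun u ω =>
    if h : u < T then stepGain S u (H u) (restr Ω₁ (u + 1) h ω) else 0
  have hE : ∀ {u} (h : u < T) ω, E u ω = stepGain S u (H u) (restr Ω₁ (u + 1) h ω) :=
    fun h ω => dif_pos h
  let R : ℕ → (Fin T → Ω₁) → ℝ := fun u ω => E u ω - (V (u + 1) ω - V u ω)
  have hR : ∀ {u t} (_ : u < t) (ht : t ≤ T), Measurable[filtr Ω₁ T t ht] (R u) := by
    intro u t hut ht
    have h1 := measurable_filtr_comp_restr (T := T) hut ht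
      (measurable_stepGain hS (hut.trans_le ht) (hHm u))
    have h2 := measurable_filtr_comp_restr (T := T) hut ht (hvm (u + 1) (hut.trans_le ht))
    have h3 := measurable_filtr_comp_restr (T := T) hut.le ht (hvm u (hut.le.trans ht))
    simp only [← hvV, ← hE] at h1 h2 h3
    generalize filtr Ω₁ T t ht = m at h1 h2 h3 ⊢
    exact h1.sub (h2.sub h3)
  have hqs : QuasiSure (MeasFam Ω₁ Pt T) (univComp (Fin T → Ω₁)) fun ω => ∀ u < T, 0 ≤ R u ω := by
    refine quasiSure_of_ae ?_ fun μ hμ => ?_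
    · have h1 : ∀ u, u < T → Measurable[univComp (Fin T → Ω₁)] (R u) := fun u h =>
        (hR h le_rfl).mono (MeasurableSpace.comap_le_iff_le_map.2 le_rfl) le_rfl
      generalize univComp (Fin T → Ω₁) = m at h1 ⊢
      have : {ω | ∀ u < T, 0 ≤ R u ω} = ⋂ u, ⋂ (_ : u < T), R u ⁻¹' Ici 0 := by
        ext; simp
      rw [this]
      exact MeasurableSet.iInter fun u => MeasurableSet.iInter fun h => h1 u h measurableSet_Ici
    · refine ae_all_iff.2 fun u => ?_
      by_cases h : u < T
      · filter_upwards [hH u h μ hμ] with ω hω _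
        simp only [R, hE h]
        linarith
      · exact Eventually.of_forall fun ω h' => absurd h' h
  refine ⟨H, hHm, fun t ω => ∑ u ∈ Finset.range t, max 0 (R u ω), fun t ht => ?_, fun ω => by simp,
    fun t _ ω => ?_, fun t ht => ?_⟩
  · have h1 : ∀ u ∈ Finset.range t, Measurable[filtr Ω₁ T t ht] (R u) := fun u hu =>
      hR (Finset.mem_range.1 hu) ht
    generalize filtr Ω₁ T t ht = m at h1 ⊢
    exact Finset.measurable_sum _ fun u hu => measurable_const.max (h1 u hu)
  · simp only [Finset.sum_range_succ]
    linarith [le_max_left 0 (R t ω)]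
  · obtain ⟨A, hA, hsub, h0⟩ := hqs
    refine ⟨A, hA, fun ω hω => hsub fun hpos => hω ?_, h0⟩
    have h1 : gain Ω₁ S H t ht ω = ∑ u ∈ Finset.range t, E u ω := by
      rw [gain_eq_sum_stepGain, ← Fin.sum_univ_eq_sum_range (fun u => E u ω)]
      exact Finset.sum_congr rfl fun u _ => (hE (u.2.trans_le ht) ω).symm
    have h2 : ∑ u ∈ Finset.range t, max 0 (R u ω) =
        ∑ u ∈ Finset.range t, E u ω - (V t ω - V 0 ω) := by
      rw [← Finset.sum_range_sub (fun u => V u ω), ← Finset.sum_sub_distrib]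
      exact Finset.sum_congr rfl fun u hu =>
        max_eq_right (hpos u ((Finset.mem_range.1 hu).trans_le ht))
    beta_reduce
    rw [h1, h2]
    ring

theorem isSupermart_of_decomposition {V : ℕ → (Fin T → Ω₁) → ℝ} (hV0 : Measurable[filtr Ω₁ T 0 (Nat.zero_le T)] (V 0))
    {Q : Measure (Fin T → Ω₁)}
    (hQ : Q ∈ QSet Ω₁ (MeasFam Ω₁ Pt T) S (fun i : Fin 0 => i.elim0))
    (h_int : ∀ t : ℕ, 1 ≤ t → t ≤ T → Integrable (V t) Q)
    {H : (u : ℕ) → (Fin u → Ω₁) → Fin d → ℝ} (hH : Pred Ω₁ d H) {K : ℕ → (Fin T → Ω₁) → ℝ}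
    (hK : ∀ t : ℕ, t + 1 ≤ T → ∀ ω, K t ω ≤ K (t + 1) ω)
    (hdec : ∀ (t : ℕ) (h : t ≤ T), QuasiSure (MeasFam Ω₁ Pt T) (univComp (Fin T → Ω₁))
      (fun ω => V t ω = V 0 ω + gain Ω₁ S H t h ω - K t ω)) : IsSupermart Ω₁ V Q := by
  obtain ⟨hQp, ⟨P, hP, hQP⟩, hQm, -⟩ := hQ
  have hall : ∀ t, t ≤ T → Integrable (V t) Q := by
    intro t ht
    rcases t.eq_zero_or_pos with rfl | h
    · obtain ⟨f, -, hf⟩ := @Measurable.exists_eq_measurable_comp _ _ _ (univComp _) _ _ _ _ _ hV0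
      have : V 0 = fun _ => f Fin.elim0 := by
        rw [hf]
        ext ω
        exact congrArg f (Subsingleton.elim _ _)
      rw [this]
      exact integrable_const _
    · exact h_int t h ht
  refine ⟨hall, fun t ht A hA => ?_⟩
  have hle : ∀ᵐ ω ∂Q, V (t + 1) ω - V t ω ≤ stepGain S t (H t) (restr Ω₁ (t + 1) ht ω) := by
    filter_upwards [hQP.ae_le (QuasiSure.ae (hdec (t + 1) ht) hP),
      hQP.ae_le (QuasiSure.ae (hdec t (t.le_succ.trans ht)) hP)] with ω h1 h2
    rw [gain_eq_sum_stepGain, Fin.sum_univ_castSucc] at h1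
    rw [gain_eq_sum_stepGain] at h2
    have := hK t ht ω
    simp only [Fin.val_castSucc, Fin.val_last] at h1
    linarith
  have := setIntegral_le_of_le_stepGain hQm ht (hH t)
    ((hall _ ht).sub (hall t (t.le_succ.trans ht))) hle hA
  simp only [Pi.sub_apply] at this
  rwa [integral_sub (hall _ ht).integrableOn (hall t (t.le_succ.trans ht)).integrableOn,
    sub_nonpos] at this

end Decomposition

end BN

open BN in
/-- **Nondominated Optional Decomposition Theorem** (Theorem 6.1). Under `NA(𝒫)`,
an adapted process `V` whose components are upper semianalytic and `Q`-integrable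
for every martingale measure `Q ∈ 𝒬` is a supermartingale under every `Q ∈ 𝒬` iff
`V_t = V_0 + (H·S)_t - K_t` `𝒫`-q.s. for a predictable `H` and an adapted
nondecreasing process `K` with `K₀ = 0`. -/
theorem nondominated_optional_decomposition
    (Ω₁ : Type) [MeasurableSpace Ω₁] [TopologicalSpace Ω₁] [PolishSpace Ω₁]
    [BorelSpace Ω₁] [Nonempty Ω₁] (T d : ℕ)
    (Pt : (t : ℕ) → (Fin t → Ω₁) → Set (ProbabilityMeasure Ω₁))
    (hPtne : ∀ t, t < T → ∀ ω, (Pt t ω).Nonempty)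
    (hPtconv : ∀ t, t < T → ∀ ω, ConvexPM (Pt t ω))
    (hPtgraph : ∀ t, t < T →
      AnalyticSet {p : (Fin t → Ω₁) × ProbabilityMeasure Ω₁ | p.2 ∈ Pt t p.1})
    (S : (t : ℕ) → (Fin t → Ω₁) → Fin d → ℝ) (hS : ∀ t, t ≤ T → Measurable (S t))
    (hNA : NA Ω₁ (MeasFam Ω₁ Pt T) S (fun i : Fin 0 => i.elim0))
    (V : ℕ → (Fin T → Ω₁) → ℝ)
    (hVadapt : ∀ (t : ℕ) (h : t ≤ T), Measurable[filtr Ω₁ T t h] (V t))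
    (hVusa : ∀ t : ℕ, t ≤ T → UpperSemianalytic (V t))
    (hVint : ∀ t : ℕ, 1 ≤ t → t ≤ T →
      ∀ Q ∈ QSet Ω₁ (MeasFam Ω₁ Pt T) S (fun i : Fin 0 => i.elim0), Integrable (V t) Q) :
    ((∀ Q ∈ QSet Ω₁ (MeasFam Ω₁ Pt T) S (fun i : Fin 0 => i.elim0), IsSupermart Ω₁ V Q) ↔
      ∃ H : (u : ℕ) → (Fin u → Ω₁) → Fin d → ℝ, Pred Ω₁ d H ∧
        ∃ K : ℕ → (Fin T → Ω₁) → ℝ,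
          (∀ (t : ℕ) (h : t ≤ T), Measurable[filtr Ω₁ T t h] (K t)) ∧
          (∀ ω, K 0 ω = 0) ∧
          (∀ t : ℕ, t + 1 ≤ T → ∀ ω, K t ω ≤ K (t + 1) ω) ∧
          (∀ (t : ℕ) (h : t ≤ T),
            QuasiSure (MeasFam Ω₁ Pt T) (univComp (Fin T → Ω₁))
              (fun ω => V t ω = V 0 ω + gain Ω₁ S H t h ω - K t ω))) := by
  exact ⟨exists_decomposition hPtne hPtconv hPtgraph hS hNA hVadapt hVusa,
    fun ⟨_, hH, _, _, _, hK, hdec⟩ Q hQ => isSupermart_of_decomposition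
      (hVadapt 0 (Nat.zero_le T)) hQ (fun t h1 ht => hVint t h1 ht Q hQ) hH hK hdec⟩
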